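/- Kato–Ponce commutator estimate (special case p = 2, s ≥ 1 integer): there exists C such that for smooth compactly supported f and divergence-free g, ‖Λ^s(f·∇g) − f·∇Λ^s g‖_{L^2} ≤ C(‖∇f‖_{L^∞}‖Λ^s g‖_{L^2} + ‖Λ^s f‖_{L^2}‖∇g‖_{L^∞}), where Λ = (−Δ)^{1/2}. -/

import Mathlib

open MeasureTheory
open scoped FourierTransform ENNReal

/-- The fractional Laplacian `Λˢ = (−Δ)^{s/2}`, defined via the Fourier multiplier `‖ξ‖ˢ`. -/
noncomputable def Lam {n : ℕ} (s : ℝ) (h : EuclideanSpace ℝ (Fin n) → ℂ)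
    (x : EuclideanSpace ℝ (Fin n)) : ℂ :=
  𝓕⁻ (fun ξ => ((‖ξ‖ ^ s : ℝ) : ℂ) * 𝓕 h ξ) x


section Part1

open MeasureTheory
open scoped FourierTransform ENNReal

namespace KP

section NcPG

variable {V : Type*} [NormedAddCommGroup V]

/-- Continuous functions of rapid decay. -/
def Nc (F : V → ℂ) : Prop :=
  Continuous F ∧ ∀ k : ℕ, ∃ C : ℝ, 0 ≤ C ∧ ∀ x, (1 + ‖x‖) ^ k * ‖F x‖ ≤ C

/-- Continuous functions of polynomial growth. -/
def PG (f : V → ℝ) : Prop :=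
  Continuous f ∧ ∃ (C : ℝ) (k : ℕ), 0 ≤ C ∧ ∀ x, |f x| ≤ C * (1 + ‖x‖) ^ k

lemma PG.cont {f : V → ℝ} (hf : PG f) : Continuous f := hf.1
lemma Nc.cont {f : V → ℂ} (hf : Nc f) : Continuous f := hf.1

lemma PG.const (c : ℝ) : PG (fun _ : V => c) :=
  ⟨continuous_const, |c|, 0, abs_nonneg c, fun x => by simp⟩

lemma PG.mul {f g : V → ℝ} (hf : PG f) (hg : PG g) : PG (fun x => f x * g x) := by
  obtain ⟨hfc, C, k, hC, hfb⟩ := hf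
  obtain ⟨hgc, D, l, hD, hgb⟩ := hg
  refine ⟨hfc.mul hgc, C * D, k + l, by positivity, fun x => ?_⟩
  rw [abs_mul, pow_add]
  calc |f x| * |g x| ≤ (C * (1 + ‖x‖) ^ k) * (D * (1 + ‖x‖) ^ l) := by
        gcongr
        · exact hfb x
        · exact hgb x
    _ = _ := by ring

lemma PG.add {f g : V → ℝ} (hf : PG f) (hg : PG g) : PG (fun x => f x + g x) := by
  obtain ⟨hfc, C, k, hC, hfb⟩ := hf
  obtain ⟨hgc, D, l, hD, hgb⟩ := hg
  refine ⟨hfc.add hgc, C + D, k + l, by positivity, fun x => ?_⟩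
  have h1 : (1:ℝ) ≤ 1 + ‖x‖ := by linarith [norm_nonneg x]
  calc |f x + g x| ≤ |f x| + |g x| := abs_add_le _ _
    _ ≤ C * (1 + ‖x‖) ^ k + D * (1 + ‖x‖) ^ l := add_le_add (hfb x) (hgb x)
    _ ≤ C * (1 + ‖x‖) ^ (k + l) + D * (1 + ‖x‖) ^ (k + l) := by
        gcongr
        · omega
        · omega
    _ = _ := by ring

lemma PG.neg {f : V → ℝ} (hf : PG f) : PG (fun x => - f x) := by
  have := (PG.const (V := V) (-1)).mul hf
  simpa using this

lemma PG.sub {f g : V → ℝ} (hf : PG f) (hg : PG g) : PG (fun x => f x - g x) := by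
  simpa [sub_eq_add_neg] using hf.add hg.neg

lemma PG.pow {f : V → ℝ} (hf : PG f) (k : ℕ) : PG (fun x => f x ^ k) := by
  induction k with
  | zero => simpa using PG.const (V := V) 1
  | succ k ih => simpa [pow_succ] using ih.mul hf

lemma PG.sum {ι : Type*} (s : Finset ι) {f : ι → V → ℝ} (hf : ∀ i ∈ s, PG (f i)) :
    PG (fun x => ∑ i ∈ s, f i x) := by
  classical
  induction s using Finset.induction_on with
  | empty => simpa using PG.const (V := V) 0
  | insert a s ha ih =>
    simp only [Finset.sum_insert ha]
    exact (hf a (by simp)).add (ih fun i hi => hf i (by simp [hi]))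

lemma PG.of_le {f : V → ℝ} (hf : Continuous f) {g : V → ℝ} (hg : PG g)
    (h : ∀ x, |f x| ≤ |g x|) : PG f := by
  obtain ⟨-, C, k, hC, hb⟩ := hg
  exact ⟨hf, C, k, hC, fun x => (h x).trans (hb x)⟩

lemma PG.norm_rpow {j : ℝ} (hj : 0 ≤ j) : PG (fun x : V => ‖x‖ ^ j) := by
  refine ⟨continuous_norm.rpow_const (fun _ => Or.inr hj), 1, ⌈j⌉₊, zero_le_one, fun x => ?_⟩
  rw [abs_of_nonneg (by positivity), one_mul]
  have h1 : (1:ℝ) ≤ 1 + ‖x‖ := by linarith [norm_nonneg x]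
  calc ‖x‖ ^ j ≤ (1 + ‖x‖) ^ j := by gcongr; linarith
    _ ≤ (1 + ‖x‖) ^ (⌈j⌉₊ : ℝ) := Real.rpow_le_rpow_of_exponent_le h1 (Nat.le_ceil j)
    _ = _ := Real.rpow_natCast _ _

lemma PG.comp {W : Type*} [NormedAddCommGroup W] {f : V → ℝ} (hf : PG f) {φ : W → V}
    (hφ : Continuous φ) {K : ℝ} (hK : 1 ≤ K) (hb : ∀ w, ‖φ w‖ ≤ K * ‖w‖) :
    PG (fun w => f (φ w)) := by
  obtain ⟨hfc, C, k, hC, hfb⟩ := hf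
  refine ⟨hfc.comp hφ, C * K ^ k, k, by positivity, fun w => (hfb _).trans ?_⟩
  rw [mul_assoc, ← mul_pow]
  gcongr
  nlinarith [hb w, norm_nonneg w]

lemma PG.fst {W : Type*} [NormedAddCommGroup W] {f : V → ℝ} (hf : PG f) :
    PG (fun p : V × W => f p.1) :=
  hf.comp continuous_fst le_rfl (fun w => by simpa using norm_fst_le w)

lemma PG.snd {W : Type*} [NormedAddCommGroup W] {f : W → ℝ} (hf : PG f) :
    PG (fun p : V × W => f p.2) :=
  hf.comp continuous_snd le_rfl (fun w => by simpa using norm_snd_le w)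

lemma PG.plus {f : V → ℝ} (hf : PG f) : PG (fun p : V × V => f (p.1 + p.2)) :=
  hf.comp (by fun_prop) (K := 2) (by norm_num)
    (fun w => by linarith [norm_add_le w.1 w.2, norm_fst_le w, norm_snd_le w])

lemma PG.swap {f : V × V → ℝ} (hf : PG f) : PG (fun p : V × V => f p.swap) :=
  hf.comp continuous_swap le_rfl (fun w => by
    rw [one_mul, Prod.norm_def, Prod.norm_def]; simp [max_comm])

lemma Nc.mul_pg {F : V → ℂ} (hF : Nc F) {f : V → ℝ} (hf : PG f) :
    Nc (fun x => (f x : ℂ) * F x) := by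
  obtain ⟨hFc, hFb⟩ := hF
  obtain ⟨hfc, C, k, hC, hfb⟩ := hf
  refine ⟨(Complex.continuous_ofReal.comp hfc).mul hFc, fun l => ?_⟩
  obtain ⟨D, hD, hDb⟩ := hFb (l + k)
  refine ⟨C * D, by positivity, fun x => ?_⟩
  rw [norm_mul, Complex.norm_real, Real.norm_eq_abs]
  calc (1 + ‖x‖) ^ l * (|f x| * ‖F x‖) ≤ (1 + ‖x‖) ^ l * ((C * (1 + ‖x‖) ^ k) * ‖F x‖) := by
        gcongr; exact hfb x
    _ = C * ((1 + ‖x‖) ^ (l + k) * ‖F x‖) := by rw [pow_add]; ring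
    _ ≤ C * D := by gcongr; exact hDb x

lemma Nc.bdd {F : V → ℂ} (hF : Nc F) : ∃ C : ℝ, 0 ≤ C ∧ ∀ x, ‖F x‖ ≤ C := by
  obtain ⟨C, hC, h⟩ := hF.2 0
  exact ⟨C, hC, fun x => by simpa using h x⟩

lemma Nc.mul_bdd {F G : V → ℂ} (hF : Nc F) (hG : Continuous G) {C : ℝ} 
    (hb : ∀ x, ‖G x‖ ≤ C) : Nc (fun x => F x * G x) := by
  refine ⟨hF.1.mul hG, fun k => ?_⟩
  obtain ⟨D, hD, h⟩ := hF.2 k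
  refine ⟨D * max C 0, by positivity, fun x => ?_⟩
  rw [norm_mul, ← mul_assoc]
  exact mul_le_mul (h x) ((hb x).trans (le_max_left _ _)) (norm_nonneg _) hD

lemma Nc.prod {F G : V → ℂ} (hF : Nc F) (hG : Nc G) :
    Nc (fun p : V × V => F p.1 * G p.2) := by
  refine ⟨(hF.1.comp continuous_fst).mul (hG.1.comp continuous_snd), fun k => ?_⟩
  obtain ⟨C, hC, h⟩ := hF.2 k
  obtain ⟨D, hD, h'⟩ := hG.2 k
  refine ⟨C * D, by positivity, fun p => ?_⟩
  rw [norm_mul]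
  calc (1 + ‖p‖) ^ k * (‖F p.1‖ * ‖G p.2‖)
      ≤ ((1 + ‖p.1‖) * (1 + ‖p.2‖)) ^ k * (‖F p.1‖ * ‖G p.2‖) := by
        gcongr
        rw [Prod.norm_def]
        rcases max_cases ‖p.1‖ ‖p.2‖ with h | h <;> rw [h.1] <;>
          nlinarith [norm_nonneg p.1, norm_nonneg p.2]
    _ = ((1 + ‖p.1‖) ^ k * ‖F p.1‖) * ((1 + ‖p.2‖) ^ k * ‖G p.2‖) := by rw [mul_pow]; ring
    _ ≤ C * D := mul_le_mul (h _) (h' _) (by positivity) hC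

lemma Nc.add {F G : V → ℂ} (hF : Nc F) (hG : Nc G) : Nc (fun x => F x + G x) := by
  refine ⟨hF.1.add hG.1, fun k => ?_⟩
  obtain ⟨C, hC, h⟩ := hF.2 k
  obtain ⟨D, hD, h'⟩ := hG.2 k
  refine ⟨C + D, by positivity, fun x => ?_⟩
  have := norm_add_le (F x) (G x)
  have h0 : 0 ≤ (1 + ‖x‖) ^ k := by positivity
  nlinarith [h x, h' x]

lemma Nc.const_mul {F : V → ℂ} (hF : Nc F) (c : ℂ) : Nc (fun x => c * F x) := by
  have := hF.mul_bdd (G := fun _ => c) continuous_const (C := ‖c‖) (fun _ => le_rfl)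
  simpa [mul_comm] using this

variable [NormedSpace ℝ V]

lemma Nc.of_schwartz (f : SchwartzMap V ℂ) : Nc (fun x => f x) := by
  refine ⟨f.continuous, fun k => ?_⟩
  have h := SchwartzMap.one_add_le_sup_seminorm_apply (𝕜 := ℝ) (m := (k, 0)) (k := k) (n := 0)
    le_rfl le_rfl f
  refine ⟨2 ^ k * ((Finset.Iic ((k, 0) : ℕ × ℕ)).sup fun m => SchwartzMap.seminorm ℝ m.1 m.2) f,
    by positivity, fun x => ?_⟩
  simpa using h x

variable [FiniteDimensional ℝ V] [MeasurableSpace V] [BorelSpace V] {μ : Measure V}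
  [μ.IsAddHaarMeasure]

lemma Nc.integrable {F : V → ℂ} (hF : Nc F) : Integrable F μ := by
  obtain ⟨C, hC, h⟩ := hF.2 (Module.finrank ℝ V + 1)
  have hr : (Module.finrank ℝ V : ℝ) < ((Module.finrank ℝ V + 1 : ℕ) : ℝ) := by push_cast; linarith
  refine ((integrable_one_add_norm (μ := μ) hr).const_mul C).mono' hF.1.aestronglyMeasurable
    (Filter.Eventually.of_forall fun x => ?_)
  have hp : 0 < 1 + ‖x‖ := by positivity
  rw [Real.rpow_neg hp.le, Real.rpow_natCast, ← div_eq_mul_inv, le_div_iff₀ (by positivity)]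
  linarith [h x]

lemma Nc.memLp {F : V → ℂ} (hF : Nc F) : MemLp F 2 μ := by
  obtain ⟨C, hC, h⟩ := hF.bdd
  have h1 : Nc (fun x => (‖F x‖ : ℂ) * F x) := by
    refine hF.mul_pg ⟨hF.1.norm, C, 0, hC, fun x => by simpa using h x⟩
  rw [memLp_two_iff_integrable_sq_norm hF.1.aestronglyMeasurable]
  refine (h1.integrable (μ := μ)).norm.congr (Filter.Eventually.of_forall fun x => ?_)
  simp [pow_two]

end NcPG

end KP

end Part1

section Part2

open MeasureTheory
open scoped FourierTransform ENNReal ContDiff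

namespace KP

/-- Euclidean space. -/
abbrev EE (n : ℕ) : Type := EuclideanSpace ℝ (Fin n)

variable {n : ℕ}

/-- Fourier transform of Schwartz functions. -/
noncomputable abbrev ft (a : SchwartzMap (EE n) ℂ) : SchwartzMap (EE n) ℂ := 𝓕 a

lemma fourier_self_adj {f g : EE n → ℂ} (hf : Integrable f) (hg : Integrable g) :
    ∫ ξ, 𝓕 f ξ * g ξ = ∫ x, f x * 𝓕 g x := by
  simpa using! VectorFourier.integral_bilin_fourierIntegral_eq_flip (ContinuousLinearMap.mul ℂ ℂ)
    (L := innerₗ (EE n)) Real.continuous_fourierChar continuous_inner hf hg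

lemma fourier_cont {f : EE n → ℂ} (hf : Integrable f) : Continuous (𝓕 f) :=
  VectorFourier.fourierIntegral_continuous Real.continuous_fourierChar
    (L := innerₗ (EE n)) continuous_inner hf

lemma fourier_norm_le (f : EE n → ℂ) (x : EE n) : ‖𝓕 f x‖ ≤ ∫ v, ‖f v‖ :=
  VectorFourier.norm_fourierIntegral_le_integral_norm _ _ _ _ _

lemma fourierInv_cont {f : EE n → ℂ} (hf : Integrable f) : Continuous (𝓕⁻ f) := by
  have : 𝓕⁻ f = fun x => 𝓕 f (-x) := by ext x; exact Real.fourierInv_eq_fourier_neg f x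
  rw [this]; exact (fourier_cont hf).comp continuous_neg

lemma fourierInv_norm_le (f : EE n → ℂ) (x : EE n) : ‖𝓕⁻ f x‖ ≤ ∫ v, ‖f v‖ := by
  rw [Real.fourierInv_eq_fourier_neg]; exact fourier_norm_le f _

lemma plancherel_fourier {F : EE n → ℂ} (h1 : Integrable F) (h2 : MemLp F 2) :
    eLpNorm (𝓕 F) 2 volume = eLpNorm F 2 := by
  set G : Lp (α := EE n) ℂ 2 volume := 𝓕 (h2.toLp F) with hG
  have key : (𝓕 F) =ᵐ[volume] G := by
    apply ae_eq_of_integral_contDiff_smul_eq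
    · exact (fourier_cont h1).locallyIntegrable
    · exact (Lp.memLp G).locallyIntegrable (by norm_num)
    · intro g hg hgs
      have hgs' : HasCompactSupport (fun x => (g x : ℂ)) :=
        hgs.comp_left (g := fun r : ℝ => (r : ℂ)) (by simp)
      have hg' : ContDiff ℝ ∞ (fun x => (g x : ℂ)) := by
        exact Complex.ofRealCLM.contDiff.comp hg
      set φ : SchwartzMap (EE n) ℂ := hgs'.toSchwartzMap hg' with hφ
      have hφe : ∀ x, φ x = (g x : ℂ) := fun x => rfl
      have e1 : ∫ x, g x • 𝓕 F x = ∫ x, F x * 𝓕 φ x := by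
        rw [SchwartzMap.fourier_coe, ← fourier_self_adj h1 φ.integrable]
        refine integral_congr_ae (Filter.Eventually.of_forall fun x => ?_)
        simp [hφe, mul_comm]
      have e2 : ∫ x, g x • G x = (G : TemperedDistribution (EE n) ℂ) φ := by
        rw [Lp.toTemperedDistribution_apply]
        refine integral_congr_ae (Filter.Eventually.of_forall fun x => ?_)
        simp [hφe]
      rw [e1, e2, hG, ← Lp.fourier_toTemperedDistribution_eq, TemperedDistribution.fourier_apply,
        Lp.toTemperedDistribution_apply]
      refine integral_congr_ae ?_
      filter_upwards [h2.coeFn_toLp] with x hx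
      simp [hx, mul_comm]
  have := Lp.norm_fourier_eq (h2.toLp F)
  rw [Lp.norm_def, Lp.norm_def] at this
  rw [eLpNorm_congr_ae key, ← eLpNorm_congr_ae h2.coeFn_toLp]
  exact (ENNReal.toReal_eq_toReal_iff' (Lp.eLpNorm_ne_top _) (Lp.eLpNorm_ne_top _)).1 this

lemma plancherel_fourierInv {F : EE n → ℂ} (h1 : Integrable F) (h2 : MemLp F 2) :
    eLpNorm (𝓕⁻ F) 2 volume = eLpNorm F 2 := by
  have : 𝓕⁻ F = (𝓕 F) ∘ (fun x => -x) := by ext x; exact Real.fourierInv_eq_fourier_neg F x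
  rw [this, eLpNorm_comp_measurePreserving (fourier_cont h1).aestronglyMeasurable
    (Measure.measurePreserving_neg _)]
  exact plancherel_fourier h1 h2

lemma Nc.plancherel {F : EE n → ℂ} (h : Nc F) : eLpNorm (𝓕 F) 2 volume = eLpNorm F 2 :=
  plancherel_fourier h.integrable h.memLp

lemma Nc.plancherelInv {F : EE n → ℂ} (h : Nc F) : eLpNorm (𝓕⁻ F) 2 volume = eLpNorm F 2 :=
  plancherel_fourierInv h.integrable h.memLp

/-- The trilinear form with symbol `S`. -/
noncomputable def TS (S : EE n × EE n → ℝ) (α β γ : EE n → ℂ) : ℂ :=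
  ∫ p : EE n × EE n, (S p : ℂ) * (α p.1 * β p.2 * γ (p.1 + p.2))

lemma nc_integrand {S : EE n × EE n → ℝ} (hS : PG S) {α β γ : EE n → ℂ} (hα : Nc α) (hβ : Nc β)
    (hγ : Nc γ) : Nc (fun p : EE n × EE n => (S p : ℂ) * (α p.1 * β p.2 * γ (p.1 + p.2))) := by
  obtain ⟨C, hC, h⟩ := hγ.bdd
  exact ((hα.prod hβ).mul_bdd (G := fun p : EE n × EE n => γ (p.1 + p.2))
    (hγ.1.comp (by fun_prop)) (fun p => h _)).mul_pg hS

instance : (volume : Measure (EE n × EE n)).IsAddHaarMeasure := by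
  rw [Measure.volume_eq_prod]; infer_instance

lemma integrable_integrand {S : EE n × EE n → ℝ} (hS : PG S) {α β γ : EE n → ℂ} (hα : Nc α)
    (hβ : Nc β) (hγ : Nc γ) :
    Integrable (fun p : EE n × EE n => (S p : ℂ) * (α p.1 * β p.2 * γ (p.1 + p.2))) :=
  (nc_integrand hS hα hβ hγ).integrable

lemma fourier_translate (γ : EE n → ℂ) (η x : EE n) :
    𝓕 (fun ζ => γ (ζ + η)) x = Complex.exp ((↑(2 * Real.pi * inner ℝ η x) * Complex.I)) * 𝓕 γ x := by
  rw [Real.fourier_eq', Real.fourier_eq']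
  rw [← integral_add_right_eq_self
    (fun v => Complex.exp ((↑(-2 * Real.pi * inner ℝ v x) * Complex.I)) • γ v) η]
  rw [← integral_const_mul]
  congr 1
  ext v
  rw [smul_eq_mul, smul_eq_mul, ← mul_assoc, ← Complex.exp_add]
  congr 2
  rw [inner_add_left]
  push_cast
  ring

lemma T_identity (a : SchwartzMap (EE n) ℂ) {β γ : EE n → ℂ} (hβ : Nc β) (hγ : Nc γ) :
    TS (fun _ => 1) (ft a) β γ = ∫ x, a x * 𝓕⁻ β x * 𝓕 γ x := by
  have hα : Nc (fun x => 𝓕 a x) := Nc.of_schwartz (𝓕 a)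
  have hint := integrable_integrand (PG.const 1) hα hβ hγ
  unfold TS
  rw [Measure.volume_eq_prod] at hint ⊢
  rw [integral_prod_symm _ hint]
  have hF : ∀ η : EE n, ∫ ζ, ((1:ℝ) : ℂ) * (𝓕 a ζ * β η * γ (ζ + η)) =
      ∫ x, β η * (a x * (Complex.exp ((↑(2 * Real.pi * inner ℝ η x) * Complex.I)) * 𝓕 γ x)) := by
    intro η
    have hγ' : Integrable (fun ζ => γ (ζ + η)) := (hγ.integrable (μ := volume)).comp_add_right η
    have := fourier_self_adj a.integrable hγ'
    simp_rw [fourier_translate] at this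
    rw [integral_const_mul (β η), ← this, ← integral_const_mul]
    congr 1; ext ζ; rw [SchwartzMap.fourier_coe]; push_cast; ring
  simp only [hF]
  rw [integral_integral_swap]
  · congr 1; ext x
    rw [Real.fourierInv_eq', mul_assoc, mul_comm (∫ v, _) _, ← mul_assoc, ← integral_const_mul]
    congr 1; ext η
    simp only [smul_eq_mul]
    ring
  · obtain ⟨C, hC⟩ : ∃ C, ∀ x, ‖𝓕 γ x‖ ≤ C := ⟨_, fun x => fourier_norm_le γ x⟩
    have h1 : Integrable (fun p : EE n × EE n => β p.1 * a p.2) (volume.prod volume) :=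
      hβ.integrable.mul_prod a.integrable
    have hc : Continuous (fun p : EE n × EE n =>
        Complex.exp ((↑(2 * Real.pi * inner ℝ p.1 p.2) * Complex.I)) * 𝓕 γ p.2) := by
      have := fourier_cont hγ.integrable
      fun_prop
    have h2 := h1.mul_bdd (g := fun p : EE n × EE n =>
        Complex.exp ((↑(2 * Real.pi * inner ℝ p.1 p.2) * Complex.I)) * 𝓕 γ p.2) (c := C)
      hc.aestronglyMeasurable (Filter.Eventually.of_forall fun p => by
        rw [norm_mul, Complex.norm_exp_ofReal_mul_I, one_mul]; exact hC _)
    refine h2.congr (Filter.Eventually.of_forall fun p => ?_)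
    simp [Function.uncurry]
    ring

lemma enorm_integral_mul_le {F G : EE n → ℂ} (hF : AEStronglyMeasurable F)
    (hG : AEStronglyMeasurable G) :
    ‖∫ x, F x * G x‖ₑ ≤ eLpNorm F 2 * eLpNorm G 2 := by
  have h1 := eLpNorm_smul_le_mul_eLpNorm (μ := volume) (p := 2) (q := 2) (r := 1) hG hF
  have h2 := enorm_integral_le_lintegral_enorm (μ := volume) (F • G)
  rw [← eLpNorm_one_eq_lintegral_enorm] at h2
  exact h2.trans h1

lemma T_bound_gen (a : SchwartzMap (EE n) ℂ) {β γ : EE n → ℂ} (hβ : Nc β) (hγ : Nc γ) :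
    ‖TS (fun _ => 1) (ft a) β γ‖ₑ ≤ eLpNorm β 2 * eLpNorm (fun x => a x * 𝓕 γ x) 2 := by
  rw [T_identity a hβ hγ, ← hβ.plancherelInv]
  have e : ∀ x, a x * 𝓕⁻ β x * 𝓕 γ x = 𝓕⁻ β x * (a x * 𝓕 γ x) := fun x => by ring
  simp only [e]
  exact enorm_integral_mul_le (fourierInv_cont hβ.integrable).aestronglyMeasurable
    (a.continuous.mul (fourier_cont hγ.integrable)).aestronglyMeasurable

lemma eLpNorm_bdd_mul_le {X : ℝ} {a F : EE n → ℂ} (hX : ∀ x, ‖a x‖ ≤ X) :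
    eLpNorm (fun x => a x * F x) 2 ≤ ENNReal.ofReal X * eLpNorm F 2 := by
  have := eLpNorm_le_mul_eLpNorm_of_ae_le_mul (μ := volume) (f := fun x => a x * F x) (g := F)
    (c := X) (Filter.Eventually.of_forall fun x => by
      rw [norm_mul]; exact mul_le_mul_of_nonneg_right (hX x) (norm_nonneg _)) 2
  exact this

lemma T_bound (a : SchwartzMap (EE n) ℂ) {X : ℝ} (hX : ∀ x, ‖a x‖ ≤ X) {β γ : EE n → ℂ}
    (hβ : Nc β) (hγ : Nc γ) :
    ‖TS (fun _ => 1) (ft a) β γ‖ₑ ≤ ENNReal.ofReal X * eLpNorm β 2 * eLpNorm γ 2 := by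
  refine (T_bound_gen a hβ hγ).trans ?_
  calc _ ≤ eLpNorm β 2 * (ENNReal.ofReal X * eLpNorm (𝓕 γ) 2 volume) := by
        gcongr; exact eLpNorm_bdd_mul_le hX
    _ = _ := by rw [hγ.plancherel]; ring

end KP

end Part2

section Part3

open MeasureTheory
open scoped FourierTransform ENNReal ContDiff

namespace KP

variable {n : ℕ}

/-- Heat multiplier. -/
noncomputable def ht (t : ℝ) (ξ : EE n) : ℝ := Real.exp (-(t * ‖ξ‖ ^ 2))

lemma ht_pos (t : ℝ) (ξ : EE n) : 0 < ht t ξ := Real.exp_pos _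

lemma ht_le_one {t : ℝ} (ht0 : 0 ≤ t) (ξ : EE n) : ht t ξ ≤ 1 := by
  unfold ht; rw [Real.exp_le_one_iff]; have : 0 ≤ t * ‖ξ‖ ^ 2 := by positivity
  linarith

lemma ht_cont (t : ℝ) : Continuous (ht t : EE n → ℝ) := by unfold ht; fun_prop

lemma ht_pg {t : ℝ} (ht0 : 0 ≤ t) : PG (ht t : EE n → ℝ) :=
  PG.of_le (ht_cont t) (PG.const 1) fun x => by
    rw [abs_of_pos (ht_pos t x), abs_one]; exact ht_le_one ht0 x

lemma ht_temperate {t : ℝ} (ht0 : 0 ≤ t) :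
    Function.HasTemperateGrowth (fun ξ : EE n => ((ht t ξ : ℝ) : ℂ)) := by
  have h1 : Function.HasTemperateGrowth (fun ξ : EE n => -(t * ‖ξ‖ ^ 2)) := by
    have h0 := Function.hasTemperateGrowth_norm_sq (H := EE n)
    have := ((Function.HasTemperateGrowth.const (E := EE n) t).mul h0).neg
    exact this
  have h2 : Function.HasTemperateGrowth (Real.exp ∘ (fun ξ : EE n => -(t * ‖ξ‖ ^ 2))) := by
    refine Function.HasTemperateGrowth.comp' (t := Set.Iic 0) ?_ (uniqueDiffOn_Iic 0)
      Real.contDiff_exp.contDiffOn ?_ h1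
    · rintro _ ⟨x, rfl⟩
      have : 0 ≤ t * ‖x‖ ^ 2 := by positivity
      simpa using this
    · intro N
      refine ⟨0, 1, zero_le_one, fun k _ x hx => ?_⟩
      rw [norm_iteratedFDerivWithin_eq_norm_iteratedDerivWithin,
        iteratedDerivWithin_eq_iteratedDeriv (uniqueDiffOn_Iic 0)
          (Real.contDiff_exp.contDiffAt) hx, iteratedDeriv_eq_iterate, Real.iter_deriv_exp]
      simpa using hx
  exact Function.Complex.hasTemperateGrowth_ofReal.comp h2

/-- Heat flow on Schwartz functions. -/
noncomputable def heat (t : ℝ) (a : SchwartzMap (EE n) ℂ) : SchwartzMap (EE n) ℂ :=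
  𝓕⁻ (SchwartzMap.smulLeftCLM ℂ (fun ξ : EE n => ((ht t ξ : ℝ) : ℂ)) (𝓕 a))

lemma ft_heat {t : ℝ} (ht0 : 0 ≤ t) (a : SchwartzMap (EE n) ℂ) (ξ : EE n) :
    ft (heat t a) ξ = (ht t ξ : ℂ) * ft a ξ := by
  unfold ft heat
  rw [FourierTransform.fourier_fourierInv_eq]
  rw [SchwartzMap.smulLeftCLM_apply_apply (ht_temperate ht0)]
  rfl

lemma heat_apply {t : ℝ} (ht0 : 0 ≤ t) (a : SchwartzMap (EE n) ℂ) (x : EE n) :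
    heat t a x = 𝓕⁻ (fun ξ => (ht t ξ : ℂ) * ft a ξ) x := by
  unfold heat
  rw [SchwartzMap.fourierInv_coe]
  congr 1
  refine congrArg _ (funext fun ξ => ?_)
  rw [SchwartzMap.smulLeftCLM_apply_apply (ht_temperate ht0)]
  rfl

lemma heat_bound {t : ℝ} (ht0 : 0 < t) (a : SchwartzMap (EE n) ℂ) {X : ℝ}
    (hX : ∀ x, ‖a x‖ ≤ X) (x : EE n) : ‖heat t a x‖ ≤ X := by
  set G : EE n → ℂ := fun v => Complex.exp (-(t:ℂ) * ‖v‖ ^ 2 + 2 * Real.pi * Complex.I * inner ℝ x v)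
    with hG
  have hnorm : ∀ v, G v = Complex.exp ((↑(2 * Real.pi * inner ℝ v x) * Complex.I)) * (ht t v : ℂ) := by
    intro v
    rw [hG, ht, Complex.ofReal_exp, ← Complex.exp_add, real_inner_comm]
    congr 1
    push_cast
    ring
  have hGi : Integrable G := by
    have := GaussianFourier.integrable_cexp_neg_mul_sq_norm_add (V := EE n) (b := (t:ℂ))
      (by simpa using ht0) (2 * Real.pi * Complex.I) x
    exact this
  have e1 : heat t a x = ∫ w, a w * 𝓕 G w := by
    rw [← fourier_self_adj a.integrable hGi, heat_apply ht0.le, Real.fourierInv_eq']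
    congr 1
    ext v
    rw [hnorm, ft, SchwartzMap.fourier_coe, smul_eq_mul]
    ring
  have hG2 : ∀ w, 𝓕 G w = (((Real.pi / t) ^ ((n:ℝ) / 2) *
      Real.exp (-(Real.pi ^ 2 / t) * ‖w - x‖ ^ 2) : ℝ) : ℂ) := by
    intro w
    rw [hG, fourier_gaussian_innerProductSpace' (by simpa using ht0)]
    rw [norm_sub_rev]
    push_cast
    rw [Complex.ofReal_cpow (by positivity)]
    simp only [finrank_euclideanSpace, Fintype.card_fin]
    push_cast
    congr 2
    ring
  have hmass : ∫ w : EE n, (Real.pi / t) ^ ((n:ℝ) / 2) *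
      Real.exp (-(Real.pi ^ 2 / t) * ‖w - x‖ ^ 2) = 1 := by
    rw [integral_const_mul,
      integral_sub_right_eq_self (fun w : EE n => Real.exp (-(Real.pi ^ 2 / t) * ‖w‖ ^ 2)) x,
      GaussianFourier.integral_rexp_neg_mul_sq_norm (by positivity)]
    simp only [finrank_euclideanSpace, Fintype.card_fin]
    rw [← Real.mul_rpow (by positivity) (by positivity)]
    have : Real.pi / t * (Real.pi / (Real.pi ^ 2 / t)) = 1 := by
      field_simp
    rw [this, Real.one_rpow]
  have hmi : Integrable (fun w : EE n => (Real.pi / t) ^ ((n:ℝ) / 2) *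
      Real.exp (-(Real.pi ^ 2 / t) * ‖w - x‖ ^ 2)) := by
    by_contra h
    rw [integral_undef h] at hmass
    exact zero_ne_one hmass
  rw [e1]
  calc ‖∫ w, a w * 𝓕 G w‖ ≤ ∫ w : EE n, X * ((Real.pi / t) ^ ((n:ℝ) / 2) *
      Real.exp (-(Real.pi ^ 2 / t) * ‖w - x‖ ^ 2)) := by
        refine norm_integral_le_of_norm_le (hmi.const_mul X)
          (Filter.Eventually.of_forall fun w => ?_)
        rw [norm_mul, hG2, Complex.norm_real, Real.norm_of_nonneg (by positivity)]
        exact mul_le_mul_of_nonneg_right (hX w) (by positivity)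
    _ = X := by rw [integral_const_mul, hmass, mul_one]

/-- Symbols bounded on `L^∞ × (weight j) × (weight k)`. -/
def MA (j k : ℝ) (S : EE n × EE n → ℝ) : Prop :=
  PG S ∧ ∃ C : ℝ, 0 ≤ C ∧ ∀ (a : SchwartzMap (EE n) ℂ) (X : ℝ), (∀ x, ‖a x‖ ≤ X) →
    ∀ β γ : EE n → ℂ, Nc β → Nc γ →
      ‖TS S (ft a) β γ‖ₑ ≤ ENNReal.ofReal C * ENNReal.ofReal X *
        eLpNorm (fun η => ((‖η‖ ^ j : ℝ) : ℂ) * β η) 2 *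
        eLpNorm (fun ξ => ((‖ξ‖ ^ k : ℝ) : ℂ) * γ ξ) 2

lemma MA.one : MA 0 0 (fun _ : EE n × EE n => 1) := by
  refine ⟨PG.const 1, 1, zero_le_one, fun a X hX β γ hβ hγ => ?_⟩
  simpa using T_bound a hX hβ hγ

lemma TS_add {S R : EE n × EE n → ℝ} (hS : PG S) (hR : PG R) {α β γ : EE n → ℂ} (hα : Nc α)
    (hβ : Nc β) (hγ : Nc γ) :
    TS (fun p => S p + R p) α β γ = TS S α β γ + TS R α β γ := by
  unfold TS
  rw [← integral_add (integrable_integrand hS hα hβ hγ) (integrable_integrand hR hα hβ hγ)]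
  congr 1; ext p; push_cast; ring

lemma TS_const_mul (c : ℝ) (S : EE n × EE n → ℝ) (α β γ : EE n → ℂ) :
    TS (fun p => c * S p) α β γ = c * TS S α β γ := by
  unfold TS
  rw [← integral_const_mul]
  congr 1; ext p; push_cast; ring

lemma MA.add {j k : ℝ} {S R : EE n × EE n → ℝ} (hS : MA j k S) (hR : MA j k R) :
    MA j k (fun p => S p + R p) := by
  obtain ⟨hS, C, hC, h⟩ := hS
  obtain ⟨hR, D, hD, h'⟩ := hR
  refine ⟨hS.add hR, C + D, by positivity, fun a X hX β γ hβ hγ => ?_⟩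
  rw [TS_add hS hR (Nc.of_schwartz _) hβ hγ, ENNReal.ofReal_add hC hD]
  refine (enorm_add_le _ _).trans ?_
  refine (add_le_add (h a X hX β γ hβ hγ) (h' a X hX β γ hβ hγ)).trans_eq ?_
  ring

lemma MA.congr {j k j' k' : ℝ} {S R : EE n × EE n → ℝ} (hS : MA j k S) (hj : j = j')
    (hk : k = k') (h : ∀ p, S p = R p) : MA j' k' R := by
  subst hj; subst hk
  have : S = R := funext h
  rwa [← this]

lemma MA.const_mul {j k : ℝ} {S : EE n × EE n → ℝ} (hS : MA j k S) (c : ℝ) :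
    MA j k (fun p => c * S p) := by
  obtain ⟨hS, C, hC, h⟩ := hS
  refine ⟨(PG.const c).mul hS, |c| * C, by positivity, fun a X hX β γ hβ hγ => ?_⟩
  rw [TS_const_mul, enorm_mul, ENNReal.ofReal_mul (abs_nonneg c)]
  have e : ‖(c : ℂ)‖ₑ = ENNReal.ofReal |c| := by
    rw [← ofReal_norm, Complex.norm_real, Real.norm_eq_abs]
  rw [e]
  refine (mul_le_mul_right (h a X hX β γ hβ hγ) _).trans_eq ?_
  ring

lemma MA.sum {j k : ℝ} {ι : Type*} (s : Finset ι) {S : ι → EE n × EE n → ℝ}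
    (hS : ∀ i ∈ s, MA j k (S i)) : MA j k (fun p => ∑ i ∈ s, S i p) := by
  classical
  induction s using Finset.induction_on with
  | empty =>
    refine ⟨by simpa using PG.const 0, 0, le_rfl, fun a X hX β γ hβ hγ => ?_⟩
    simp [TS]
  | insert a s ha ih =>
    simp only [Finset.sum_insert ha]
    exact (hS a (by simp)).add (ih fun i hi => hS i (by simp [hi]))

lemma MA.mul_snd {j k j' : ℝ} {S : EE n × EE n → ℝ} (hS : MA j k S) (hj : 0 ≤ j) (hj' : 0 ≤ j')
    {f : EE n → ℝ} (hf : Continuous f) (hb : ∀ x, |f x| ≤ ‖x‖ ^ j') :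
    MA (j' + j) k (fun p => f p.2 * S p) := by
  obtain ⟨hS, C, hC, h⟩ := hS
  have hfp : PG f := PG.of_le hf (PG.norm_rpow hj') (fun x => (hb x).trans (le_abs_self _))
  refine ⟨hfp.snd.mul hS, C, hC, fun a X hX β γ hβ hγ => ?_⟩
  have e : TS (fun p => f p.2 * S p) (ft a) β γ = TS S (ft a) (fun η => (f η : ℂ) * β η) γ := by
    unfold TS; congr 1; ext p; push_cast; ring
  rw [e]
  refine (h a X hX _ γ (hβ.mul_pg hfp) hγ).trans (mul_le_mul' (mul_le_mul' le_rfl ?_) le_rfl)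
  refine eLpNorm_mono fun x => ?_
  rw [norm_mul, norm_mul, norm_mul, Complex.norm_real, Complex.norm_real, Complex.norm_real,
    Real.rpow_add_of_nonneg (norm_nonneg x) hj' hj, Real.norm_eq_abs, Real.norm_eq_abs,
    Real.norm_eq_abs, abs_of_nonneg (show 0 ≤ ‖x‖ ^ j by positivity),
    abs_of_nonneg (show 0 ≤ ‖x‖ ^ j' * ‖x‖ ^ j by positivity)]
  calc ‖x‖ ^ j * (|f x| * ‖β x‖) ≤ ‖x‖ ^ j * (‖x‖ ^ j' * ‖β x‖) := by gcongr; exact hb x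
    _ = _ := by ring

lemma MA.mul_plus {j k k' : ℝ} {S : EE n × EE n → ℝ} (hS : MA j k S) (hk : 0 ≤ k) (hk' : 0 ≤ k')
    {f : EE n → ℝ} (hf : Continuous f) (hb : ∀ x, |f x| ≤ ‖x‖ ^ k') :
    MA j (k' + k) (fun p => f (p.1 + p.2) * S p) := by
  obtain ⟨hS, C, hC, h⟩ := hS
  have hfp : PG f := PG.of_le hf (PG.norm_rpow hk') (fun x => (hb x).trans (le_abs_self _))
  refine ⟨hfp.plus.mul hS, C, hC, fun a X hX β γ hβ hγ => ?_⟩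
  have e : TS (fun p => f (p.1 + p.2) * S p) (ft a) β γ =
      TS S (ft a) β (fun η => (f η : ℂ) * γ η) := by
    unfold TS; congr 1; ext p; push_cast; ring
  rw [e]
  refine (h a X hX β _ hβ (hγ.mul_pg hfp)).trans (mul_le_mul' le_rfl ?_)
  refine eLpNorm_mono fun x => ?_
  rw [norm_mul, norm_mul, norm_mul, Complex.norm_real, Complex.norm_real, Complex.norm_real,
    Real.rpow_add_of_nonneg (norm_nonneg x) hk' hk, Real.norm_eq_abs, Real.norm_eq_abs,
    Real.norm_eq_abs, abs_of_nonneg (show 0 ≤ ‖x‖ ^ k by positivity),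
    abs_of_nonneg (show 0 ≤ ‖x‖ ^ k' * ‖x‖ ^ k by positivity)]
  calc ‖x‖ ^ k * (|f x| * ‖γ x‖) ≤ ‖x‖ ^ k * (‖x‖ ^ k' * ‖γ x‖) := by gcongr; exact hb x
    _ = _ := by ring

lemma coord_bound (l : Fin n) (x : EE n) : |x l| ≤ ‖x‖ := by
  simpa using PiLp.norm_apply_le x l

lemma coord_cont (l : Fin n) : Continuous (fun x : EE n => x l) := by fun_prop

lemma coord_pg (l : Fin n) : PG (fun x : EE n => x l) :=
  PG.of_le (coord_cont l) (PG.norm_rpow zero_le_one) fun x => by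
    rw [Real.rpow_one, abs_norm]; exact coord_bound l x

lemma inner_sum (x y : EE n) : inner ℝ x y = ∑ l, x l * y l := by
  simp [PiLp.inner_apply, mul_comm]

/-- multiplication by `η · ξ`. -/
lemma MA.mul_v {j k : ℝ} {S : EE n × EE n → ℝ} (hS : MA j k S) (hj : 0 ≤ j) (hk : 0 ≤ k) :
    MA (j + 1) (k + 1) (fun p => inner ℝ p.2 (p.1 + p.2) * S p) := by
  have : ∀ l ∈ (Finset.univ : Finset (Fin n)),
      MA (1 + j) (1 + k) (fun p => p.2 l * ((p.1 + p.2) l * S p)) := by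
    intro l _
    exact (hS.mul_plus (k' := 1) hk zero_le_one (coord_cont l)
      (by simpa using coord_bound l)).mul_snd hj (j' := 1) zero_le_one (coord_cont l)
        (by simpa using coord_bound l)
  refine (MA.sum _ this).congr (add_comm _ _) (add_comm _ _) fun p => ?_
  rw [inner_sum, Finset.sum_mul]
  refine Finset.sum_congr rfl fun l _ => ?_
  ring

lemma MA.mul_y2 {j k : ℝ} {S : EE n × EE n → ℝ} (hS : MA j k S) (hj : 0 ≤ j) :
    MA (j + 2) k (fun p => ‖p.2‖ ^ 2 * S p) :=
  (hS.mul_snd hj (j' := 2) zero_le_two (f := fun x => ‖x‖ ^ 2) (by fun_prop)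
    (fun x => by simp)).congr (add_comm _ _) rfl fun p => rfl

lemma MA.mul_x2 {j k : ℝ} {S : EE n × EE n → ℝ} (hS : MA j k S) (hk : 0 ≤ k) :
    MA j (k + 2) (fun p => ‖p.1 + p.2‖ ^ 2 * S p) :=
  (hS.mul_plus hk (k' := 2) zero_le_two (f := fun x => ‖x‖ ^ 2) (by fun_prop)
    (fun x => by simp)).congr rfl (add_comm _ _) fun p => rfl

/-- separated symbols -/
lemma MA.powers {j k : ℝ} (hj : 0 ≤ j) (hk : 0 ≤ k) :
    MA j k (fun p : EE n × EE n => ‖p.2‖ ^ j * ‖p.1 + p.2‖ ^ k) := by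
  have h := ((MA.one (n := n)).mul_plus (k' := k) le_rfl hk (f := fun x => ‖x‖ ^ k)
    (PG.norm_rpow hk).cont (fun x => (abs_of_nonneg (by positivity)).le)).mul_snd (j' := j) le_rfl hj
    (f := fun x => ‖x‖ ^ j)
    (PG.norm_rpow hj).cont (fun x => (abs_of_nonneg (by positivity)).le)
  exact h.congr (add_zero _) (add_zero _) fun p => by ring

end KP

end Part3

section Part4

open MeasureTheory
open scoped FourierTransform ENNReal ContDiff

namespace KP
variable {n : ℕ}

/-- Cauchy--Schwarz for lower integrals. -/
lemma cs_lint {Θ : Type*} [MeasurableSpace Θ] {μ : Measure Θ} {f g : Θ → ℝ≥0∞}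
    (hf : AEMeasurable f μ) (hg : AEMeasurable g μ) {A B : ℝ} (hA : 0 ≤ A) (hB : 0 ≤ B)
    {P Q : ℝ≥0∞}
    (h1 : ∫⁻ θ, f θ ^ 2 ∂μ ≤ ENNReal.ofReal A * P ^ 2)
    (h2 : ∫⁻ θ, g θ ^ 2 ∂μ ≤ ENNReal.ofReal B * Q ^ 2) :
    ∫⁻ θ, f θ * g θ ∂μ ≤ ENNReal.ofReal (√A * √B) * P * Q := by
  have h := ENNReal.lintegral_mul_le_Lp_mul_Lq μ (p := 2) (q := 2)
    (by constructor <;> norm_num) hf hg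
  simp only [Pi.mul_apply] at h
  refine h.trans ?_
  have key : ∀ (A : ℝ) (P : ℝ≥0∞) (f : Θ → ℝ≥0∞), 0 ≤ A →
      ∫⁻ θ, f θ ^ 2 ∂μ ≤ ENNReal.ofReal A * P ^ 2 →
      (∫⁻ θ, f θ ^ (2:ℝ) ∂μ) ^ (1 / (2:ℝ)) ≤ ENNReal.ofReal (√A) * P := by
    intro A P f hA h
    simp only [ENNReal.rpow_two]
    refine (ENNReal.rpow_le_rpow h (by norm_num)).trans_eq ?_
    rw [ENNReal.mul_rpow_of_nonneg _ _ (by norm_num), ← ENNReal.rpow_natCast P,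
      ← ENNReal.rpow_mul, ENNReal.ofReal_rpow_of_nonneg hA (by norm_num), Real.sqrt_eq_rpow]
    norm_num
  refine (mul_le_mul' (key A P f hA h1) (key B Q g hB h2)).trans_eq ?_
  rw [ENNReal.ofReal_mul (by positivity)]
  ring

lemma eLpNorm_two_sq {V : Type*} [MeasurableSpace V] {μ : Measure V} (F : V → ℂ) :
    eLpNorm F 2 μ ^ 2 = ∫⁻ x, ‖F x‖ₑ ^ 2 ∂μ := by
  rw [eLpNorm_eq_lintegral_rpow_enorm_toReal (by norm_num) (by norm_num)]
  simp only [ENNReal.toReal_ofNat, ENNReal.rpow_two]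
  rw [← ENNReal.rpow_natCast, ← ENNReal.rpow_mul]
  norm_num

lemma meas_eLpNorm {Θ : Type*} [MeasurableSpace Θ] {A : Θ → EE n → ℝ}
    (hA : Measurable (Function.uncurry A)) {β : EE n → ℂ} (hβ : Continuous β) :
    Measurable (fun θ => eLpNorm (fun η => (A θ η : ℂ) * β η) 2 volume) := by
  have : ∀ θ, eLpNorm (fun η => (A θ η : ℂ) * β η) 2 volume =
      (∫⁻ η, ‖(A θ η : ℂ) * β η‖ₑ ^ 2) ^ (1/2:ℝ) := by
    intro θ
    rw [← eLpNorm_two_sq, ← ENNReal.rpow_natCast, ← ENNReal.rpow_mul]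
    norm_num
  simp only [this]
  refine Measurable.pow_const ?_ _
  refine Measurable.lintegral_prod_right' (f := fun z : Θ × EE n =>
    ‖(A z.1 z.2 : ℂ) * β z.2‖ₑ ^ 2) ?_
  have : Measurable (fun z : Θ × EE n => A z.1 z.2) := hA
  have h2 : Measurable (fun z : Θ × EE n => β z.2) := hβ.measurable.comp measurable_snd
  exact ((Complex.measurable_ofReal.comp this).mul h2).enorm.pow_const 2

/-- square function estimate -/
lemma sq_one {Θ : Type*} [MeasurableSpace Θ] {μ : Measure Θ} [SFinite μ] {A : Θ → EE n → ℝ}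
    (hA : Measurable (Function.uncurry A)) {β : EE n → ℂ} (hβ : Continuous β)
    {w : EE n → ℝ} {C : ℝ}
    (h : ∀ η, ∫⁻ θ, ‖A θ η‖ₑ ^ 2 ∂μ ≤ ENNReal.ofReal C * ‖w η‖ₑ ^ 2) :
    ∫⁻ θ, eLpNorm (fun η => (A θ η : ℂ) * β η) 2 volume ^ 2 ∂μ
      ≤ ENNReal.ofReal C * eLpNorm (fun η => (w η : ℂ) * β η) 2 volume ^ 2 := by
  simp only [eLpNorm_two_sq]
  have hm : Measurable (fun z : Θ × EE n => ‖(A z.1 z.2 : ℂ) * β z.2‖ₑ ^ 2) := by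
    have : Measurable (fun z : Θ × EE n => A z.1 z.2) := hA
    have h2 : Measurable (fun z : Θ × EE n => β z.2) := hβ.measurable.comp measurable_snd
    exact ((Complex.measurable_ofReal.comp this).mul h2).enorm.pow_const 2
  rw [lintegral_lintegral_swap (f := fun θ η => ‖(A θ η : ℂ) * β η‖ₑ ^ 2) hm.aemeasurable]
  rw [← lintegral_const_mul' _ _ ENNReal.ofReal_ne_top]
  refine lintegral_mono fun η => ?_
  have hr : ∀ r : ℝ, ‖(r : ℂ)‖ₑ = ‖r‖ₑ := fun r => by
    rw [← ofReal_norm, ← ofReal_norm, Complex.norm_real]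
  simp only [enorm_mul, mul_pow, hr]
  rw [lintegral_mul_const' _ _ (by finiteness), ← mul_assoc]
  gcongr
  exact h η

lemma fubini_TS {Θ : Type*} [MeasurableSpace Θ] {μ : Measure Θ} [SFinite μ]
    {K : Θ → EE n × EE n → ℝ} (hK : Measurable (Function.uncurry K))
    {S P : EE n × EE n → ℝ} (hS : ∀ p, S p = ∫ θ, K θ p ∂μ)
    (hP : PG P) (hKP : ∀ p, ∫⁻ θ, ‖K θ p‖ₑ ∂μ ≤ ENNReal.ofReal (P p))
    {α β γ : EE n → ℂ} (hα : Nc α) (hβ : Nc β) (hγ : Nc γ) :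
    ‖TS S α β γ‖ₑ ≤ ∫⁻ θ, ‖TS (K θ) α β γ‖ₑ ∂μ := by
  set F : EE n × EE n → ℂ := fun p => α p.1 * β p.2 * γ (p.1 + p.2) with hF
  have hFc : Continuous F := by
    have := hα.cont; have := hβ.cont; have := hγ.cont
    fun_prop
  have hr : ∀ r : ℝ, ‖(r : ℂ)‖ₑ = ‖r‖ₑ := fun r => by
    rw [← ofReal_norm, ← ofReal_norm, Complex.norm_real]
  have hm : Measurable (fun z : (EE n × EE n) × Θ => (K z.2 z.1 : ℂ) * F z.1) := by
    have : Measurable (fun z : (EE n × EE n) × Θ => K z.2 z.1) :=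
      hK.comp measurable_swap
    have h2 : Measurable (fun z : (EE n × EE n) × Θ => F z.1) := hFc.measurable.comp measurable_fst
    fun_prop
  have hint : Integrable (Function.uncurry fun (p : EE n × EE n) θ => (K θ p : ℂ) * F p)
      ((volume : Measure (EE n × EE n)).prod μ) := by
    refine ⟨hm.aestronglyMeasurable, ?_⟩
    unfold HasFiniteIntegral
    rw [lintegral_prod _ (by exact hm.enorm.aemeasurable)]
    have hb : ∫⁻ p : EE n × EE n, ENNReal.ofReal (P p) * ‖F p‖ₑ < ⊤ := by
      have := (integrable_integrand hP hα hβ hγ).2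
      refine lt_of_le_of_lt (lintegral_mono fun p => ?_) this
      change _ ≤ ‖(P p : ℂ) * F p‖ₑ
      rw [enorm_mul (P p : ℂ), hr]
      gcongr
      rw [← ofReal_norm]
      exact ENNReal.ofReal_le_ofReal (le_abs_self _)
    refine lt_of_le_of_lt (lintegral_mono fun p => ?_) hb
    simp only [Function.uncurry, enorm_mul, hr]
    rw [lintegral_mul_const' _ _ (by finiteness)]
    gcongr
    exact hKP p
  have e : TS S α β γ = ∫ θ, TS (K θ) α β γ ∂μ := by
    unfold TS
    rw [← integral_integral_swap hint]
    congr 1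
    ext p
    rw [integral_mul_const, hS p, ← integral_complex_ofReal]
  rw [e]
  exact enorm_integral_le_lintegral_enorm _

/-- heat-damped function -/
noncomputable def hf (t : ℝ) (F : EE n → ℂ) : EE n → ℂ := fun ξ => (ht t ξ : ℂ) * F ξ

lemma hf_nc {t : ℝ} (h : 0 ≤ t) {F : EE n → ℂ} (hF : Nc F) : Nc (hf t F) := hF.mul_pg (ht_pg h)

lemma hf_ft {t : ℝ} (h : 0 ≤ t) (a : SchwartzMap (EE n) ℂ) : hf t (ft a) = ft (heat t a) := by
  ext ξ; rw [ft_heat h]; rfl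

lemma meas_TS {S : EE n × EE n → ℝ} (hS : Continuous S) {α β γ : EE n → ℂ} (hα : Continuous α)
    (hβ : Continuous β) (hγ : Continuous γ) :
    Measurable (fun t => TS S (hf t α) (hf t β) (hf t γ)) := by
  unfold TS
  refine StronglyMeasurable.measurable ?_
  refine StronglyMeasurable.integral_prod_right' (f := fun z : ℝ × (EE n × EE n) =>
    (S z.2 : ℂ) * (hf z.1 α z.2.1 * hf z.1 β z.2.2 * hf z.1 γ (z.2.1 + z.2.2))) ?_
  refine Continuous.stronglyMeasurable ?_
  unfold hf ht
  fun_prop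

/-- admissible triple -/
structure Adm (a h : SchwartzMap (EE n) ℂ) (aD : Fin n → SchwartzMap (EE n) ℂ) (X Y : ℝ) :
    Prop where
  der : ∀ l ζ, ft (aD l) ζ = ((ζ l : ℝ) : ℂ) * ft a ζ
  bX : ∀ l x, ‖aD l x‖ ≤ X
  bY : ∀ x, ‖h x‖ ≤ Y

/-- right-hand side functional -/
noncomputable def RH (s : ℝ) (a h ψ : SchwartzMap (EE n) ℂ) (X Y : ℝ) : ℝ≥0∞ :=
  (ENNReal.ofReal X * eLpNorm (fun η => ((‖η‖ ^ (s - 1) : ℝ) : ℂ) * ft h η) 2 volume +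
    eLpNorm (fun η => ((‖η‖ ^ s : ℝ) : ℂ) * ft a η) 2 volume * ENNReal.ofReal Y) *
    eLpNorm (ft ψ) 2 volume

/-- Good symbols. -/
def Good (m : ℕ) (s : ℝ) (S : EE n × EE n → ℝ) : Prop :=
  PG S ∧ ∃ C : ℝ, 0 ≤ C ∧ ∀ (a h ψ : SchwartzMap (EE n) ℂ) (aD : Fin n → SchwartzMap (EE n) ℂ)
    (X Y : ℝ), Adm a h aD X Y →
    ∫⁻ t in Set.Ioi (0:ℝ), ENNReal.ofReal (t ^ ((m:ℝ) - 1)) *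
      ‖TS S (hf t (ft a)) (hf t (ft h)) (hf t (ft ψ))‖ₑ ≤ ENNReal.ofReal C * RH s a h ψ X Y

lemma Good.add {m : ℕ} {s : ℝ} {S R : EE n × EE n → ℝ} (hS : Good m s S) (hR : Good m s R) :
    Good m s (fun p => S p + R p) := by
  obtain ⟨hS, C, hC, h⟩ := hS
  obtain ⟨hR, D, hD, h'⟩ := hR
  refine ⟨hS.add hR, C + D, by positivity, fun a b ψ aD X Y hA => ?_⟩
  rw [ENNReal.ofReal_add hC hD, add_mul]
  refine le_trans ?_ (add_le_add (h a b ψ aD X Y hA) (h' a b ψ aD X Y hA))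
  rw [← lintegral_add_left]
  · refine setLIntegral_mono' measurableSet_Ioi fun t ht => ?_
    have ht : (0:ℝ) ≤ t := le_of_lt ht
    rw [← mul_add, TS_add hS hR (hf_nc ht (Nc.of_schwartz _)) (hf_nc ht (Nc.of_schwartz _))
      (hf_nc ht (Nc.of_schwartz _))]
    gcongr
    exact enorm_add_le _ _
  · have := meas_TS hS.cont (ft a).continuous (ft b).continuous (ft ψ).continuous
    fun_prop

lemma Good.congr {m : ℕ} {s : ℝ} {S R : EE n × EE n → ℝ} (hS : Good m s S)
    (h : ∀ p, S p = R p) : Good m s R := by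
  have : S = R := funext h
  rwa [← this]

lemma Good.const_mul {m : ℕ} {s : ℝ} {S : EE n × EE n → ℝ} (hS : Good m s S) (c : ℝ) :
    Good m s (fun p => c * S p) := by
  obtain ⟨hS, C, hC, h⟩ := hS
  refine ⟨(PG.const c).mul hS, |c| * C, by positivity, fun a b ψ aD X Y hA => ?_⟩
  have e : ‖(c : ℂ)‖ₑ = ENNReal.ofReal |c| := by
    rw [← ofReal_norm, Complex.norm_real, Real.norm_eq_abs]
  simp only [TS_const_mul, enorm_mul, e]
  rw [ENNReal.ofReal_mul (abs_nonneg c), mul_assoc]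
  simp only [mul_left_comm _ (ENNReal.ofReal |c|)]
  rw [lintegral_const_mul' _ _ ENNReal.ofReal_ne_top]
  gcongr
  exact h a b ψ aD X Y hA

lemma Good.sum {m : ℕ} {r : ℝ} {ι : Type*} (s : Finset ι) {S : ι → EE n × EE n → ℝ}
    (hS : ∀ i ∈ s, Good m r (S i)) : Good m r (fun p => ∑ i ∈ s, S i p) := by
  classical
  induction s using Finset.induction_on with
  | empty =>
    refine ⟨by simpa using PG.const 0, 0, le_rfl, fun a b ψ aD X Y hA => ?_⟩
    simp [TS]
  | insert a s ha ih =>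
    simp only [Finset.sum_insert ha]
    exact (hS a (by simp)).add (ih fun i hi => hS i (by simp [hi]))

lemma Good.sub {m : ℕ} {s : ℝ} {S R : EE n × EE n → ℝ} (hS : Good m s S) (hR : Good m s R) :
    Good m s (fun p => S p - R p) :=
  (hS.add (hR.const_mul (-1))).congr fun p => by ring

/-- Gaussian weight -/
lemma gauss_weight {e j j0 y : ℝ} (he : -1 < e) (hj0 : 0 ≤ j0) (hj : j = j0 + e + 1) (hy : 0 ≤ y) :
    ∫⁻ t in Set.Ioi (0:ℝ), ‖t ^ (e / 2) * (y ^ j * Real.exp (-(t * y ^ 2)))‖ₑ ^ 2 ≤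
      ENNReal.ofReal (Real.Gamma (e + 1)) * ‖y ^ j0‖ₑ ^ 2 := by
  have hΓ : 0 < Real.Gamma (e + 1) := Real.Gamma_pos_of_pos (by linarith)
  rcases hy.eq_or_lt with h0 | h0
  · rw [← h0, Real.zero_rpow (by linarith)]
    simp
  · have h1 : ∀ t ∈ Set.Ioi (0:ℝ), ‖t ^ (e / 2) * (y ^ j * Real.exp (-(t * y ^ 2)))‖ₑ ^ 2 =
        ENNReal.ofReal ((y ^ j) ^ 2 * (t ^ ((e + 1) - 1) * Real.exp (-((2 * y ^ 2) * t)))) := by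
      intro t ht
      have ht : 0 < t := ht
      rw [← ofReal_norm, Real.norm_of_nonneg (by positivity), ← ENNReal.ofReal_pow (by positivity)]
      congr 1
      have e1 : t ^ ((e + 1) - 1) = (t ^ (e / 2)) ^ 2 := by
        rw [← Real.rpow_natCast, ← Real.rpow_mul ht.le]; congr 1; push_cast; ring
      have e2 : Real.exp (-((2 * y ^ 2) * t)) = Real.exp (-(t * y ^ 2)) ^ 2 := by
        rw [← Real.exp_nat_mul]; congr 1; push_cast; ring
      rw [e1, e2]; ring
    rw [setLIntegral_congr_fun measurableSet_Ioi h1]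
    have hval := Real.integral_rpow_mul_exp_neg_mul_Ioi (a := e + 1) (r := 2 * y ^ 2)
      (by linarith) (by positivity)
    have hint : IntegrableOn (fun t : ℝ => t ^ ((e + 1) - 1) * Real.exp (-((2 * y ^ 2) * t)))
        (Set.Ioi 0) := by
      by_contra h
      rw [integral_undef h] at hval
      have : 0 < (1 / (2 * y ^ 2)) ^ (e + 1) * Real.Gamma (e + 1) := by positivity
      linarith
    rw [← ofReal_integral_eq_lintegral_ofReal (hint.const_mul _), integral_const_mul, hval,
      ← ofReal_norm, Real.norm_of_nonneg (by positivity), ← ENNReal.ofReal_pow (by positivity),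
      ← ENNReal.ofReal_mul hΓ.le]
    · apply ENNReal.ofReal_le_ofReal
      have e1 : y ^ j = y ^ j0 * y ^ (e + 1) := by rw [← Real.rpow_add h0]; congr 1; linarith
      have e2 : (1 / (2 * y ^ 2)) ^ (e + 1) = (1/2) ^ (e + 1) * (y ^ (e + 1))⁻¹ ^ 2 := by
        rw [← Real.rpow_neg h0.le, ← Real.rpow_natCast (y ^ (-(e + 1))), ← Real.rpow_mul h0.le]
        have : 1 / (2 * y ^ 2) = (1/2) * y ^ (-2 : ℝ) := by
          rw [Real.rpow_neg h0.le]; simp; ring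
        rw [this, Real.mul_rpow (by positivity) (by positivity), ← Real.rpow_mul h0.le]
        congr 2; push_cast; ring
      rw [e1, e2]
      have h3 : 0 < y ^ (e + 1) := by positivity
      have h4 : ((1:ℝ)/2) ^ (e + 1) ≤ 1 := Real.rpow_le_one (by norm_num) (by norm_num) (by linarith)
      calc (y ^ j0 * y ^ (e + 1)) ^ 2 * ((1/2) ^ (e + 1) * (y ^ (e + 1))⁻¹ ^ 2 * Real.Gamma (e + 1))
          = ((1/2) ^ (e + 1)) * (Real.Gamma (e + 1) * (y ^ j0) ^ 2) := by field_simp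
        _ ≤ 1 * (Real.Gamma (e + 1) * (y ^ j0) ^ 2) := by gcongr
        _ = _ := one_mul _
    · filter_upwards [ae_restrict_mem measurableSet_Ioi] with t ht
      have ht : 0 < t := ht
      simp only [Pi.zero_apply]; positivity

/-- the one-function heat square estimate -/
lemma heat_sq {e j j0 : ℝ} (he : -1 < e) (hj0 : 0 ≤ j0) (hj : j = j0 + e + 1) {β : EE n → ℂ}
    (hβ : Continuous β) :
    ∫⁻ t in Set.Ioi (0:ℝ), eLpNorm (fun η => ((t ^ (e / 2) * (‖η‖ ^ j * ht t η) : ℝ) : ℂ) * β η) 2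
      volume ^ 2 ≤ ENNReal.ofReal (Real.Gamma (e + 1)) *
        eLpNorm (fun η => ((‖η‖ ^ j0 : ℝ) : ℂ) * β η) 2 volume ^ 2 := by
  refine sq_one (A := fun (t : ℝ) (η : EE n) => t ^ (e / 2) * (‖η‖ ^ j * ht t η)) ?_ hβ
    (w := fun η => ‖η‖ ^ j0) fun η => ?_
  · unfold Function.uncurry ht
    have hj' : 0 ≤ j := by linarith
    fun_prop
  · exact gauss_weight he hj0 hj (norm_nonneg η)

lemma heat_meas {e j : ℝ} {β : EE n → ℂ} (hβ : Continuous β) :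
    Measurable (fun t : ℝ => eLpNorm (fun η => ((t ^ (e / 2) * (‖η‖ ^ j * ht t η) : ℝ) : ℂ) * β η) 2
      volume) := by
  refine meas_eLpNorm (A := fun (t : ℝ) (η : EE n) => t ^ (e / 2) * (‖η‖ ^ j * ht t η)) ?_ hβ
  unfold Function.uncurry ht
  fun_prop

lemma eLpNorm_ofReal_mul {c : ℝ} (hc : 0 ≤ c) (F : EE n → ℂ) :
    eLpNorm (fun x => (c : ℂ) * F x) 2 volume = ENNReal.ofReal c * eLpNorm F 2 volume := by
  have := eLpNorm_const_smul (c : ℂ) F 2 (volume : Measure (EE n))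
  rw [← ofReal_norm, Complex.norm_real, Real.norm_of_nonneg hc] at this
  exact this

/-- two-function heat estimate -/
lemma heat_two {e₁ e₂ j j0 k k0 m : ℝ} (he₁ : -1 < e₁) (hj0 : 0 ≤ j0) (hj : j = j0 + e₁ + 1)
    (he₂ : -1 < e₂) (hk0 : 0 ≤ k0) (hk : k = k0 + e₂ + 1) (hm : m = (e₁ + e₂) / 2)
    {β γ : EE n → ℂ} (hβ : Continuous β) (hγ : Continuous γ) :
    ∫⁻ t in Set.Ioi (0:ℝ), ENNReal.ofReal (t ^ m) *
      (eLpNorm (fun η => ((‖η‖ ^ j : ℝ) : ℂ) * hf t β η) 2 volume *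
       eLpNorm (fun η => ((‖η‖ ^ k : ℝ) : ℂ) * hf t γ η) 2 volume) ≤
      ENNReal.ofReal (√(Real.Gamma (e₁ + 1)) * √(Real.Gamma (e₂ + 1))) *
        eLpNorm (fun η => ((‖η‖ ^ j0 : ℝ) : ℂ) * β η) 2 volume *
        eLpNorm (fun η => ((‖η‖ ^ k0 : ℝ) : ℂ) * γ η) 2 volume := by
  refine le_trans ?_ (cs_lint (heat_meas hβ).aemeasurable (heat_meas hγ).aemeasurable
    (Real.Gamma_pos_of_pos (by linarith)).le (Real.Gamma_pos_of_pos (by linarith)).le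
    (heat_sq he₁ hj0 hj hβ) (heat_sq he₂ hk0 hk hγ))
  refine setLIntegral_mono' measurableSet_Ioi fun t ht' => le_of_eq ?_
  have ht' : 0 < t := ht'
  have key : ∀ (e j : ℝ) (β : EE n → ℂ),
      eLpNorm (fun η => ((t ^ (e / 2) * (‖η‖ ^ j * ht t η) : ℝ) : ℂ) * β η) 2 volume =
      ENNReal.ofReal (t ^ (e/2)) * eLpNorm (fun η => ((‖η‖ ^ j : ℝ) : ℂ) * hf t β η) 2 volume := by
    intro e j β
    rw [← eLpNorm_ofReal_mul (by positivity)]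
    congr 1; ext η; unfold hf; push_cast; ring
  rw [key, key, hm, add_div, Real.rpow_add ht', ENNReal.ofReal_mul (by positivity)]
  ring

end KP

end Part4

section Part5

open MeasureTheory
open scoped FourierTransform ENNReal ContDiff

namespace KP
variable {n : ℕ}

lemma Good_alpha {m : ℕ} {s j k : ℝ} (hs : 1 ≤ s) {S : EE n × EE n → ℝ} (hS : MA j k S)
    (hj : s - 1 < j) (hk : 0 < k) (h : 1 + j + k = s + 2 * m) (l : Fin n) :
    Good m s (fun p => p.1 l * S p) := by
  obtain ⟨hS, C, hC, hb⟩ := hS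
  refine ⟨(coord_pg l).fst.mul hS, C * (√(Real.Gamma (j - s + 1)) * √(Real.Gamma (k - 1 + 1))),
    by positivity, fun a h ψ aD X Y hA => ?_⟩
  have h1 := heat_two (n := n) (e₁ := j - s) (e₂ := k - 1) (j := j) (j0 := s - 1) (k := k)
    (k0 := 0) (m := (m:ℝ) - 1) (by linarith) (by linarith) (by ring) (by linarith) le_rfl (by ring)
    (by linarith) (ft h).continuous (ft ψ).continuous
  calc _ ≤ ∫⁻ t in Set.Ioi (0:ℝ), (ENNReal.ofReal C * ENNReal.ofReal X) *
        (ENNReal.ofReal (t ^ ((m:ℝ) - 1)) *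
      (eLpNorm (fun η => ((‖η‖ ^ j : ℝ) : ℂ) * hf t (ft h) η) 2 volume *
       eLpNorm (fun η => ((‖η‖ ^ k : ℝ) : ℂ) * hf t (ft ψ) η) 2 volume)) := by
        refine setLIntegral_mono' measurableSet_Ioi fun t ht' => ?_
        have ht0 : 0 < t := ht'
        have e : TS (fun p => p.1 l * S p) (hf t (ft a)) (hf t (ft h)) (hf t (ft ψ)) =
            TS S (ft (heat t (aD l))) (hf t (ft h)) (hf t (ft ψ)) := by
          rw [← hf_ft ht0.le]
          unfold TS hf
          congr 1; ext p; rw [hA.der l]; push_cast; ring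
        rw [e]
        refine (mul_le_mul_right (hb (heat t (aD l)) X (heat_bound ht0 _ (hA.bX l)) _ _
          (hf_nc ht0.le (Nc.of_schwartz _)) (hf_nc ht0.le (Nc.of_schwartz _))) _).trans_eq ?_
        ring
    _ ≤ (ENNReal.ofReal C * ENNReal.ofReal X) *
        (ENNReal.ofReal (√(Real.Gamma (j - s + 1)) * √(Real.Gamma (k - 1 + 1))) *
        eLpNorm (fun η => ((‖η‖ ^ (s - 1) : ℝ) : ℂ) * ft h η) 2 volume *
        eLpNorm (fun η => ((‖η‖ ^ (0:ℝ) : ℝ) : ℂ) * ft ψ η) 2 volume) := by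
        rw [lintegral_const_mul' _ _ (by finiteness)]
        gcongr
    _ = ENNReal.ofReal (C * (√(Real.Gamma (j - s + 1)) * √(Real.Gamma (k - 1 + 1)))) *
        ((ENNReal.ofReal X * eLpNorm (fun η => ((‖η‖ ^ (s - 1) : ℝ) : ℂ) * ft h η) 2 volume) *
          eLpNorm (ft ψ) 2 volume) := by
        rw [ENNReal.ofReal_mul hC]
        simp only [Real.rpow_zero, Complex.ofReal_one, one_mul]
        ring
    _ ≤ _ := by
        unfold RH
        gcongr
        exact le_self_add

lemma TS_swap (S : EE n × EE n → ℝ) (α β γ : EE n → ℂ) :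
    TS S α β γ = TS (fun p => S p.swap) β α γ := by
  unfold TS
  have h := (Measure.measurePreserving_swap (μ := (volume : Measure (EE n)))
    (ν := (volume : Measure (EE n)))).integral_comp MeasurableEquiv.prodComm.measurableEmbedding
    (fun p => (S p : ℂ) * (α p.1 * β p.2 * γ (p.1 + p.2)))
  refine h.symm.trans ?_
  congr 1
  ext p
  simp only [Prod.fst_swap, Prod.snd_swap]
  rw [add_comm p.2 p.1]
  ring

lemma Good_beta {m : ℕ} {s i k : ℝ} (hs : 1 ≤ s) {S : EE n × EE n → ℝ}
    (hS : MA i k (fun p => S p.swap))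
    (hi : s < i) (hk : 0 < k) (h : i + k = s + 2 * m) :
    Good m s S := by
  obtain ⟨hS, C, hC, hb⟩ := hS
  refine ⟨hS.swap, C * (√(Real.Gamma (i - s - 1 + 1)) * √(Real.Gamma (k - 1 + 1))),
    by positivity, fun a h ψ aD X Y hA => ?_⟩
  have h1 := heat_two (n := n) (e₁ := i - s - 1) (e₂ := k - 1) (j := i) (j0 := s) (k := k)
    (k0 := 0) (m := (m:ℝ) - 1) (by linarith) (by linarith) (by ring) (by linarith) le_rfl (by ring)
    (by linarith) (ft a).continuous (ft ψ).continuous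
  calc _ ≤ ∫⁻ t in Set.Ioi (0:ℝ), (ENNReal.ofReal C * ENNReal.ofReal Y) *
        (ENNReal.ofReal (t ^ ((m:ℝ) - 1)) *
      (eLpNorm (fun η => ((‖η‖ ^ i : ℝ) : ℂ) * hf t (ft a) η) 2 volume *
       eLpNorm (fun η => ((‖η‖ ^ k : ℝ) : ℂ) * hf t (ft ψ) η) 2 volume)) := by
        refine setLIntegral_mono' measurableSet_Ioi fun t ht' => ?_
        have ht0 : 0 < t := ht'
        rw [TS_swap, hf_ft ht0.le h]
        refine (mul_le_mul_right (hb (heat t h) Y (heat_bound ht0 _ hA.bY) _ _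
          (hf_nc ht0.le (Nc.of_schwartz _)) (hf_nc ht0.le (Nc.of_schwartz _))) _).trans_eq ?_
        ring
    _ ≤ (ENNReal.ofReal C * ENNReal.ofReal Y) *
        (ENNReal.ofReal (√(Real.Gamma (i - s - 1 + 1)) * √(Real.Gamma (k - 1 + 1))) *
        eLpNorm (fun η => ((‖η‖ ^ s : ℝ) : ℂ) * ft a η) 2 volume *
        eLpNorm (fun η => ((‖η‖ ^ (0:ℝ) : ℝ) : ℂ) * ft ψ η) 2 volume) := by
        rw [lintegral_const_mul' _ _ (by finiteness)]
        gcongr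
    _ = ENNReal.ofReal (C * (√(Real.Gamma (i - s - 1 + 1)) * √(Real.Gamma (k - 1 + 1)))) *
        ((eLpNorm (fun η => ((‖η‖ ^ s : ℝ) : ℂ) * ft a η) 2 volume * ENNReal.ofReal Y) *
          eLpNorm (ft ψ) 2 volume) := by
        rw [ENNReal.ofReal_mul hC]
        simp only [Real.rpow_zero, Complex.ofReal_one, one_mul]
        ring
    _ ≤ _ := by
        unfold RH
        gcongr
        exact le_add_self

lemma Good_alpha_u {m : ℕ} {s : ℝ} (hs : 1 ≤ s) (l : Fin n) (c : ℕ) :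
    ∀ {j k : ℝ} {S : EE n × EE n → ℝ}, MA j k S →
    s - 1 < j → 0 < k → 1 + j + k + 2 * c = s + 2 * m →
    Good m s (fun p => p.1 l * (S p * (inner ℝ p.1 (p.1 + p.2)) ^ c)) := by
  induction c with
  | zero =>
    intro j k S hS hj hk h
    exact (Good_alpha hs hS hj hk (by simpa using h) l).congr fun p => by simp
  | succ c ih =>
    intro j k S hS hj hk h
    push_cast at h
    have h1 := ih (hS.mul_x2 hk.le) hj (by linarith) (by linarith)
    have h2 := ih (hS.mul_v (by linarith) hk.le) (by linarith) (by linarith) (by linarith)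
    refine (h1.sub h2).congr fun p => ?_
    have : inner ℝ p.1 (p.1 + p.2) = ‖p.1 + p.2‖ ^ 2 - inner ℝ p.2 (p.1 + p.2) := by
      rw [← real_inner_self_eq_norm_sq, inner_add_left (p.1)]; ring
    linear_combination (-(p.1 l) * S p * inner ℝ p.1 (p.1 + p.2) ^ c) * this

lemma Good_beta_y {m : ℕ} {s : ℝ} (hs : 1 ≤ s) (d : ℕ) :
    ∀ {i k : ℝ} {S : EE n × EE n → ℝ}, MA i k (fun p => S p.swap) →
    s < i → 0 < k → i + k + 2 * d = s + 2 * m →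
    Good m s (fun p => S p * (‖p.2‖ ^ 2) ^ d) := by
  induction d with
  | zero =>
    intro i k S hS hi hk h
    exact (Good_beta hs hS hi hk (by simpa using h)).congr fun p => by simp
  | succ d ih =>
    intro i k S hS hi hk h
    push_cast at h
    have h1 := ih (S := fun p => ‖p.1 + p.2‖ ^ 2 * S p) (i := i) (k := k + 2)
      ((hS.mul_x2 hk.le).congr rfl rfl fun p => by simp [add_comm]) hi (by linarith) (by linarith)
    have h2 := ih (S := fun p => inner ℝ p.1 (p.1 + p.2) * S p) (i := i + 1) (k := k + 1)
      ((hS.mul_v (by linarith) hk.le).congr rfl rfl fun p => by simp [add_comm])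
      (by linarith) (by linarith) (by linarith)
    have h3 := ih (S := fun p => ‖p.1‖ ^ 2 * S p) (i := i + 2) (k := k)
      ((hS.mul_y2 (by linarith)).congr rfl rfl fun p => by simp)
      (by linarith) (by linarith) (by linarith)
    refine ((h1.sub (h2.const_mul 2)).add h3).congr fun p => ?_
    have : ‖p.2‖ ^ 2 = ‖p.1 + p.2‖ ^ 2 - 2 * inner ℝ p.1 (p.1 + p.2) + ‖p.1‖ ^ 2 := by
      rw [norm_add_sq_real, inner_add_right, real_inner_self_eq_norm_sq]; ring
    linear_combination (- S p * (‖p.2‖ ^ 2) ^ d) * this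

end KP

end Part5

section Part6

open MeasureTheory
open scoped FourierTransform ENNReal ContDiff

namespace KP
variable {n : ℕ}

/-- the positive half line -/
noncomputable abbrev hl : Measure ℝ := volume.restrict (Set.Ioi (0:ℝ))

/-- normalising constant -/
noncomputable def cp (f : ℝ) : ℝ := ∫ t in Set.Ioi (0:ℝ), Real.rpowIntegrand₀₁ f t 1

lemma cp_pos {f : ℝ} (hf : f ∈ Set.Ioo (0:ℝ) 1) : 0 < cp f := by
  exact Real.integral_rpowIntegrand₀₁_one_pos hf

lemma lam_weight {f y : ℝ} (hf : f ∈ Set.Ioo (0:ℝ) 1) (hy : 0 < y) :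
    ∫⁻ r, ‖r ^ (f / 2) * (y ^ (1 - f) * (r + y ^ 2)⁻¹)‖ₑ ^ 2 ∂hl ≤ ENNReal.ofReal (cp f) := by
  have hi := Real.integrableOn_rpowIntegrand₀₁_Ioi hf (sq_nonneg y)
  have hv := Real.integral_rpowIntegrand₀₁_eq_rpow_mul_const hf (sq_nonneg y)
  calc _ ≤ ∫⁻ r, ENNReal.ofReal ((y ^ (2 * f))⁻¹ * Real.rpowIntegrand₀₁ f r (y ^ 2)) ∂hl := by
        refine setLIntegral_mono' measurableSet_Ioi fun r hr => ?_
        have hr : 0 < r := hr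
        rw [← ofReal_norm, Real.norm_of_nonneg (by positivity), ← ENNReal.ofReal_pow (by positivity)]
        apply ENNReal.ofReal_le_ofReal
        rw [Real.rpowIntegrand₀₁_eq_pow_div hf hr.le (sq_nonneg y)]
        have e1 : (r ^ (f/2)) ^ 2 = r ^ (f - 1) * r := by
          rw [← Real.rpow_natCast, ← Real.rpow_mul hr.le, ← Real.rpow_add_one hr.ne']
          congr 1; push_cast; ring
        have e2 : (y ^ (1 - f)) ^ 2 * y ^ (2 * f) = y ^ 2 := by
          rw [← Real.rpow_natCast, ← Real.rpow_mul hy.le, ← Real.rpow_add hy, ← Real.rpow_natCast]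
          congr 1; push_cast; ring
        have h3 : 0 < y ^ (2 * f) := by positivity
        have h4 : (y ^ (1 - f)) ^ 2 = (y ^ (2 * f))⁻¹ * y ^ 2 := by
          rw [← e2]; field_simp
        rw [mul_pow, mul_pow, e1, h4]
        have h5 : r * (r + y ^ 2)⁻¹ ≤ 1 := by
          rw [← div_eq_mul_inv, div_le_one (by positivity)]; nlinarith
        calc r ^ (f - 1) * r * ((y ^ (2 * f))⁻¹ * y ^ 2 * (r + y ^ 2)⁻¹ ^ 2)
            = ((y ^ (2 * f))⁻¹ * (r ^ (f - 1) * y ^ 2 / (r + y ^ 2))) * (r * (r + y ^ 2)⁻¹) := by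
              field_simp
          _ ≤ ((y ^ (2 * f))⁻¹ * (r ^ (f - 1) * y ^ 2 / (r + y ^ 2))) * 1 := by gcongr
          _ = _ := mul_one _
    _ = ENNReal.ofReal (cp f) := by
        rw [← ofReal_integral_eq_lintegral_ofReal (hi.const_mul _), integral_const_mul, hv]
        · congr 1
          have : (y ^ 2) ^ f = y ^ (2 * f) := by
            rw [Real.rpow_mul hy.le]; simp
          rw [this, ← mul_assoc, inv_mul_cancel₀ (by positivity), one_mul]
          rfl
        · filter_upwards [ae_restrict_mem measurableSet_Ioi] with r hr
          have hr : 0 < r := hr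
          have := Real.rpowIntegrand₀₁_nonneg hf.1 hr.le (sq_nonneg y)
          simp only [Pi.zero_apply]; positivity

/-- joint weight -/
noncomputable def jw (e f j : ℝ) (θ : ℝ × ℝ) (η : EE n) : ℝ :=
  (θ.1 ^ (e / 2) * ht θ.1 η) * (θ.2 ^ (f / 2) * (‖η‖ ^ j * (θ.2 + ‖η‖ ^ 2)⁻¹))

lemma jw_meas (e f j : ℝ) : Measurable (Function.uncurry (jw e f j : ℝ × ℝ → EE n → ℝ)) := by
  unfold Function.uncurry jw ht
  fun_prop

lemma jw_weight {e f j j0 : ℝ} (he : -1 < e) (hf : f ∈ Set.Ioo (0:ℝ) 1) (hj0 : 0 ≤ j0)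
    (hj : j = j0 + e + 1 + (1 - f)) (η : EE n) :
    ∫⁻ θ, ‖jw e f j θ η‖ₑ ^ 2 ∂(hl.prod hl) ≤
      ENNReal.ofReal (Real.Gamma (e + 1) * cp f) * ‖‖η‖ ^ j0‖ₑ ^ 2 := by
  have hf1 := hf.1
  have hf2 := hf.2
  rcases (norm_nonneg η).eq_or_lt with h0 | h0
  · simp [jw, ← h0, Real.zero_rpow (show j ≠ 0 by linarith)]
  set y := ‖η‖ with hy
  have e1 : ∀ θ : ℝ × ℝ, ‖jw e f j θ η‖ₑ ^ 2 =
      ‖θ.1 ^ (e / 2) * (y ^ (j0 + e + 1) * Real.exp (-(θ.1 * y ^ 2)))‖ₑ ^ 2 *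
      ‖θ.2 ^ (f / 2) * (y ^ (1 - f) * (θ.2 + y ^ 2)⁻¹)‖ₑ ^ 2 := by
    intro θ
    rw [← mul_pow, ← enorm_mul]
    congr 2
    unfold jw ht
    rw [← hy, hj, Real.rpow_add h0 (j0 + e + 1)]
    ring
  simp only [e1]
  rw [lintegral_prod_mul
    (f := fun a : ℝ => ‖a ^ (e / 2) * (y ^ (j0 + e + 1) * Real.exp (-(a * y ^ 2)))‖ₑ ^ 2)
    (g := fun b : ℝ => ‖b ^ (f / 2) * (y ^ (1 - f) * (b + y ^ 2)⁻¹)‖ₑ ^ 2) (by fun_prop) (by fun_prop),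
    ENNReal.ofReal_mul (Real.Gamma_pos_of_pos (by linarith)).le]
  refine (mul_le_mul' (gauss_weight he hj0 rfl h0.le) (lam_weight hf h0)).trans_eq ?_
  ring

lemma jw_two {e₁ e₂ f j j0 k k0 : ℝ} (hf : f ∈ Set.Ioo (0:ℝ) 1) (he₁ : -1 < e₁) (hj0 : 0 ≤ j0)
    (hj : j = j0 + e₁ + 1 + (1 - f))
    (he₂ : -1 < e₂) (hk0 : 0 ≤ k0) (hk : k = k0 + e₂ + 1 + (1 - f))
    {β γ : EE n → ℂ} (hβ : Continuous β) (hγ : Continuous γ) :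
    ∫⁻ θ, (eLpNorm (fun η => (jw e₁ f j θ η : ℂ) * β η) 2 volume *
       eLpNorm (fun η => (jw e₂ f k θ η : ℂ) * γ η) 2 volume) ∂(hl.prod hl) ≤
      ENNReal.ofReal (√(Real.Gamma (e₁ + 1) * cp f) * √(Real.Gamma (e₂ + 1) * cp f)) *
        eLpNorm (fun η => ((‖η‖ ^ j0 : ℝ) : ℂ) * β η) 2 volume *
        eLpNorm (fun η => ((‖η‖ ^ k0 : ℝ) : ℂ) * γ η) 2 volume := by
  have h1 := (Real.Gamma_pos_of_pos (show 0 < e₁ + 1 by linarith)).le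
  have h2 := (Real.Gamma_pos_of_pos (show 0 < e₂ + 1 by linarith)).le
  have h3 := (cp_pos hf).le
  exact cs_lint (meas_eLpNorm (jw_meas e₁ f j) hβ).aemeasurable
    (meas_eLpNorm (jw_meas e₂ f k) hγ).aemeasurable
    (by positivity) (by positivity) (sq_one (jw_meas e₁ f j) hβ (jw_weight he₁ hf hj0 hj))
    (sq_one (jw_meas e₂ f k) hγ (jw_weight he₂ hf hk0 hk))

/-- resolvent weight -/
noncomputable def rw' (f j r : ℝ) (η : EE n) : ℝ := r ^ (f / 2) * (‖η‖ ^ j * (r + ‖η‖ ^ 2)⁻¹)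

lemma rw'_pg {f j r : ℝ} (hj : 0 ≤ j) (hr : 0 < r) : PG (rw' f j r : EE n → ℝ) := by
  refine PG.of_le ?_ ((PG.const (r ^ (f/2) * r⁻¹)).mul (PG.norm_rpow hj)) fun x => ?_
  · unfold rw'
    refine continuous_const.mul ((PG.norm_rpow hj).cont.mul (Continuous.inv₀ (by fun_prop) ?_))
    intro x; positivity
  · unfold rw'
    rw [abs_of_nonneg (by positivity), abs_of_nonneg (by positivity)]
    have : (r + ‖x‖ ^ 2)⁻¹ ≤ r⁻¹ := by gcongr; nlinarith [sq_nonneg ‖x‖]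
    calc r ^ (f / 2) * (‖x‖ ^ j * (r + ‖x‖ ^ 2)⁻¹) ≤ r ^ (f / 2) * (‖x‖ ^ j * r⁻¹) := by gcongr
      _ = _ := by ring

/-- `ζ_l A(η) B(ξ)` with `A`, `B` dominated. -/
lemma TS_sep {a : SchwartzMap (EE n) ℂ} {X : ℝ} {aD : SchwartzMap (EE n) ℂ} {l : Fin n}
    (hd : ∀ ζ, ft aD ζ = ((ζ l : ℝ) : ℂ) * ft a ζ) (hX : ∀ x, ‖aD x‖ ≤ X)
    {t : ℝ} (ht0 : 0 < t) {A B A' B' : EE n → ℝ} (hA : PG A) (hB : PG B)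
    (hA' : ∀ x, |A x| ≤ |A' x|) (hB' : ∀ x, |B x| ≤ |B' x|) {β γ : EE n → ℂ} (hβ : Nc β)
    (hγ : Nc γ) :
    ‖TS (fun p => p.1 l * (A p.2 * B (p.1 + p.2))) (hf t (ft a)) β γ‖ₑ ≤
      ENNReal.ofReal X * (eLpNorm (fun η => (A' η : ℂ) * β η) 2 volume *
        eLpNorm (fun η => (B' η : ℂ) * γ η) 2 volume) := by
  have e : TS (fun p => p.1 l * (A p.2 * B (p.1 + p.2))) (hf t (ft a)) β γ =
      TS (fun _ => 1) (ft (heat t aD)) (fun η => (A η : ℂ) * β η) (fun η => (B η : ℂ) * γ η) := by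
    rw [← hf_ft ht0.le]
    unfold TS hf
    congr 1; ext p; rw [hd]; push_cast; ring
  rw [e]
  have hm : ∀ (A A' : EE n → ℝ) (β : EE n → ℂ), (∀ x, |A x| ≤ |A' x|) →
      eLpNorm (fun η => (A η : ℂ) * β η) 2 volume ≤ eLpNorm (fun η => (A' η : ℂ) * β η) 2 volume := by
    intro A A' β h
    refine eLpNorm_mono fun x => ?_
    rw [norm_mul, norm_mul, Complex.norm_real, Complex.norm_real]
    gcongr
    exact h x
  refine (T_bound (heat t aD) (heat_bound ht0 _ hX) (hβ.mul_pg hA) (hγ.mul_pg hB)).trans ?_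
  rw [mul_assoc]
  gcongr
  · exact hm _ _ _ hA'
  · exact hm _ _ _ hB'

lemma Good_kappa {m : ℕ} {s f j k : ℝ} (hs : 1 ≤ s) (hf0 : f ∈ Set.Ioo (0:ℝ) 1)
    (hj : s ≤ j) (hk : 1 ≤ k) (h : j + k + 2 * f = s + 2 * m) :
    Good m s (fun p : EE n × EE n => ‖p.2‖ ^ j * ‖p.1 + p.2‖ ^ k *
      ((‖p.1 + p.2‖ ^ 2) ^ f - (‖p.2‖ ^ 2) ^ f)) := by
  have hf1 := hf0.1
  have hf2 := hf0.2
  have hpj : PG (fun p : EE n × EE n => ‖p.2‖ ^ j * ‖p.1 + p.2‖ ^ k) :=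
    ((PG.norm_rpow (V := EE n) (show 0 ≤ j by linarith)).snd).mul
      ((PG.norm_rpow (V := EE n) (show 0 ≤ k by linarith)).plus)
  have hp2 : PG (fun x : EE n => (‖x‖ ^ 2) ^ f) := by
    have := PG.norm_rpow (V := EE n) (show 0 ≤ 2 * f by linarith)
    convert this using 2 with x
    rw [Real.rpow_mul (norm_nonneg x)]; simp
  have hS : PG (fun p : EE n × EE n => ‖p.2‖ ^ j * ‖p.1 + p.2‖ ^ k *
      ((‖p.1 + p.2‖ ^ 2) ^ f - (‖p.2‖ ^ 2) ^ f)) := hpj.mul (hp2.plus.sub hp2.snd)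
  set C₁ := √(Real.Gamma (j - s - 1 + f + 1) * cp f) * √(Real.Gamma (k - 1 + f + 1) * cp f)
  set C₂ := √(Real.Gamma (j - s + f + 1) * cp f) * √(Real.Gamma (k - 2 + f + 1) * cp f)
  have hC₁ : 0 ≤ C₁ := by positivity
  have hC₂ : 0 ≤ C₂ := by positivity
  have hcp := cp_pos hf0
  refine ⟨hS, (cp f)⁻¹ * (n * (C₁ + C₂)), by positivity, fun a b ψ aD X Y hA => ?_⟩
  -- the kernel
  set K : ℝ → EE n × EE n → ℝ := fun r p => (cp f)⁻¹ * (‖p.2‖ ^ j * ‖p.1 + p.2‖ ^ k *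
    (Real.rpowIntegrand₀₁ f r (‖p.1 + p.2‖ ^ 2) - Real.rpowIntegrand₀₁ f r (‖p.2‖ ^ 2))) with hK
  have hKm : Measurable (Function.uncurry K) := by
    rw [hK]; unfold Function.uncurry Real.rpowIntegrand₀₁
    fun_prop
  have hi : ∀ y : ℝ, Integrable (fun r => Real.rpowIntegrand₀₁ f r (y ^ 2)) hl := fun y =>
    Real.integrableOn_rpowIntegrand₀₁_Ioi hf0 (sq_nonneg y)
  have hv : ∀ y : ℝ, ∫ r, Real.rpowIntegrand₀₁ f r (y ^ 2) ∂hl = (y ^ 2) ^ f * cp f := fun y =>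
    Real.integral_rpowIntegrand₀₁_eq_rpow_mul_const hf0 (sq_nonneg y)
  have hKS : ∀ p, (fun p : EE n × EE n => ‖p.2‖ ^ j * ‖p.1 + p.2‖ ^ k *
      ((‖p.1 + p.2‖ ^ 2) ^ f - (‖p.2‖ ^ 2) ^ f)) p = ∫ r, K r p ∂hl := by
    intro p
    rw [hK]
    simp only
    rw [integral_const_mul, integral_const_mul, integral_sub (hi _) (hi _), hv, hv]
    field_simp
  have hP : PG (fun p : EE n × EE n => ‖p.2‖ ^ j * ‖p.1 + p.2‖ ^ k *
      ((‖p.1 + p.2‖ ^ 2) ^ f + (‖p.2‖ ^ 2) ^ f)) := hpj.mul (hp2.plus.add hp2.snd)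
  have hKP : ∀ p, ∫⁻ r, ‖K r p‖ₑ ∂hl ≤ ENNReal.ofReal ((fun p : EE n × EE n =>
      ‖p.2‖ ^ j * ‖p.1 + p.2‖ ^ k * ((‖p.1 + p.2‖ ^ 2) ^ f + (‖p.2‖ ^ 2) ^ f)) p) := by
    intro p
    have : (fun p : EE n × EE n => ‖p.2‖ ^ j * ‖p.1 + p.2‖ ^ k *
      ((‖p.1 + p.2‖ ^ 2) ^ f + (‖p.2‖ ^ 2) ^ f)) p = ∫ r, (cp f)⁻¹ * (‖p.2‖ ^ j * ‖p.1 + p.2‖ ^ k *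
    (Real.rpowIntegrand₀₁ f r (‖p.1 + p.2‖ ^ 2) + Real.rpowIntegrand₀₁ f r (‖p.2‖ ^ 2))) ∂hl := by
      rw [integral_const_mul, integral_const_mul, integral_add (hi _) (hi _), hv, hv]
      field_simp
    have hI : Integrable (fun r => (cp f)⁻¹ * (‖p.2‖ ^ j * ‖p.1 + p.2‖ ^ k *
      (Real.rpowIntegrand₀₁ f r (‖p.1 + p.2‖ ^ 2) + Real.rpowIntegrand₀₁ f r (‖p.2‖ ^ 2)))) hl :=
      (((hi _).add (hi _)).const_mul _).const_mul _
    rw [this, ofReal_integral_eq_lintegral_ofReal hI]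
    · refine setLIntegral_mono' measurableSet_Ioi fun r hr => ?_
      have hr : 0 < r := hr
      have n1 := Real.rpowIntegrand₀₁_nonneg hf1 hr.le (sq_nonneg ‖p.1 + p.2‖)
      have n2 := Real.rpowIntegrand₀₁_nonneg hf1 hr.le (sq_nonneg ‖p.2‖)
      rw [← ofReal_norm, Real.norm_eq_abs, hK]
      apply ENNReal.ofReal_le_ofReal
      simp only
      rw [abs_mul, abs_mul, abs_of_nonneg (show 0 ≤ (cp f)⁻¹ by positivity),
        abs_of_nonneg (show 0 ≤ ‖p.2‖ ^ j * ‖p.1 + p.2‖ ^ k by positivity)]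
      gcongr
      rw [abs_le]; constructor <;> linarith
    · filter_upwards [ae_restrict_mem measurableSet_Ioi] with r hr
      have hr : 0 < r := hr
      have n1 := Real.rpowIntegrand₀₁_nonneg hf1 hr.le (sq_nonneg ‖p.1 + p.2‖)
      have n2 := Real.rpowIntegrand₀₁_nonneg hf1 hr.le (sq_nonneg ‖p.2‖)
      simp only [Pi.zero_apply]; positivity
  -- the bound for fixed parameters
  set G : (e j : ℝ) → (EE n → ℂ) → ℝ × ℝ → ℝ≥0∞ := fun e j β θ =>
    eLpNorm (fun η => (jw e f j θ η : ℂ) * β η) 2 volume with hG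
  have hGm : ∀ e j (β : SchwartzMap (EE n) ℂ), Measurable (G e j β) := fun e j β =>
    meas_eLpNorm (jw_meas e f j) β.continuous
  have hbd : ∀ t r : ℝ, 0 < t → 0 < r → ENNReal.ofReal (t ^ ((m:ℝ) - 1)) *
      ‖TS (K r) (hf t (ft a)) (hf t (ft b)) (hf t (ft ψ))‖ₑ ≤
      (ENNReal.ofReal ((cp f)⁻¹) * (n * ENNReal.ofReal X)) *
       (G (j - s - 1 + f) j (ft b) (t, r) * G (k - 1 + f) (k + 1) (ft ψ) (t, r) +
        G (j - s + f) (j + 1) (ft b) (t, r) * G (k - 2 + f) k (ft ψ) (t, r)) := by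
    intro t r ht0 hr
    have hNb := hf_nc ht0.le (Nc.of_schwartz (ft b))
    have hNa := hf_nc ht0.le (Nc.of_schwartz (ft a))
    have hNψ := hf_nc ht0.le (Nc.of_schwartz (ft ψ))
    have pgA : ∀ l : Fin n, PG (fun p : EE n × EE n => p.1 l *
        (rw' f j r p.2 * ((p.1 + p.2) l * rw' f k r (p.1 + p.2)))) := fun l =>
      (coord_pg l).fst.mul ((rw'_pg (f := f) (by linarith) hr).snd.mul
        (((coord_pg l).mul (rw'_pg (f := f) (j := k) (by linarith) hr)).plus))
    have pgB : ∀ l : Fin n, PG (fun p : EE n × EE n => p.1 l *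
        ((p.2 l * rw' f j r p.2) * rw' f k r (p.1 + p.2))) := fun l =>
      (coord_pg l).fst.mul ((((coord_pg l).mul (rw'_pg (f := f) (j := j) (by linarith) hr)).snd).mul
        ((rw'_pg (f := f) (j := k) (by linarith) hr).plus))
    have eK : TS (K r) (hf t (ft a)) (hf t (ft b)) (hf t (ft ψ)) = ((cp f)⁻¹ : ℝ) *
        ∑ l, (TS (fun p => p.1 l * (rw' f j r p.2 * ((p.1 + p.2) l * rw' f k r (p.1 + p.2))))
            (hf t (ft a)) (hf t (ft b)) (hf t (ft ψ)) +
          TS (fun p => p.1 l * ((p.2 l * rw' f j r p.2) * rw' f k r (p.1 + p.2)))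
            (hf t (ft a)) (hf t (ft b)) (hf t (ft ψ))) := by
      rw [hK]
      simp only
      rw [TS_const_mul]
      congr 1
      simp_rw [← TS_add (pgA _) (pgB _) hNa hNb hNψ]
      unfold TS
      rw [← integral_finsetSum]
      · congr 1; ext p
        rw [← Finset.sum_mul, ← Complex.ofReal_sum]
        congr 2
        have hx : ‖p.1 + p.2‖ ^ 2 - ‖p.2‖ ^ 2 = ∑ l, p.1 l * ((p.1 + p.2) l + p.2 l) := by
          have : ∑ l, p.1 l * ((p.1 + p.2) l + p.2 l) = inner ℝ p.1 ((p.1 + p.2) + p.2) := by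
            rw [inner_sum]; rfl
          rw [this, norm_add_sq_real, inner_add_right, inner_add_right, real_inner_self_eq_norm_sq]
          ring
        have e3 : Real.rpowIntegrand₀₁ f r (‖p.1 + p.2‖ ^ 2) - Real.rpowIntegrand₀₁ f r (‖p.2‖ ^ 2)
            = (r ^ (f/2) * r ^ (f/2)) * ((r + ‖p.2‖ ^ 2)⁻¹ * (r + ‖p.1 + p.2‖ ^ 2)⁻¹) *
              (‖p.1 + p.2‖ ^ 2 - ‖p.2‖ ^ 2) := by
          unfold Real.rpowIntegrand₀₁
          rw [← Real.rpow_add hr, add_halves]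
          have : r + ‖p.2‖ ^ 2 ≠ 0 := by positivity
          have : r + ‖p.1 + p.2‖ ^ 2 ≠ 0 := by positivity
          field_simp
          ring
        beta_reduce
        rw [e3, hx, Finset.mul_sum, Finset.mul_sum]
        refine Finset.sum_congr rfl fun l _ => ?_
        unfold rw'
        ring
      · intro l _
        exact integrable_integrand ((pgA l).add (pgB l)) hNa hNb hNψ
    have hGt : ∀ e j (β : SchwartzMap (EE n) ℂ), G e j β (t, r) = ENNReal.ofReal (t ^ (e/2)) *
        eLpNorm (fun η => (rw' f j r η : ℂ) * hf t β η) 2 volume := by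
      intro e j β
      rw [← eLpNorm_ofReal_mul (by positivity), hG]
      simp only
      congr 1; ext η; unfold jw rw' hf; push_cast; ring
    have ht1 : ∀ e₁ e₂ : ℝ, e₁ + e₂ = 2 * m - 2 → ENNReal.ofReal (t ^ ((m:ℝ) - 1)) =
        ENNReal.ofReal (t ^ (e₁ / 2)) * ENNReal.ofReal (t ^ (e₂ / 2)) := by
      intro e₁ e₂ he
      rw [← ENNReal.ofReal_mul (by positivity), ← Real.rpow_add ht0]
      congr 2; linarith
    have hcoord : ∀ (l : Fin n) (q : ℝ), 0 < q → ∀ x : EE n, |x l * rw' f q r x| ≤ |rw' f (q + 1) r x| := by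
      intro l q hq x
      rw [abs_mul, abs_of_nonneg (show 0 ≤ rw' f q r x by unfold rw'; positivity),
        abs_of_nonneg (show 0 ≤ rw' f (q + 1) r x by unfold rw'; positivity)]
      unfold rw'
      rw [Real.rpow_add_one' (norm_nonneg x) (by linarith)]
      calc _ ≤ ‖x‖ * (r ^ (f / 2) * (‖x‖ ^ q * (r + ‖x‖ ^ 2)⁻¹)) := by
            gcongr; exact coord_bound l x
        _ = _ := by ring
    have b1 : ∀ l, ‖TS (fun p => p.1 l * (rw' f j r p.2 * ((p.1 + p.2) l * rw' f k r (p.1 + p.2))))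
            (hf t (ft a)) (hf t (ft b)) (hf t (ft ψ))‖ₑ ≤ ENNReal.ofReal X *
        (eLpNorm (fun η => (rw' f j r η : ℂ) * hf t (ft b) η) 2 volume *
        eLpNorm (fun η => (rw' f (k + 1) r η : ℂ) * hf t (ft ψ) η) 2 volume) := fun l =>
      TS_sep (hA.der l) (hA.bX l) ht0 (A := rw' f j r) (B := fun x => x l * rw' f k r x)
        (rw'_pg (by linarith) hr) ((coord_pg l).mul (rw'_pg (by linarith) hr)) (fun _ => le_rfl)
        (hcoord l k (by linarith)) hNb hNψ
    have b2 : ∀ l, ‖TS (fun p => p.1 l * ((p.2 l * rw' f j r p.2) * rw' f k r (p.1 + p.2)))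
            (hf t (ft a)) (hf t (ft b)) (hf t (ft ψ))‖ₑ ≤ ENNReal.ofReal X *
        (eLpNorm (fun η => (rw' f (j + 1) r η : ℂ) * hf t (ft b) η) 2 volume *
        eLpNorm (fun η => (rw' f k r η : ℂ) * hf t (ft ψ) η) 2 volume) := fun l =>
      TS_sep (hA.der l) (hA.bX l) ht0 (A := fun x => x l * rw' f j r x) (B := rw' f k r)
        ((coord_pg l).mul (rw'_pg (by linarith) hr)) (rw'_pg (by linarith) hr)
        (hcoord l j (by linarith)) (fun _ => le_rfl) hNb hNψ
    rw [eK, enorm_mul, hGt, hGt, hGt, hGt]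
    have hc : ‖(((cp f)⁻¹ : ℝ) : ℂ)‖ₑ = ENNReal.ofReal ((cp f)⁻¹) := by
      rw [← ofReal_norm, Complex.norm_real, Real.norm_of_nonneg (by positivity)]
    rw [hc]
    refine (mul_le_mul_right (mul_le_mul_right ((enorm_sum_le _ _).trans
      (Finset.sum_le_sum fun l _ => (enorm_add_le _ _).trans (add_le_add (b1 l) (b2 l)))) _)
      _).trans_eq ?_
    rw [Finset.sum_const, Finset.card_univ, Fintype.card_fin, nsmul_eq_mul, mul_add, mul_add,
      mul_add, mul_add]
    congr 1
    · rw [ht1 (j - s - 1 + f) (k - 1 + f) (by linarith)]; ring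
    · rw [ht1 (j - s + f) (k - 2 + f) (by linarith)]; ring
  have J1 := jw_two (n := n) (e₁ := j - s - 1 + f) (e₂ := k - 1 + f) (j := j) (j0 := s - 1)
    (k := k + 1) (k0 := 0) hf0 (by linarith) (by linarith) (by ring) (by linarith) le_rfl (by ring)
    (ft b).continuous (ft ψ).continuous
  have J2 := jw_two (n := n) (e₁ := j - s + f) (e₂ := k - 2 + f) (j := j + 1) (j0 := s - 1)
    (k := k) (k0 := 0) hf0 (by linarith) (by linarith) (by ring) (by linarith) le_rfl (by ring)
    (ft b).continuous (ft ψ).continuous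
  have hGGm : Measurable fun θ : ℝ × ℝ =>
      (G (j - s - 1 + f) j (ft b) θ * G (k - 1 + f) (k + 1) (ft ψ) θ +
        G (j - s + f) (j + 1) (ft b) θ * G (k - 2 + f) k (ft ψ) θ) :=
    ((hGm _ _ _).mul (hGm _ _ _)).add ((hGm _ _ _).mul (hGm _ _ _))
  calc _ ≤ ∫⁻ t, ∫⁻ r, (ENNReal.ofReal ((cp f)⁻¹) * (n * ENNReal.ofReal X)) *
       (G (j - s - 1 + f) j (ft b) (t, r) * G (k - 1 + f) (k + 1) (ft ψ) (t, r) +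
        G (j - s + f) (j + 1) (ft b) (t, r) * G (k - 2 + f) k (ft ψ) (t, r)) ∂hl ∂hl := by
        refine setLIntegral_mono' measurableSet_Ioi fun t ht' => ?_
        have ht0 : 0 < t := ht'
        refine (mul_le_mul_right (fubini_TS hKm hKS hP hKP (hf_nc ht0.le (Nc.of_schwartz (ft a)))
          (hf_nc ht0.le (Nc.of_schwartz (ft b))) (hf_nc ht0.le (Nc.of_schwartz (ft ψ)))) _).trans ?_
        rw [← lintegral_const_mul' _ _ ENNReal.ofReal_ne_top]
        exact setLIntegral_mono' measurableSet_Ioi fun r hr => hbd t r ht0 hr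
    _ = (ENNReal.ofReal ((cp f)⁻¹) * (n * ENNReal.ofReal X)) * ∫⁻ θ, 
       (G (j - s - 1 + f) j (ft b) θ * G (k - 1 + f) (k + 1) (ft ψ) θ +
        G (j - s + f) (j + 1) (ft b) θ * G (k - 2 + f) k (ft ψ) θ) ∂(hl.prod hl) := by
        rw [lintegral_prod _ hGGm.aemeasurable, ← lintegral_const_mul' _ _ (by finiteness)]
        congr 1; ext t
        rw [lintegral_const_mul' _ _ (by finiteness)]
    _ ≤ (ENNReal.ofReal ((cp f)⁻¹) * (n * ENNReal.ofReal X)) *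
        (ENNReal.ofReal C₁ * eLpNorm (fun η => ((‖η‖ ^ (s - 1) : ℝ) : ℂ) * ft b η) 2 volume *
          eLpNorm (fun η => ((‖η‖ ^ (0:ℝ) : ℝ) : ℂ) * ft ψ η) 2 volume +
         ENNReal.ofReal C₂ * eLpNorm (fun η => ((‖η‖ ^ (s - 1) : ℝ) : ℂ) * ft b η) 2 volume *
          eLpNorm (fun η => ((‖η‖ ^ (0:ℝ) : ℝ) : ℂ) * ft ψ η) 2 volume) := by
        have hm1 : Measurable (fun θ => G (j - s - 1 + f) j (ft b) θ *
            G (k - 1 + f) (k + 1) (ft ψ) θ) := (hGm _ _ _).mul (hGm _ _ _)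
        rw [lintegral_add_left hm1]
        exact mul_le_mul_right (add_le_add J1 J2) _
    _ = ENNReal.ofReal ((cp f)⁻¹ * (n * (C₁ + C₂))) *
        ((ENNReal.ofReal X * eLpNorm (fun η => ((‖η‖ ^ (s - 1) : ℝ) : ℂ) * ft b η) 2 volume) *
          eLpNorm (ft ψ) 2 volume) := by
        rw [ENNReal.ofReal_mul (p := (cp f)⁻¹) (by positivity), ENNReal.ofReal_mul (p := (n:ℝ)) (by positivity),
          ENNReal.ofReal_add hC₁ hC₂, ENNReal.ofReal_natCast]
        simp only [Real.rpow_zero, Complex.ofReal_one, one_mul]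
        ring
    _ ≤ _ := by
        unfold RH
        gcongr
        exact le_self_add

end KP

end Part6

section Part7

open MeasureTheory
open scoped FourierTransform ENNReal ContDiff

namespace KP
variable {n : ℕ}

open scoped LineDeriv in
/-- coordinate derivative -/
noncomputable def dl (l : Fin n) (a : SchwartzMap (EE n) ℂ) : SchwartzMap (EE n) ℂ :=
  ∂_{(EuclideanSpace.single l (1:ℝ) : EE n)} a

lemma dl_apply (l : Fin n) (a : SchwartzMap (EE n) ℂ) (x : EE n) :
    dl l a x = fderiv ℝ a x (EuclideanSpace.single l (1:ℝ)) :=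
  SchwartzMap.lineDerivOp_apply_eq_fderiv _ _ _

lemma ft_dl (l : Fin n) (a : SchwartzMap (EE n) ℂ) (v : EE n) :
    ft (dl l a) v = (2 * Real.pi * Complex.I) * ((v l : ℝ) : ℂ) * ft a v := by
  unfold ft dl
  rw [SchwartzMap.fourier_lineDerivOp_eq]
  rw [smul_apply, SchwartzMap.smulLeftCLM_apply_apply (by fun_prop)]
  rw [EuclideanSpace.inner_single_right]
  simp
  ring

lemma ft_inj {a b : SchwartzMap (EE n) ℂ} (h : ∀ v, ft a v = ft b v) : a = b := by
  have : ft a = ft b := SchwartzMap.ext h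
  have h2 := congrArg (fun f : SchwartzMap (EE n) ℂ => 𝓕⁻ f) this
  simpa [ft] using h2

lemma heat_dl {t : ℝ} (ht0 : 0 ≤ t) (l : Fin n) (a : SchwartzMap (EE n) ℂ) :
    heat t (dl l a) = dl l (heat t a) := by
  apply ft_inj
  intro v
  rw [ft_heat ht0, ft_dl, ft_dl, ft_heat ht0]
  ring

/-- joint continuity of the heat flow -/
lemma heat_joint (a : SchwartzMap (EE n) ℂ) :
    Continuous (fun z : ℝ × EE n => heat |z.1| a z.2) := by
  have e : ∀ z : ℝ × EE n, heat |z.1| a z.2 =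
      ∫ v, Complex.exp ((↑(2 * Real.pi * inner ℝ v z.2) * Complex.I)) •
        ((ht |z.1| v : ℂ) * ft a v) := fun z => by
    rw [heat_apply (abs_nonneg _), Real.fourierInv_eq']
  simp only [e]
  refine continuous_of_dominated (bound := fun v => ‖ft a v‖) ?_ ?_ ?_ ?_
  · intro z
    refine Continuous.aestronglyMeasurable ?_
    have := (ft a).continuous
    have := ht_cont (n := n) |z.1|
    fun_prop
  · intro z
    refine Filter.Eventually.of_forall fun v => ?_
    rw [norm_smul, Complex.norm_exp_ofReal_mul_I, one_mul, norm_mul, Complex.norm_real,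
      Real.norm_of_nonneg (ht_pos _ _).le]
    exact mul_le_of_le_one_left (norm_nonneg _) (ht_le_one (abs_nonneg _) _)
  · exact (ft a).integrable.norm
  · refine Filter.Eventually.of_forall fun v => ?_
    unfold ht
    fun_prop

lemma heat_hasDeriv {t : ℝ} (ht0 : 0 < t) {a b : SchwartzMap (EE n) ℂ}
    (hab : ∀ v, ft b v = (((-‖v‖ ^ 2 : ℝ)) : ℂ) * ft a v) (x : EE n) :
    HasDerivAt (fun t => heat |t| a x) (heat t b x) t := by
  have e : ∀ (a : SchwartzMap (EE n) ℂ) (t : ℝ), heat |t| a x =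
      ∫ v, Complex.exp ((↑(2 * Real.pi * inner ℝ v x) * Complex.I)) *
        ((ht |t| v : ℂ) * ft a v) := fun a t => by
    rw [heat_apply (abs_nonneg _), Real.fourierInv_eq']; rfl
  have e2 : heat t b x = ∫ v, Complex.exp ((↑(2 * Real.pi * inner ℝ v x) * Complex.I)) *
        (((-‖v‖ ^ 2 * ht t v : ℝ) : ℂ) * ft a v) := by
    have := e b t
    rw [abs_of_pos ht0] at this
    rw [this]
    congr 1; ext v; rw [hab]; push_cast; ring
  have e3 : ∀ (t : ℝ) (F : ℝ → ℂ) (z : ℂ), 0 < t → HasDerivAt F z t → HasDerivAt (fun t => F |t|) z t := by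
    intro t F z h0 hF
    refine hF.congr_of_eventuallyEq ?_
    filter_upwards [lt_mem_nhds h0] with r hr
    rw [abs_of_pos hr]
  refine e3 t (fun t => heat t a x) _ ht0 ?_
  rw [e2]
  have e4 : (fun t => ∫ v, Complex.exp ((↑(2 * Real.pi * inner ℝ v x) * Complex.I)) *
        ((ht t v : ℂ) * ft a v)) =ᶠ[nhds t] (fun t => heat t a x) := by
    filter_upwards [lt_mem_nhds ht0] with r hr
    have := e a r
    rw [abs_of_pos hr] at this
    exact this.symm
  refine HasDerivAt.congr_of_eventuallyEq ?_ e4.symm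
  have hN : Nc (fun v => (((‖v‖ ^ (2:ℝ) : ℝ)) : ℂ) * ft a v) :=
    (Nc.of_schwartz (ft a)).mul_pg (PG.norm_rpow (by norm_num))
  refine (hasDerivAt_integral_of_dominated_loc_of_deriv_le
    (F := fun (t:ℝ) (v : EE n) => Complex.exp ((↑(2 * Real.pi * inner ℝ v x) * Complex.I)) *
        ((ht t v : ℂ) * ft a v)) (s := Set.Ioi 0)
    (F' := fun (t:ℝ) (v : EE n) => Complex.exp ((↑(2 * Real.pi * inner ℝ v x) * Complex.I)) *
        (((-‖v‖ ^ 2 * ht t v : ℝ) : ℂ) * ft a v))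
    (bound := fun v => ‖(((‖v‖ ^ (2:ℝ) : ℝ)) : ℂ) * ft a v‖) (Ioi_mem_nhds ht0) ?_ ?_ ?_ ?_ ?_ ?_).2
  · refine Filter.Eventually.of_forall fun r => Continuous.aestronglyMeasurable ?_
    have := (ft a).continuous
    have := ht_cont (n := n) r
    fun_prop
  · have h1 := ((hf_nc ht0.le (Nc.of_schwartz (ft a))).integrable (μ := volume)).norm
    refine Integrable.mono' h1 (Continuous.aestronglyMeasurable ?_)
      (Filter.Eventually.of_forall fun v => ?_)
    · have := (ft a).continuous
      have := ht_cont (n := n) t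
      fun_prop
    · rw [norm_mul, Complex.norm_exp_ofReal_mul_I, one_mul]; rfl
  · refine Continuous.aestronglyMeasurable ?_
    have := (ft a).continuous
    have := ht_cont (n := n) t
    fun_prop
  · refine Filter.Eventually.of_forall fun v r hr => ?_
    rw [norm_mul, Complex.norm_exp_ofReal_mul_I, one_mul, norm_mul, norm_mul, Complex.norm_real,
      Complex.norm_real, norm_mul, Real.norm_of_nonneg (ht_pos _ _).le, norm_neg, Real.rpow_two]
    gcongr
    exact mul_le_of_le_one_right (norm_nonneg _) (ht_le_one (le_of_lt hr) _)
  · exact hN.integrable.norm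
  · refine Filter.Eventually.of_forall fun v r hr => ?_
    refine HasDerivAt.const_mul _ (HasDerivAt.mul_const ?_ _)
    refine HasDerivAt.ofReal_comp ?_
    unfold ht
    have : HasDerivAt (fun r : ℝ => -(r * ‖v‖ ^ 2)) (-(1 * ‖v‖ ^ 2)) r :=
      ((hasDerivAt_id r).mul_const _).neg
    convert this.exp using 1
    ring

/-- normalised Laplacian -/
noncomputable def Lap (a : SchwartzMap (EE n) ℂ) : SchwartzMap (EE n) ℂ :=
  ((4 * Real.pi ^ 2)⁻¹ : ℝ) • ∑ l, dl l (dl l a)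

lemma Lap_apply (a : SchwartzMap (EE n) ℂ) (x : EE n) :
    Lap a x = ((4 * Real.pi ^ 2)⁻¹ : ℝ) • ∑ l, dl l (dl l a) x := by
  unfold Lap
  rw [smul_apply, sum_apply]

lemma ft_sum {ι : Type*} (s : Finset ι) (f : ι → SchwartzMap (EE n) ℂ) :
    ft (∑ l ∈ s, f l) = ∑ l ∈ s, ft (f l) := by
  exact map_sum (FourierTransform.fourierCLE ℂ (SchwartzMap (EE n) ℂ)) f s

lemma ft_smul (c : ℂ) (f : SchwartzMap (EE n) ℂ) : ft (c • f) = c • ft f :=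
  map_smul (FourierTransform.fourierCLE ℂ (SchwartzMap (EE n) ℂ)) c f

lemma ft_Lap (a : SchwartzMap (EE n) ℂ) (v : EE n) :
    ft (Lap a) v = (((-‖v‖ ^ 2 : ℝ)) : ℂ) * ft a v := by
  have : Lap a = (((4 * Real.pi ^ 2)⁻¹ : ℝ) : ℂ) • ∑ l, dl l (dl l a) := by
    ext x; rw [Lap_apply, smul_apply, sum_apply]; simp
  rw [this, ft_smul, ft_sum, smul_apply, sum_apply]
  simp only [ft_dl]
  rw [EuclideanSpace.real_norm_sq_eq]
  have : ∀ l, 2 * Real.pi * Complex.I * ((v l : ℝ) : ℂ) *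
    (2 * Real.pi * Complex.I * ((v l : ℝ) : ℂ) * ft a v) = ((v l ^ 2 : ℝ) : ℂ) * (-(4 * Real.pi ^ 2) * ft a v) := by
    intro l
    push_cast
    linear_combination (4 * Real.pi ^ 2 * (v l : ℂ) ^ 2 * ft a v) * Complex.I_sq
  simp only [this]
  rw [← Finset.sum_mul, ← Complex.ofReal_sum]
  have hpi : (Real.pi : ℂ) ≠ 0 := by exact_mod_cast Real.pi_ne_zero
  rw [smul_eq_mul]
  push_cast
  field_simp

end KP

end Part7

section Part8

open MeasureTheory
open scoped FourierTransform ENNReal ContDiff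

namespace KP
variable {n : ℕ}

/-- real inner product on the complex numbers, pointwise -/
noncomputable abbrev ip (z w : ℂ) : ℝ := inner ℝ z w

lemma ip_self (z : ℂ) : ip z z = ‖z‖ ^ 2 := real_inner_self_eq_norm_sq z
lemma ip_comm (z w : ℂ) : ip z w = ip w z := real_inner_comm w z
lemma ip_le (z w : ℂ) : |ip z w| ≤ ‖z‖ * ‖w‖ := abs_real_inner_le_norm z w

lemma schwartz_bdd (A : SchwartzMap (EE n) ℂ) : ∃ C : ℝ, 0 ≤ C ∧ ∀ x, ‖A x‖ ≤ C :=
  (Nc.of_schwartz A).bdd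

lemma int4 (A₁ A₂ A₃ A₄ : SchwartzMap (EE n) ℂ) :
    Integrable (fun x => ip (A₁ x) (A₂ x) * ip (A₃ x) (A₄ x)) := by
  obtain ⟨C₁, h1, b1⟩ := schwartz_bdd A₁
  obtain ⟨C₂, h2, b2⟩ := schwartz_bdd A₂
  obtain ⟨C₃, h3, b3⟩ := schwartz_bdd A₃
  refine Integrable.mono' (A₄.integrable.norm.const_mul (C₁ * C₂ * C₃))
    (Continuous.aestronglyMeasurable ?_) (Filter.Eventually.of_forall fun x => ?_)
  · have := A₁.continuous; have := A₂.continuous; have := A₃.continuous; have := A₄.continuous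
    fun_prop
  · rw [norm_mul, Real.norm_eq_abs, Real.norm_eq_abs, mul_assoc]
    calc _ ≤ (‖A₁ x‖ * ‖A₂ x‖) * (‖A₃ x‖ * ‖A₄ x‖) := by
          gcongr <;> exact ip_le _ _
      _ ≤ _ := by
        gcongr
        exacts [b1 x, b2 x, b3 x]

lemma ip_hasFDeriv (l : Fin n) (A₁ A₂ : SchwartzMap (EE n) ℂ) (x : EE n) :
    DifferentiableAt ℝ (fun x => ip (A₁ x) (A₂ x)) x ∧
    fderiv ℝ (fun x => ip (A₁ x) (A₂ x)) x (EuclideanSpace.single l (1:ℝ)) =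
      ip (A₁ x) (dl l A₂ x) + ip (dl l A₁ x) (A₂ x) := by
  have h := A₁.differentiableAt (x := x) |>.hasFDerivAt.inner ℝ (A₂.differentiableAt (x := x)).hasFDerivAt
  refine ⟨h.differentiableAt, ?_⟩
  rw [h.fderiv, dl_apply, dl_apply]
  rfl

lemma ibp (l : Fin n) (A₁ A₂ A₃ A₄ : SchwartzMap (EE n) ℂ) :
    ∫ x, ip (A₁ x) (A₂ x) * (ip (A₃ x) (dl l A₄ x) + ip (dl l A₃ x) (A₄ x)) =
    - ∫ x, (ip (A₁ x) (dl l A₂ x) + ip (dl l A₁ x) (A₂ x)) * ip (A₃ x) (A₄ x) := by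
  have h := integral_mul_fderiv_eq_neg_fderiv_mul_of_integrable (μ := (volume : Measure (EE n)))
    (f := fun x => ip (A₁ x) (A₂ x)) (g := fun x => ip (A₃ x) (A₄ x))
    (v := (EuclideanSpace.single l (1:ℝ) : EE n))
  simp only [(ip_hasFDeriv l _ _ _).2] at h
  refine h ?_ ?_ (int4 _ _ _ _) (fun x _ => (ip_hasFDeriv l _ _ _).1)
    (fun x _ => (ip_hasFDeriv l _ _ _).1)
  · simp only [add_mul]
    exact (int4 _ _ _ _).add (int4 _ _ _ _)
  · simp only [mul_add]
    exact (int4 _ _ _ _).add (int4 _ _ _ _)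

lemma static (l : Fin n) (B Φ : SchwartzMap (EE n) ℂ) :
    ∫ x, (ip (B x) (dl l (dl l B) x) * ip (Φ x) (Φ x) + ip (B x) (B x) * ip (Φ x) (dl l (dl l Φ) x))
      ≤ ∫ x, (7 * (ip (B x) (B x) * ip (dl l Φ x) (dl l Φ x)) -
        (1/2) * (ip (dl l B x) (dl l B x) * ip (Φ x) (Φ x))) := by
  have h1 := ibp l B B Φ (dl l Φ)
  have h2 := ibp l Φ Φ B (dl l B)
  have e1 : ∀ x, (ip (B x) (dl l (dl l B) x) * ip (Φ x) (Φ x) +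
      ip (B x) (B x) * ip (Φ x) (dl l (dl l Φ) x)) =
      (ip (B x) (B x) * (ip (Φ x) (dl l (dl l Φ) x) + ip (dl l Φ x) (dl l Φ x)) +
       ip (Φ x) (Φ x) * (ip (B x) (dl l (dl l B) x) + ip (dl l B x) (dl l B x))) -
      (ip (B x) (B x) * ip (dl l Φ x) (dl l Φ x) + ip (dl l B x) (dl l B x) * ip (Φ x) (Φ x)) := by
    intro x; ring
  have i1 : ∀ A₁ A₂ A₃ A₄ A₅ A₆ : SchwartzMap (EE n) ℂ,
     Integrable (fun x => ip (A₁ x) (A₂ x) * (ip (A₃ x) (A₄ x) + ip (A₅ x) (A₆ x))) := by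
    intros
    simp only [mul_add]
    exact (int4 _ _ _ _).add (int4 _ _ _ _)
  have i2 : ∀ A₁ A₂ A₃ A₄ A₅ A₆ : SchwartzMap (EE n) ℂ,
     Integrable (fun x => (ip (A₃ x) (A₄ x) + ip (A₅ x) (A₆ x)) * ip (A₁ x) (A₂ x)) := by
    intros
    simp only [add_mul]
    exact (int4 _ _ _ _).add (int4 _ _ _ _)
  have k1 := i1 B B Φ (dl l (dl l Φ)) (dl l Φ) (dl l Φ)
  have k2 := i1 Φ Φ B (dl l (dl l B)) (dl l B) (dl l B)
  have k3 : Integrable (fun x => ip (B x) (B x) * ip (dl l Φ x) (dl l Φ x) +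
    ip (dl l B x) (dl l B x) * ip (Φ x) (Φ x)) := (int4 _ _ _ _).add (int4 _ _ _ _)
  have k4 := i2 Φ (dl l Φ) B (dl l B) (dl l B) B
  have k5 := i2 B (dl l B) Φ (dl l Φ) (dl l Φ) Φ
  have k12 : Integrable (fun x =>
    ip (B x) (B x) * (ip (Φ x) (dl l (dl l Φ) x) + ip (dl l Φ x) (dl l Φ x)) +
       ip (Φ x) (Φ x) * (ip (B x) (dl l (dl l B) x) + ip (dl l B x) (dl l B x))) := k1.add k2
  have k45 : Integrable (fun x => -((ip (B x) (dl l B x) + ip (dl l B x) (B x)) * ip (Φ x) (dl l Φ x) +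
    (ip (Φ x) (dl l Φ x) + ip (dl l Φ x) (Φ x)) * ip (B x) (dl l B x))) := (k4.add k5).neg
  simp only [e1]
  rw [integral_sub k12 k3, integral_add k1 k2, h1, h2, ← neg_add,
    ← integral_add k4 k5, ← integral_neg, ← integral_sub k45 k3]
  refine integral_mono (k45.sub k3) ?_ fun x => ?_
  · exact ((int4 _ _ _ _).const_mul _).sub ((int4 _ _ _ _).const_mul _)
  · beta_reduce
    rw [ip_comm (dl l B x) (B x), ip_comm (dl l Φ x) (Φ x)]
    have a1 := ip_le (B x) (dl l B x)
    have a2 := ip_le (Φ x) (dl l Φ x)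
    have a3 : |ip (B x) (dl l B x) * ip (Φ x) (dl l Φ x)| ≤
        (‖B x‖ * ‖dl l B x‖) * (‖Φ x‖ * ‖dl l Φ x‖) := by
      rw [abs_mul]; gcongr
    have a4 := neg_le_of_abs_le a3
    simp only [ip_self]
    nlinarith [sq_nonneg (‖dl l B x‖ * ‖Φ x‖ - 4 * (‖B x‖ * ‖dl l Φ x‖))]

lemma heat_zero (a : SchwartzMap (EE n) ℂ) : heat 0 a = a := by
  apply ft_inj; intro v; rw [ft_heat le_rfl]; simp [ht]

lemma heat_bound' {t : ℝ} (ht0 : 0 ≤ t) (a : SchwartzMap (EE n) ℂ) {X : ℝ}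
    (hX : ∀ x, ‖a x‖ ≤ X) (x : EE n) : ‖heat t a x‖ ≤ X := by
  rcases ht0.eq_or_lt with h | h
  · rw [← h, heat_zero]; exact hX x
  · exact heat_bound h a hX x

lemma schwartz_plancherel (a : SchwartzMap (EE n) ℂ) : eLpNorm (ft a) 2 volume = eLpNorm a 2 volume := by
  have := (Nc.of_schwartz a).plancherel
  rw [← this, ft, SchwartzMap.fourier_coe]

lemma heat_contr {t : ℝ} (ht0 : 0 ≤ t) (a : SchwartzMap (EE n) ℂ) :
    eLpNorm (heat t a) 2 volume ≤ eLpNorm a 2 volume := by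
  rw [← schwartz_plancherel, ← schwartz_plancherel a]
  refine eLpNorm_mono fun v => ?_
  rw [ft_heat ht0, norm_mul, Complex.norm_real, Real.norm_of_nonneg (ht_pos _ _).le]
  exact mul_le_of_le_one_left (norm_nonneg _) (ht_le_one ht0 _)

/-- joint heat flow -/
noncomputable def H (a : SchwartzMap (EE n) ℂ) (z : ℝ × EE n) : ℂ := heat |z.1| a z.2

lemma H_cont (a : SchwartzMap (EE n) ℂ) : Continuous (H a) := heat_joint a

lemma lint_H_sq (a : SchwartzMap (EE n) ℂ) (μ : Measure ℝ) [SFinite μ] :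
    ∫⁻ z, ‖H a z‖ₑ ^ 2 ∂(μ.prod volume) = ∫⁻ t, eLpNorm (heat |t| a) 2 volume ^ 2 ∂μ := by
  rw [lintegral_prod _ (by have := (H_cont a).measurable; fun_prop)]
  simp only [eLpNorm_two_sq]
  rfl

lemma int_H_sq (a : SchwartzMap (EE n) ℂ) (μ : Measure ℝ) [IsFiniteMeasure μ] :
    Integrable (fun z => ‖H a z‖ ^ 2) (μ.prod volume) := by
  refine ⟨((H_cont a).norm.pow 2).aestronglyMeasurable, ?_⟩
  unfold HasFiniteIntegral
  have : ∀ z, ‖‖H a z‖ ^ 2‖ₑ = ‖H a z‖ₑ ^ 2 := fun z => by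
    rw [enorm_pow, enorm_norm]
  simp only [this]
  rw [lint_H_sq]
  calc _ ≤ ∫⁻ t, eLpNorm a 2 volume ^ 2 ∂μ := by
        refine lintegral_mono fun t => ?_
        gcongr
        exact heat_contr (abs_nonneg _) a
    _ < ⊤ := by
        rw [lintegral_const]
        have : eLpNorm a 2 volume ≠ ⊤ := (a.memLp 2 volume).2.ne
        finiteness

lemma int_H4 (A₁ A₂ A₃ A₄ : SchwartzMap (EE n) ℂ) (μ : Measure ℝ) [IsFiniteMeasure μ] :
    Integrable (fun z => ip (H A₁ z) (H A₂ z) * ip (H A₃ z) (H A₄ z)) (μ.prod volume) := by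
  obtain ⟨C₁, h1, b1⟩ := schwartz_bdd A₁
  obtain ⟨C₂, h2, b2⟩ := schwartz_bdd A₂
  refine Integrable.mono' (((int_H_sq A₃ μ).add (int_H_sq A₄ μ)).const_mul (C₁ * C₂))
    (Continuous.aestronglyMeasurable ?_) (Filter.Eventually.of_forall fun z => ?_)
  · have := H_cont A₁; have := H_cont A₂; have := H_cont A₃; have := H_cont A₄
    fun_prop
  · rw [norm_mul, Real.norm_eq_abs, Real.norm_eq_abs]
    simp only [Pi.add_apply]
    have c1 : ‖H A₁ z‖ ≤ C₁ := heat_bound' (abs_nonneg _) _ b1 _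
    have c2 : ‖H A₂ z‖ ≤ C₂ := heat_bound' (abs_nonneg _) _ b2 _
    calc _ ≤ (‖H A₁ z‖ * ‖H A₂ z‖) * (‖H A₃ z‖ * ‖H A₄ z‖) := by
          gcongr <;> exact ip_le _ _
      _ ≤ (C₁ * C₂) * (‖H A₃ z‖ ^ 2 + ‖H A₄ z‖ ^ 2) := by
        gcongr
        nlinarith [sq_nonneg (‖H A₃ z‖ - ‖H A₄ z‖), sq_nonneg ‖H A₃ z‖, sq_nonneg ‖H A₄ z‖]

end KP

end Part8

section Part9

open MeasureTheory
open scoped FourierTransform ENNReal ContDiff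

namespace KP
variable {n : ℕ}

/-- time derivative density -/
noncomputable def Dd (b φ : SchwartzMap (EE n) ℂ) (l : Fin n) (z : ℝ × EE n) : ℝ :=
  ip (H b z) (H (dl l (dl l b)) z) * ip (H φ z) (H φ z) +
    ip (H b z) (H b z) * ip (H φ z) (H (dl l (dl l φ)) z)

lemma Dd_int (b φ : SchwartzMap (EE n) ℂ) (l : Fin n) (μ : Measure ℝ) [IsFiniteMeasure μ] :
    Integrable (Dd b φ l) (μ.prod volume) := (int_H4 _ _ _ _ μ).add (int_H4 _ _ _ _ μ)

lemma Dd_cont (b φ : SchwartzMap (EE n) ℂ) (l : Fin n) : Continuous (Dd b φ l) := by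
  unfold Dd
  have := H_cont b; have := H_cont φ
  have := H_cont (dl l (dl l b)); have := H_cont (dl l (dl l φ))
  fun_prop

lemma H_dl (l : Fin n) (b : SchwartzMap (EE n) ℂ) (t : ℝ) (x : EE n) :
    H (dl l b) (t, x) = dl l (heat |t| b) x := by
  unfold H; rw [heat_dl (abs_nonneg _)]

lemma H_Lap (b : SchwartzMap (EE n) ℂ) (t : ℝ) (x : EE n) :
    heat |t| (Lap b) x = ((4 * Real.pi ^ 2)⁻¹ : ℝ) • ∑ l, H (dl l (dl l b)) (t, x) := by
  have : heat |t| (Lap b) = Lap (heat |t| b) := by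
    apply ft_inj; intro v
    rw [ft_heat (abs_nonneg _), ft_Lap, ft_Lap, ft_heat (abs_nonneg _)]; ring
  rw [this, Lap_apply]
  simp only [H_dl, heat_dl (abs_nonneg t)]

lemma G_deriv (b φ : SchwartzMap (EE n) ℂ) {t : ℝ} (ht0 : 0 < t) (x : EE n) :
    HasDerivAt (fun t => ‖H b (t, x)‖ ^ 2 * ‖H φ (t, x)‖ ^ 2)
      (2 * (4 * Real.pi ^ 2)⁻¹ * ∑ l, Dd b φ l (t, x)) t := by
  have h1 := (heat_hasDeriv ht0 (ft_Lap b) x).norm_sq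
  have h2 := (heat_hasDeriv ht0 (ft_Lap φ) x).norm_sq
  have h3 := h1.mul h2
  have e1 := H_Lap b t x
  have e2 := H_Lap φ t x
  rw [abs_of_pos ht0] at e1 e2
  rw [e1, e2] at h3
  refine h3.congr_deriv ?_
  unfold Dd
  simp only [real_inner_smul_right, _root_.inner_sum, ← ip_self, Finset.sum_add_distrib]
  rw [← Finset.sum_mul, ← Finset.mul_sum]
  unfold ip H
  ring

lemma lint_HS (b φ : SchwartzMap (EE n) ℂ) {X : ℝ} (hX : ∀ x, ‖b x‖ ≤ X) (hX0 : 0 ≤ X) (t : ℝ) :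
    ∫ x, ‖H b (t, x)‖ ^ 2 * ‖H φ (t, x)‖ ^ 2 ≤ X ^ 2 * (eLpNorm φ 2 volume ^ 2).toReal := by
  have hfin : eLpNorm φ 2 volume ^ 2 ≠ ⊤ := by
    have : eLpNorm φ 2 volume ≠ ⊤ := (φ.memLp 2 volume).2.ne
    finiteness
  rw [← ENNReal.toReal_ofReal (sq_nonneg X), ← ENNReal.toReal_mul]
  rw [integral_eq_lintegral_of_nonneg_ae (Filter.Eventually.of_forall fun x => by positivity)]
  · refine ENNReal.toReal_mono (by finiteness) ?_
    calc _ ≤ ∫⁻ x, ENNReal.ofReal (X ^ 2) * ‖heat |t| φ x‖ₑ ^ 2 := by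
          refine lintegral_mono fun x => ?_
          rw [ENNReal.ofReal_mul (by positivity), ← ofReal_norm, ENNReal.ofReal_pow (norm_nonneg _)]
          rw [ENNReal.ofReal_pow (norm_nonneg _), ENNReal.ofReal_pow hX0]
          gcongr
          · exact heat_bound' (abs_nonneg _) _ hX _
          · rfl
      _ = ENNReal.ofReal (X ^ 2) * eLpNorm (heat |t| φ) 2 volume ^ 2 := by
          rw [lintegral_const_mul' _ _ (by finiteness), eLpNorm_two_sq]
      _ ≤ _ := by
          gcongr
          exact heat_contr (abs_nonneg _) φ
  · have := H_cont b; have := H_cont φ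
    refine Continuous.aestronglyMeasurable ?_
    fun_prop

lemma lint_dl_sq (φ : SchwartzMap (EE n) ℂ) (l : Fin n) :
    ∫⁻ t in Set.Ioi (0:ℝ), eLpNorm (heat |t| (dl l φ)) 2 volume ^ 2 ≤
      ENNReal.ofReal (4 * Real.pi ^ 2) * eLpNorm φ 2 volume ^ 2 := by
  have h := heat_sq (n := n) (e := 0) (j := 1) (j0 := 0) (by norm_num) le_rfl (by norm_num)
    (ft φ).continuous
  have e : ∀ t ∈ Set.Ioi (0:ℝ), eLpNorm (heat |t| (dl l φ)) 2 volume ^ 2 ≤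
      ENNReal.ofReal (4 * Real.pi ^ 2) * eLpNorm (fun η => ((t ^ ((0:ℝ) / 2) * (‖η‖ ^ (1:ℝ) * ht t η) : ℝ) : ℂ) *
        ft φ η) 2 volume ^ 2 := by
    intro t ht0
    have ht0 : 0 < t := ht0
    have e2 : ENNReal.ofReal (4 * Real.pi ^ 2) = ENNReal.ofReal (2 * Real.pi) ^ 2 := by
      rw [← ENNReal.ofReal_pow (by positivity)]; congr 1; ring
    rw [e2, ← mul_pow, ← eLpNorm_ofReal_mul (by positivity), ← schwartz_plancherel, abs_of_pos ht0]
    gcongr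
    refine eLpNorm_mono fun v => ?_
    rw [ft_heat ht0.le, ft_dl]
    simp only [norm_mul, Complex.norm_real, Complex.norm_I, zero_div, Real.rpow_zero, Real.rpow_one,
      norm_norm, Complex.norm_ofNat, mul_one, one_mul, Complex.ofReal_mul, Complex.ofReal_ofNat]
    have : ‖v l‖ ≤ ‖v‖ := PiLp.norm_apply_le v l
    calc _ = 2 * ‖Real.pi‖ * (‖v l‖ * ‖ht t v‖ * ‖ft φ v‖) := by ring
      _ ≤ 2 * ‖Real.pi‖ * (‖v‖ * ‖ht t v‖ * ‖ft φ v‖) := by gcongr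
      _ = _ := by ring
  refine (setLIntegral_mono' measurableSet_Ioi e).trans ?_
  rw [lintegral_const_mul' _ _ (by finiteness)]
  gcongr
  refine h.trans_eq ?_
  simp [schwartz_plancherel]

lemma int_R (b φ : SchwartzMap (EE n) ℂ) {X : ℝ} (hX : ∀ x, ‖b x‖ ≤ X) (hX0 : 0 ≤ X) (l : Fin n)
    {ε T : ℝ} (hε : 0 < ε) :
    ∫ z, ip (H b z) (H b z) * ip (H (dl l φ) z) (H (dl l φ) z)
      ∂((volume.restrict (Set.Ioc ε T)).prod volume) ≤
      X ^ 2 * (4 * Real.pi ^ 2 * (eLpNorm φ 2 volume ^ 2).toReal) := by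
  have hfin : eLpNorm φ 2 volume ^ 2 ≠ ⊤ := by
    have : eLpNorm φ 2 volume ≠ ⊤ := (φ.memLp 2 volume).2.ne
    finiteness
  simp only [ip_self]
  rw [← ENNReal.toReal_ofReal (show 0 ≤ 4 * Real.pi ^ 2 by positivity), ← ENNReal.toReal_mul,
    ← ENNReal.toReal_ofReal (sq_nonneg X), ← ENNReal.toReal_mul]
  rw [integral_eq_lintegral_of_nonneg_ae (Filter.Eventually.of_forall fun x => by positivity)]
  · refine ENNReal.toReal_mono (by finiteness) ?_
    calc _ ≤ ∫⁻ z, ENNReal.ofReal (X ^ 2) * ‖H (dl l φ) z‖ₑ ^ 2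
            ∂((volume.restrict (Set.Ioc ε T)).prod volume) := by
          refine lintegral_mono fun x => ?_
          rw [ENNReal.ofReal_mul (by positivity), ← ofReal_norm, ENNReal.ofReal_pow (norm_nonneg _)]
          rw [ENNReal.ofReal_pow (norm_nonneg _), ENNReal.ofReal_pow hX0]
          gcongr
          exact heat_bound' (abs_nonneg _) _ hX _
      _ ≤ _ := by
          rw [lintegral_const_mul' _ _ (by finiteness), lint_H_sq]
          gcongr
          refine le_trans ?_ (lint_dl_sq φ l)
          exact lintegral_mono_set fun t ht => hε.trans ht.1
  · have := H_cont b; have := H_cont (dl l φ)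
    refine Continuous.aestronglyMeasurable ?_
    fun_prop

lemma carl_real (b φ : SchwartzMap (EE n) ℂ) {X : ℝ} (hX : ∀ x, ‖b x‖ ≤ X) (hX0 : 0 ≤ X)
    {ε T : ℝ} (hε : 0 < ε) (hT : ε ≤ T) (l : Fin n) :
    ∫ z, ip (H (dl l b) z) (H (dl l b) z) * ip (H φ z) (H φ z)
      ∂((volume.restrict (Set.Ioc ε T)).prod volume) ≤
      4 * Real.pi ^ 2 * (1 + 14 * n) * (X ^ 2 * (eLpNorm φ 2 volume ^ 2).toReal) := by
  set μ : Measure ℝ := volume.restrict (Set.Ioc ε T) with hμ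
  set N := (eLpNorm φ 2 volume ^ 2).toReal with hN
  set κ : ℝ := (4 * Real.pi ^ 2)⁻¹ with hκ
  have hκ0 : 0 < κ := by positivity
  set P : Fin n → ℝ := fun l => ∫ z, ip (H (dl l b) z) (H (dl l b) z) * ip (H φ z) (H φ z)
      ∂(μ.prod volume) with hP
  set R : Fin n → ℝ := fun l => ∫ z, ip (H b z) (H b z) * ip (H (dl l φ) z) (H (dl l φ) z)
      ∂(μ.prod volume) with hR
  have hRb : ∀ l, R l ≤ X ^ 2 * (4 * Real.pi ^ 2 * N) := fun l => int_R b φ hX hX0 l hε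
  -- dissipation
  have h2 : ∀ l, ∫ z, Dd b φ l z ∂(μ.prod volume) ≤ 7 * R l - (1/2) * P l := by
    intro l
    have hi : Integrable (fun z => 7 * (ip (H b z) (H b z) * ip (H (dl l φ) z) (H (dl l φ) z)) -
        (1/2) * (ip (H (dl l b) z) (H (dl l b) z) * ip (H φ z) (H φ z))) (μ.prod volume) :=
      ((int_H4 _ _ _ _ μ).const_mul _).sub ((int_H4 _ _ _ _ μ).const_mul _)
    have e : 7 * R l - (1/2) * P l = ∫ z, (7 * (ip (H b z) (H b z) * ip (H (dl l φ) z) (H (dl l φ) z)) -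
        (1/2) * (ip (H (dl l b) z) (H (dl l b) z) * ip (H φ z) (H φ z))) ∂(μ.prod volume) := by
      rw [integral_sub ((int_H4 _ _ _ _ μ).const_mul _) ((int_H4 _ _ _ _ μ).const_mul _),
        integral_const_mul, integral_const_mul]
    rw [e, integral_prod _ (Dd_int b φ l μ), integral_prod _ hi]
    refine integral_mono (Dd_int b φ l μ).integral_prod_left hi.integral_prod_left fun t => ?_
    have := static l (heat |t| b) (heat |t| φ)
    unfold Dd
    simp only [H_dl, heat_dl (abs_nonneg t)]
    exact this
  -- energy
  have h1 : -(X ^ 2 * N) ≤ 2 * κ * ∑ l, ∫ z, Dd b φ l z ∂(μ.prod volume) := by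
    have hi : Integrable (fun z => 2 * κ * ∑ l, Dd b φ l z) (μ.prod volume) :=
      (integrable_finsetSum _ fun l _ => Dd_int b φ l μ).const_mul _
    rw [← integral_finsetSum _ fun l _ => Dd_int b φ l μ, ← integral_const_mul,
      integral_prod_symm _ hi]
    have e : ∀ x, ∫ t, 2 * κ * ∑ l, Dd b φ l (t, x) ∂μ = ‖H b (T, x)‖ ^ 2 * ‖H φ (T, x)‖ ^ 2 -
        ‖H b (ε, x)‖ ^ 2 * ‖H φ (ε, x)‖ ^ 2 := by
      intro x
      rw [hμ, ← intervalIntegral.integral_of_le hT]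
      refine intervalIntegral.integral_eq_sub_of_hasDerivAt
        (f := fun t => ‖H b (t, x)‖ ^ 2 * ‖H φ (t, x)‖ ^ 2) (fun t ht => ?_) ?_
      · rw [Set.uIcc_of_le hT] at ht
        exact G_deriv b φ (hε.trans_le ht.1) x
      · refine Continuous.intervalIntegrable ?_ _ _
        have := Dd_cont b φ
        fun_prop
    have e0 := lint_HS b φ hX hX0 ε
    have hc : ∀ t, Integrable (fun x => ‖H b (t, x)‖ ^ 2 * ‖H φ (t, x)‖ ^ 2) := fun t => by
      have := int4 (heat |t| b) (heat |t| b) (heat |t| φ) (heat |t| φ)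
      simp only [ip_self] at this
      exact this
    simp only [e]
    rw [integral_sub (hc T) (hc ε)]
    have : 0 ≤ ∫ x, ‖H b (T, x)‖ ^ 2 * ‖H φ (T, x)‖ ^ 2 := integral_nonneg fun x => by positivity
    linarith
  have hPn : ∀ l, 0 ≤ P l := fun l => integral_nonneg fun z => by
    simp only [ip_self, Pi.zero_apply]; positivity
  have h3 : ∑ l, ∫ z, Dd b φ l z ∂(μ.prod volume) ≤
      n * (7 * (X ^ 2 * (4 * Real.pi ^ 2 * N))) - (1/2) * P l := by
    have a1 := Finset.sum_le_sum (s := Finset.univ) fun l _ => h2 l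
    refine a1.trans ?_
    rw [Finset.sum_sub_distrib, ← Finset.mul_sum, ← Finset.mul_sum]
    have a2 := Finset.sum_le_sum (s := Finset.univ) fun l _ => hRb l
    have a3 := Finset.single_le_sum (s := Finset.univ) (f := P) (fun l _ => hPn l) (Finset.mem_univ l)
    simp only [Finset.sum_const, Finset.card_univ, Fintype.card_fin, nsmul_eq_mul] at a2
    linarith
  have h4 := h1.trans (mul_le_mul_of_nonneg_left h3 (by positivity : 0 ≤ 2 * κ))
  have hk : κ * (4 * Real.pi ^ 2) = 1 := by rw [hκ]; field_simp
  have h5 : κ * P l ≤ X ^ 2 * N * (1 + 14 * n) := by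
    have : 2 * κ * (n * (7 * (X ^ 2 * (4 * Real.pi ^ 2 * N))) - (1/2) * P l) =
      14 * n * (X^2 * N) * (κ * (4 * Real.pi ^ 2)) - κ * P l := by ring
    rw [this, hk] at h4
    linarith
  calc P l = (4 * Real.pi ^ 2) * (κ * P l) := by rw [← mul_assoc, mul_comm _ κ, hk, one_mul]
    _ ≤ (4 * Real.pi ^ 2) * (X ^ 2 * N * (1 + 14 * n)) := by gcongr
    _ = _ := by ring

lemma carleson (b φ : SchwartzMap (EE n) ℂ) {X : ℝ} (hX : ∀ x, ‖b x‖ ≤ X) (hX0 : 0 ≤ X)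
    (l : Fin n) :
    ∫⁻ t in Set.Ioi (0:ℝ), eLpNorm (fun x => dl l (heat |t| b) x * heat |t| φ x) 2 volume ^ 2 ≤
      ENNReal.ofReal (4 * Real.pi ^ 2 * (1 + 14 * n)) *
        (ENNReal.ofReal X * eLpNorm φ 2 volume) ^ 2 := by
  have hU : Set.Ioi (0:ℝ) = ⋃ k : ℕ, Set.Ioc (1 / ((k:ℝ) + 1)) (k + 1) := by
    ext t
    simp only [Set.mem_Ioi, Set.mem_iUnion, Set.mem_Ioc]
    constructor
    · intro h
      obtain ⟨k1, hk1⟩ := exists_nat_one_div_lt h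
      obtain ⟨k2, hk2⟩ := exists_nat_ge t
      refine ⟨max k1 k2, lt_of_le_of_lt ?_ hk1, ?_⟩
      · gcongr; exact le_max_left _ _
      · have : (k2 : ℝ) ≤ ((max k1 k2 : ℕ) : ℝ) := by exact_mod_cast le_max_right _ _
        linarith
    · rintro ⟨k, h, _⟩
      exact lt_trans (by positivity) h
  have hfin : eLpNorm φ 2 volume ≠ ⊤ := (φ.memLp 2 volume).2.ne
  rw [hU, setLIntegral_iUnion_of_directed]
  · refine iSup_le fun k => ?_
    have h := carl_real b φ hX hX0 (ε := 1 / ((k:ℝ) + 1)) (T := k + 1) (by positivity) (by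
      rw [div_le_iff₀ (by positivity)]
      have : (0:ℝ) ≤ k := by positivity
      nlinarith) l
    have h' := ENNReal.ofReal_le_ofReal h
    rw [ofReal_integral_eq_lintegral_ofReal (int_H4 _ _ _ _ _)
      (Filter.Eventually.of_forall fun z => by simp only [ip_self, Pi.zero_apply]; positivity)] at h'
    have e1 : ENNReal.ofReal (4 * Real.pi ^ 2 * (1 + 14 * n) * (X ^ 2 * (eLpNorm φ 2 volume ^ 2).toReal))
       = ENNReal.ofReal (4 * Real.pi ^ 2 * (1 + 14 * n)) *
        (ENNReal.ofReal X * eLpNorm φ 2 volume) ^ 2 := by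
      rw [ENNReal.ofReal_mul (by positivity), ENNReal.ofReal_mul (p := X ^ 2) (by positivity),
        ENNReal.ofReal_toReal (by finiteness), ENNReal.ofReal_pow hX0, mul_pow]
    rw [e1] at h'
    refine le_trans (le_of_eq ?_) h'
    rw [lintegral_prod]
    · refine lintegral_congr fun t => ?_
      rw [eLpNorm_two_sq]
      refine lintegral_congr fun x => ?_
      simp only [ip_self, H_dl]
      rw [enorm_mul, mul_pow, ENNReal.ofReal_mul (by positivity), ENNReal.ofReal_pow (norm_nonneg _),
        ENNReal.ofReal_pow (norm_nonneg _), ofReal_norm, ofReal_norm]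
      rfl
    · have := (H_cont (dl l b)); have := (H_cont φ)
      have : Continuous (fun z => ip (H (dl l b) z) (H (dl l b) z) * ip (H φ z) (H φ z)) := by fun_prop
      exact this.measurable.ennreal_ofReal.aemeasurable
  · refine Monotone.directed_le fun i j hij => Set.Ioc_subset_Ioc ?_ ?_
    · gcongr
    · gcongr

end KP

end Part9

section Part10

open MeasureTheory
open scoped FourierTransform ENNReal ContDiff

namespace KP
variable {n : ℕ}

lemma ftft (F : SchwartzMap (EE n) ℂ) (v : EE n) : ft (ft F) v = F (-v) := by
  have h : 𝓕⁻ (𝓕 F) (-v) = F (-v) := by rw [FourierTransform.fourierInv_fourier_eq]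
  rw [SchwartzMap.fourierInv_coe, Real.fourierInv_eq_fourier_neg, neg_neg] at h
  rw [← h]
  rw [ft, SchwartzMap.fourier_coe]

lemma heat_refl {t : ℝ} (ht0 : 0 ≤ t) (ψ : SchwartzMap (EE n) ℂ) :
    ft (ft (heat t ψ)) = heat t (ft (ft ψ)) := by
  apply ft_inj
  intro v
  rw [ftft, ft_heat ht0, ft_heat ht0, ftft]
  simp [ht]

lemma carl_meas (b φ : SchwartzMap (EE n) ℂ) (l : Fin n) :
    Measurable (fun t : ℝ => eLpNorm (fun x => dl l (heat |t| b) x * heat |t| φ x) 2 volume) := by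
  have : ∀ t : ℝ, eLpNorm (fun x => dl l (heat |t| b) x * heat |t| φ x) 2 volume =
      (∫⁻ x, ‖H (dl l b) (t, x) * H φ (t, x)‖ₑ ^ 2) ^ (1/2:ℝ) := by
    intro t
    simp only [H_dl]
    unfold H
    rw [← eLpNorm_two_sq (fun x => dl l (heat |t| b) x * heat |t| φ x), ← ENNReal.rpow_natCast,
      ← ENNReal.rpow_mul]
    norm_num
  simp only [this]
  refine Measurable.pow_const ?_ _
  refine Measurable.lintegral_prod_right' (f := fun z : ℝ × EE n =>
    ‖H (dl l b) z * H φ z‖ₑ ^ 2) ?_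
  exact ((H_cont _).mul (H_cont _)).measurable.enorm.pow_const 2

lemma Good_carl_l {m : ℕ} {s J : ℝ} (hs : 1 ≤ s) (hm : 1 ≤ m) (hJ : J = 2 * m + s - 2) (l : Fin n) :
    Good m s (fun p : EE n × EE n => p.1 l * (p.1 l * ‖p.2‖ ^ J)) := by
  have hm' : (1:ℝ) ≤ m := by exact_mod_cast hm
  have hJ0 : 0 ≤ J := by linarith
  set A := 4 * Real.pi ^ 2 * (1 + 14 * (n:ℝ)) with hA
  have hA0 : 0 ≤ A := by positivity
  have hΓ : 0 ≤ Real.Gamma (2 * (m:ℝ) - 2 + 1) := (Real.Gamma_pos_of_pos (by linarith)).le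
  refine ⟨(coord_pg l).fst.mul ((coord_pg l).fst.mul (PG.norm_rpow hJ0).snd),
    (2 * Real.pi)⁻¹ * (√(Real.Gamma (2 * (m:ℝ) - 2 + 1)) * √A), by positivity,
    fun a h ψ aD X Y hA => ?_⟩
  have hX0 : 0 ≤ X := (norm_nonneg _).trans (hA.bX l 0)
  set b := aD l
  set φ := ft (ft ψ) with hφ
  have hcs := cs_lint (heat_meas (n := n) (e := 2 * (m:ℝ) - 2) (j := J) (ft h).continuous).aemeasurable
    (carl_meas b φ l).aemeasurable (μ := volume.restrict (Set.Ioi 0)) hΓ hA0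
    (heat_sq (e := 2 * (m:ℝ) - 2) (j := J) (j0 := s - 1) (by linarith) (by linarith)
      (by rw [hJ]; ring) (ft h).continuous)
    (carleson b φ (hA.bX l) hX0 l)
  have hφn : eLpNorm φ 2 volume = eLpNorm (ft ψ) 2 volume := by
    rw [hφ, schwartz_plancherel]
  rw [hφn] at hcs
  calc _ ≤ ∫⁻ t in Set.Ioi (0:ℝ), ENNReal.ofReal ((2 * Real.pi)⁻¹) *
        (eLpNorm (fun η => ((t ^ ((2 * (m:ℝ) - 2) / 2) * (‖η‖ ^ J * ht t η) : ℝ) : ℂ) * ft h η) 2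
          volume * eLpNorm (fun x => dl l (heat |t| b) x * heat |t| φ x) 2 volume) := by
        refine setLIntegral_mono' measurableSet_Ioi fun t ht' => ?_
        have ht0 : 0 < t := ht'
        rw [abs_of_pos ht0]
        set g : SchwartzMap (EE n) ℂ := (2 * Real.pi * Complex.I)⁻¹ • dl l (heat t b) with hg
        have hpi : (Real.pi : ℂ) ≠ 0 := by exact_mod_cast Real.pi_ne_zero
        have hft : ∀ ζ, ft g ζ = ((ζ l : ℝ) : ℂ) * ft (heat t b) ζ := by
          intro ζ
          rw [hg, ft_smul, smul_apply, ft_dl, smul_eq_mul]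
          have := Complex.I_ne_zero
          field_simp
        have e : TS (fun p => p.1 l * (p.1 l * ‖p.2‖ ^ J)) (hf t (ft a)) (hf t (ft h)) (hf t (ft ψ)) =
            TS (fun _ => 1) (ft g) (fun η => ((‖η‖ ^ J : ℝ) : ℂ) * hf t (ft h) η) (hf t (ft ψ)) := by
          unfold TS
          congr 1; ext p
          rw [hft, ft_heat ht0.le, hA.der l]
          unfold hf
          push_cast; ring
        rw [e]
        have hb := T_bound_gen g ((hf_nc ht0.le (Nc.of_schwartz (ft h))).mul_pg
          (PG.norm_rpow (V := EE n) hJ0)) (hf_nc ht0.le (Nc.of_schwartz (ft ψ)))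
        refine (mul_le_mul_right hb _).trans_eq ?_
        have e1 : (fun x => g x * 𝓕 (hf t (ft ψ)) x) =
            fun x => (2 * Real.pi * Complex.I)⁻¹ • (dl l (heat t b) x * heat t φ x) := by
          ext x
          rw [hf_ft ht0.le, ← SchwartzMap.fourier_coe, hφ, ← heat_refl ht0.le, hg, smul_apply,
            smul_mul_assoc]
        have e2 : (fun η => ((t ^ ((2 * (m:ℝ) - 2) / 2) * (‖η‖ ^ J * ht t η) : ℝ) : ℂ) * ft h η) =
            fun η => ((t ^ ((m:ℝ) - 1) : ℝ) : ℂ) * (((‖η‖ ^ J : ℝ) : ℂ) * hf t (ft h) η) := by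
          ext η
          rw [show (2 * (m:ℝ) - 2) / 2 = (m:ℝ) - 1 by ring]
          unfold hf
          push_cast; ring
        have e3 : ‖(2 * Real.pi * Complex.I)⁻¹‖ₑ = ENNReal.ofReal ((2 * Real.pi)⁻¹) := by
          rw [← ofReal_norm]; congr 1
          simp [abs_of_pos Real.pi_pos]
        rw [e1, e2, eLpNorm_ofReal_mul (by positivity)]
        have e4 := eLpNorm_const_smul (2 * Real.pi * Complex.I)⁻¹ (fun x => dl l (heat t b) x * heat t φ x) 2 (volume : Measure (EE n))
        rw [e3] at e4
        rw [show eLpNorm (fun x => (2 * Real.pi * Complex.I)⁻¹ • (dl l (heat t b) x * heat t φ x)) 2 volume = _ from e4]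
        ring
    _ ≤ ENNReal.ofReal ((2 * Real.pi)⁻¹) * (ENNReal.ofReal (√(Real.Gamma (2 * (m:ℝ) - 2 + 1)) * √A) *
        eLpNorm (fun η => ((‖η‖ ^ (s - 1) : ℝ) : ℂ) * ft h η) 2 volume *
        (ENNReal.ofReal X * eLpNorm (ft ψ) 2 volume)) := by
        rw [lintegral_const_mul' _ _ (by finiteness)]
        exact mul_le_mul_right hcs _
    _ = ENNReal.ofReal ((2 * Real.pi)⁻¹ * (√(Real.Gamma (2 * (m:ℝ) - 2 + 1)) * √A)) *
        ((ENNReal.ofReal X * eLpNorm (fun η => ((‖η‖ ^ (s - 1) : ℝ) : ℂ) * ft h η) 2 volume) *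
          eLpNorm (ft ψ) 2 volume) := by
        rw [ENNReal.ofReal_mul (p := (2 * Real.pi)⁻¹) (by positivity)]
        ring
    _ ≤ _ := by
        unfold RH
        gcongr
        exact le_self_add

lemma Good_carl {m : ℕ} {s J : ℝ} (hs : 1 ≤ s) (hm : 1 ≤ m) (hJ : J = 2 * m + s - 2) :
    Good m s (fun p : EE n × EE n => ‖p.1‖ ^ 2 * ‖p.2‖ ^ J) := by
  refine (Good.sum Finset.univ fun l _ => Good_carl_l (n := n) hs hm hJ l).congr fun p => ?_
  rw [EuclideanSpace.real_norm_sq_eq, Finset.sum_mul]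
  exact Finset.sum_congr rfl fun l _ => by ring

end KP

end Part10

section Part11
open MeasureTheory
open scoped FourierTransform ENNReal ContDiff
namespace KP
variable {n : ℕ}

lemma coord_plus_bound (l : Fin n) (x : EE n) : |x l| ≤ ‖x‖ ^ (1:ℝ) := by
  simpa using coord_bound l x

lemma Good_u {m : ℕ} {s j k : ℝ} (hs : 1 ≤ s) (hj : s - 1 < j) (hk : 0 ≤ k) (c : ℕ)
    (h : j + k + 2 * (c + 1 : ℕ) = s + 2 * m) :
    Good m s (fun p : EE n × EE n => ‖p.2‖ ^ j * ‖p.1 + p.2‖ ^ k *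
      (inner ℝ p.1 (p.1 + p.2)) ^ (c + 1)) := by
  push_cast at h
  have h1 : ∀ l ∈ (Finset.univ : Finset (Fin n)), Good m s (fun p : EE n × EE n =>
      p.1 l * ((p.1 + p.2) l * (‖p.2‖ ^ j * ‖p.1 + p.2‖ ^ k) * (inner ℝ p.1 (p.1 + p.2)) ^ c)) := by
    intro l _
    exact Good_alpha_u hs l c ((MA.powers (n := n) (j := j) (k := k) (by linarith) hk).mul_plus hk
      zero_le_one (coord_cont l) (coord_plus_bound l)) hj (by linarith) (by linarith)
  refine (Good.sum _ h1).congr fun p => ?_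
  rw [pow_succ, inner_sum p.1 (p.1 + p.2), Finset.mul_sum, Finset.mul_sum]
  exact Finset.sum_congr rfl fun l _ => by ring

lemma Good_w {m : ℕ} {s j k : ℝ} (hs : 1 ≤ s) (hj : s - 1 < j) (hk : 0 < k)
    (h : j + k + 2 = s + 2 * m) :
    Good m s (fun p : EE n × EE n => ‖p.2‖ ^ j * ‖p.1 + p.2‖ ^ k * inner ℝ p.1 p.2) := by
  have h1 : ∀ l ∈ (Finset.univ : Finset (Fin n)), Good m s (fun p : EE n × EE n =>
      p.1 l * (p.2 l * (‖p.2‖ ^ j * ‖p.1 + p.2‖ ^ k))) := by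
    intro l _
    exact Good_alpha hs ((MA.powers (n := n) (j := j) (k := k) (by linarith) hk.le).mul_snd
      (by linarith) zero_le_one (coord_cont l) (coord_plus_bound l)) (by linarith) hk (by linarith) l
  refine (Good.sum _ h1).congr fun p => ?_
  rw [inner_sum p.1 p.2, Finset.mul_sum]
  exact Finset.sum_congr rfl fun l _ => by ring

lemma MA_vpow {s : ℝ} (hs : 0 ≤ s) (c : ℕ) :
    MA c (s + c) (fun p : EE n × EE n => ‖p.1 + p.2‖ ^ s * (inner ℝ p.2 (p.1 + p.2)) ^ c) := by
  induction c with
  | zero => exact (MA.powers (n := n) le_rfl hs).congr (by simp) (by simp) fun p => by simp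
  | succ c ih =>
    refine (ih.mul_v (by positivity) (by positivity)).congr (by push_cast; ring) (by push_cast; ring)
      fun p => by ring

lemma Good_b {m : ℕ} {s : ℝ} (hs : 1 ≤ s) (c d : ℕ) (hc : s < c) (h : c + d = m) :
    Good m s (fun p : EE n × EE n => ‖p.1 + p.2‖ ^ s * (inner ℝ p.1 (p.1 + p.2)) ^ c *
      (‖p.2‖ ^ 2) ^ d) := by
  have h' : (c:ℝ) + d = m := by exact_mod_cast h
  refine Good_beta_y hs d (i := c) (k := s + c) ((MA_vpow (n := n) (by linarith) c).congr rfl rfl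
    fun p => ?_) hc (by positivity) (by linarith)
  simp only [Prod.fst_swap, Prod.snd_swap]
  rw [add_comm p.1 p.2]

lemma Good_diff {m N : ℕ} {s r : ℝ} (hs : 1 ≤ s) (hm : 2 * s + 2 ≤ m) (hr : r = 2 * N - s)
    (hr2 : r ≤ 2) (hr0 : 0 < r) (hN : 1 ≤ N) :
    Good m s (fun p : EE n × EE n => (‖p.1 + p.2‖ ^ s - ‖p.2‖ ^ s) * (‖p.2‖ ^ 2) ^ m) := by
  have hm1 : (1:ℝ) ≤ m := by linarith
  have hm1' : 1 ≤ m := by exact_mod_cast hm1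
  -- first piece
  have hx : ∀ p : EE n × EE n, ‖p.1 + p.2‖ ^ 2 - ‖p.2‖ ^ 2 =
      inner ℝ p.1 (p.1 + p.2) + inner ℝ p.1 p.2 := by
    intro p
    rw [← real_inner_self_eq_norm_sq, ← real_inner_self_eq_norm_sq]
    simp only [inner_add_left, inner_add_right]
    rw [real_inner_comm p.1 p.2]; ring
  have hx' : ∀ p : EE n × EE n, ‖p.1 + p.2‖ ^ 2 - ‖p.2‖ ^ 2 =
      2 * inner ℝ p.1 (p.1 + p.2) - ‖p.1‖ ^ 2 := by
    intro p
    rw [hx, ← real_inner_self_eq_norm_sq]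
    simp only [inner_add_right]
    ring
  have A1 : ∀ l ∈ Finset.range N, Good m s (fun p : EE n × EE n =>
      (‖p.1 + p.2‖ ^ 2 - ‖p.2‖ ^ 2) * (‖p.2‖ ^ (2 * ((N:ℝ) - 1 - l) + 2 * m - r) *
        ‖p.1 + p.2‖ ^ (2 * (l:ℝ)))) := by
    intro l hl
    have hl' : (l:ℝ) + 1 ≤ N := by exact_mod_cast Finset.mem_range.mp hl
    have hu := Good_u (n := n) (m := m) (s := s) (j := 2 * ((N:ℝ) - 1 - l) + 2 * m - r)
      (k := 2 * (l:ℝ)) hs (by linarith) (by positivity) 0 (by push_cast; linarith)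
    rcases Nat.eq_zero_or_pos l with rfl | hl0
    · have hc := Good_carl (n := n) (m := m) (s := s) hs hm1' rfl
      refine ((hu.const_mul 2).sub hc).congr fun p => ?_
      rw [hx' p, show (2 * (m:ℝ) + s - 2) = 2 * ((N:ℝ) - 1 - (0:ℕ)) + 2 * m - r by
        rw [hr]; push_cast; ring]
      simp
      ring
    · have hl1 : (0:ℝ) < l := by exact_mod_cast hl0
      have hw := Good_w (n := n) (m := m) (s := s) (j := 2 * ((N:ℝ) - 1 - l) + 2 * m - r)
        (k := 2 * (l:ℝ)) hs (by linarith) (by positivity) (by linarith)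
      refine (hu.add hw).congr fun p => ?_
      rw [hx p]; ring
  have A := Good.sum _ A1
  have hf : r / 4 ∈ Set.Ioo (0:ℝ) 1 := ⟨by linarith, by linarith⟩
  have B1 := Good_kappa (n := n) (m := m) (s := s) (j := 2 * m - r + r / 2) (k := s) hs hf
    (by linarith) hs (by linarith)
  have B2 := Good_kappa (n := n) (m := m) (s := s) (j := 2 * m - r) (k := s + r / 2) hs hf
    (by linarith) (by linarith) (by linarith)
  refine (A.sub (B1.add B2)).congr fun p => ?_
  set x := ‖p.1 + p.2‖ with hxx
  set y := ‖p.2‖ with hyy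
  have x0 : 0 ≤ x := norm_nonneg _
  have y0 : 0 ≤ y := norm_nonneg _
  have e1 : ∀ z : ℝ, 0 ≤ z → (z ^ 2) ^ (r / 4) = z ^ (r / 2) := by
    intro z hz
    rw [← Real.rpow_natCast, ← Real.rpow_mul hz]; congr 1; push_cast; ring
  have e2 : (y ^ 2) ^ m = y ^ (2 * m - r) * y ^ (r / 2) * y ^ (r / 2) := by
    rw [← Real.rpow_add_of_nonneg y0 (by linarith) (by linarith),
      ← Real.rpow_add_of_nonneg y0 (by linarith) (by linarith), ← pow_mul, ← Real.rpow_natCast]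
    congr 1; push_cast; ring
  have e3 : y ^ (2 * m - r + r / 2) = y ^ (2 * m - r) * y ^ (r / 2) :=
    Real.rpow_add_of_nonneg y0 (by linarith) (by linarith)
  have e4 : x ^ (s + r / 2) = x ^ s * x ^ (r / 2) :=
    Real.rpow_add_of_nonneg x0 (by linarith) (by linarith)
  have e5 : ∀ z : ℝ, 0 ≤ z → (z ^ 2) ^ N = z ^ s * z ^ (r / 2) * z ^ (r / 2) := by
    intro z hz
    rw [← Real.rpow_add_of_nonneg hz (by linarith) (by linarith),
      ← Real.rpow_add_of_nonneg hz (by linarith) (by linarith), ← pow_mul, ← Real.rpow_natCast]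
    congr 1; push_cast; rw [hr]; ring
  have e6 : ∑ l ∈ Finset.range N, (x ^ 2 - y ^ 2) * (y ^ (2 * ((N:ℝ) - 1 - l) + 2 * m - r) *
        x ^ (2 * (l:ℝ))) = ((x ^ 2) ^ N - (y ^ 2) ^ N) * y ^ (2 * m - r) := by
    rw [← Finset.mul_sum]
    have g := (Commute.all (x ^ 2) (y ^ 2)).mul_geom_sum₂ N
    rw [← g, mul_assoc, Finset.sum_mul]
    congr 1
    refine Finset.sum_congr rfl fun l hl => ?_
    have hl1 := Finset.mem_range.mp hl
    have hl' : (l:ℝ) + 1 ≤ N := by exact_mod_cast hl1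
    have f1 : y ^ (2 * ((N:ℝ) - 1 - l) + 2 * m - r) = (y ^ 2) ^ (N - 1 - l) * y ^ (2 * m - r) := by
      rw [← pow_mul, ← Real.rpow_natCast, ← Real.rpow_add_of_nonneg y0 (by positivity) (by linarith)]
      congr 1
      rw [Nat.cast_mul, Nat.cast_sub (by omega), Nat.cast_sub hN]
      push_cast; ring
    have f2 : x ^ (2 * (l:ℝ)) = (x ^ 2) ^ l := by
      rw [← pow_mul, ← Real.rpow_natCast]; push_cast; rfl
    rw [f1, f2]; ring
  rw [e6, e1 x x0, e1 y y0, e5 x x0, e5 y y0, e2, e3, e4]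
  ring

noncomputable def sg (s : ℝ) (p : EE n × EE n) : ℝ := ‖p.1 + p.2‖ ^ s - ‖p.2‖ ^ s
noncomputable def qq (p : EE n × EE n) : ℝ := ‖p.2‖ ^ 2 + inner ℝ p.1 (p.1 + p.2)

lemma qq_eq (p : EE n × EE n) : 2 * qq p = ‖p.1‖ ^ 2 + ‖p.2‖ ^ 2 + ‖p.1 + p.2‖ ^ 2 := by
  unfold qq
  rw [norm_add_sq_real, inner_add_right, real_inner_self_eq_norm_sq]; ring

lemma Good_main {m : ℕ} {s : ℝ} (hs : 1 ≤ s) (hm : 2 * s + 2 ≤ m) :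
    Good m s (fun p : EE n × EE n => sg s p * qq p ^ m) := by
  have h1 : ∀ c ∈ Finset.range (m + 1), Good m s (fun p : EE n × EE n =>
      (m.choose c : ℝ) * ((‖p.1 + p.2‖ ^ s - ‖p.2‖ ^ s) * (inner ℝ p.1 (p.1 + p.2) ^ c *
        (‖p.2‖ ^ 2) ^ (m - c)))) := by
    intro c hc
    have hcm : c ≤ m := by have := Finset.mem_range.mp hc; omega
    refine Good.const_mul ?_ _
    rcases Nat.eq_zero_or_pos c with rfl | hc0
    · have hf := Nat.floor_le (a := s / 2) (by linarith)
      have hf' := Nat.lt_floor_add_one (s / 2)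
      refine (Good_diff (n := n) (N := ⌊s / 2⌋₊ + 1) hs hm rfl (by push_cast; linarith)
        (by push_cast; linarith) (by omega)).congr fun p => by simp
    · obtain ⟨c, rfl⟩ := Nat.exists_eq_add_of_le' hc0
      set d := m - (c + 1) with hd
      have hdm : (c:ℝ) + 1 + d = m := by
        have : c + 1 + d = m := by omega
        exact_mod_cast this
      have hpow : ∀ y : ℝ, (y ^ 2) ^ d = y ^ (2 * (d:ℝ)) := by
        intro y; rw [← pow_mul, ← Real.rpow_natCast]; push_cast; rfl
      have P1 : Good m s (fun p : EE n × EE n => ‖p.2‖ ^ (s + 2 * d) * ‖p.1 + p.2‖ ^ (0:ℝ) *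
          (inner ℝ p.1 (p.1 + p.2)) ^ (c + 1)) :=
        Good_u hs (by have : (0:ℝ) ≤ d := by positivity
                      linarith) le_rfl c (by push_cast; linarith)
      have P2 : Good m s (fun p : EE n × EE n => ‖p.1 + p.2‖ ^ s *
          (inner ℝ p.1 (p.1 + p.2)) ^ (c + 1) * (‖p.2‖ ^ 2) ^ d) := by
        by_cases hcase : s - 1 < 2 * d
        · refine (Good_u (n := n) (j := 2 * d) (k := s) hs hcase (by linarith) c
            (by push_cast; linarith)).congr fun p => ?_
          rw [hpow]; ring
        · exact Good_b hs (c + 1) d (by push_cast; linarith) (by omega)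
      refine (P2.sub P1).congr fun p => ?_
      rw [Real.rpow_add_of_nonneg (norm_nonneg _) (by linarith) (by positivity), hpow]
      simp
      ring
  refine (Good.sum _ h1).congr fun p => ?_
  unfold sg qq
  rw [add_comm (‖p.2‖ ^ 2), add_pow, Finset.mul_sum]
  exact Finset.sum_congr rfl fun c _ => by ring

end KP

end Part11

section Part12
open MeasureTheory
open scoped FourierTransform ENNReal ContDiff
namespace KP
variable {n : ℕ}

lemma qq_nonneg (p : EE n × EE n) : 0 ≤ qq p := by
  have := qq_eq p
  have : 0 ≤ ‖p.1‖ ^ 2 + ‖p.2‖ ^ 2 + ‖p.1 + p.2‖ ^ 2 := by positivity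
  linarith

lemma sg_zero {s : ℝ} {p : EE n × EE n} (h : qq p = 0) : sg s p = 0 := by
  have := qq_eq p
  have h1 : ‖p.1 + p.2‖ = 0 := by nlinarith [sq_nonneg ‖p.1‖, sq_nonneg ‖p.2‖, sq_nonneg ‖p.1 + p.2‖]
  have h2 : ‖p.2‖ = 0 := by nlinarith [sq_nonneg ‖p.1‖, sq_nonneg ‖p.2‖, sq_nonneg ‖p.1 + p.2‖]
  unfold sg; rw [h1, h2]; ring

lemma sg_pg {s : ℝ} (hs : 0 ≤ s) : PG (sg s : EE n × EE n → ℝ) :=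
  ((PG.norm_rpow (V := EE n) hs).plus).sub ((PG.norm_rpow (V := EE n) hs).snd)

lemma qq_cont : Continuous (qq : EE n × EE n → ℝ) := by unfold qq; fun_prop

lemma ht_prod (t : ℝ) (p : EE n × EE n) :
    ht t p.1 * ht t p.2 * ht t (p.1 + p.2) = Real.exp (-(2 * qq p * t)) := by
  unfold ht
  rw [← Real.exp_add, ← Real.exp_add, qq_eq]; congr 1; ring

lemma core {s : ℝ} (hs : 1 ≤ s) : ∃ C : ℝ, 0 ≤ C ∧ ∀ (a h ψ : SchwartzMap (EE n) ℂ)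
    (aD : Fin n → SchwartzMap (EE n) ℂ) (X Y : ℝ), Adm a h aD X Y →
    ‖TS (sg s) (ft a) (ft h) (ft ψ)‖ₑ ≤ ENNReal.ofReal C * RH s a h ψ X Y := by
  obtain ⟨m, hm⟩ := exists_nat_ge (2 * s + 2)
  have hm0 : (0:ℝ) < m := by linarith
  obtain ⟨hPG, C, hC, hb⟩ := Good_main (n := n) hs hm
  have hΓ := Real.Gamma_pos_of_pos hm0
  set c : ℝ := 2 ^ (m:ℝ) / Real.Gamma m with hc
  have hc0 : 0 < c := by positivity
  refine ⟨c * C, by positivity, fun a h ψ aD X Y hA => ?_⟩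
  set K : ℝ → EE n × EE n → ℝ := fun t p =>
    (c * (sg s p * qq p ^ m)) * (t ^ ((m:ℝ) - 1) * Real.exp (-(2 * qq p * t))) with hK
  have hint : ∀ p : EE n × EE n, 0 < qq p → IntegrableOn
      (fun t : ℝ => t ^ ((m:ℝ) - 1) * Real.exp (-(2 * qq p * t))) (Set.Ioi 0) := by
    intro p hp
    have := integrableOn_rpow_mul_exp_neg_mul_rpow (p := 1) (s := (m:ℝ) - 1) (b := 2 * qq p)
      (by linarith) (by norm_num) (by positivity)
    refine this.congr_fun (fun t _ => ?_) measurableSet_Ioi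
    simp
  have hval : ∀ p : EE n × EE n, 0 < qq p →
      ∫ t in Set.Ioi (0:ℝ), t ^ ((m:ℝ) - 1) * Real.exp (-(2 * qq p * t)) = (c * qq p ^ m)⁻¹ := by
    intro p hp
    rw [Real.integral_rpow_mul_exp_neg_mul_Ioi hm0 (by positivity), hc, one_div,
      Real.inv_rpow (by positivity), Real.mul_rpow (by norm_num) hp.le, Real.rpow_natCast (qq p)]
    field_simp
  have hS : ∀ p, sg s p = ∫ t in Set.Ioi (0:ℝ), K t p := by
    intro p
    rcases (qq_nonneg p).eq_or_lt with h0 | h0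
    · simp [hK, sg_zero h0.symm]
    · simp only [hK]
      rw [integral_const_mul, hval p h0]
      field_simp
  have hKP : ∀ p, ∫⁻ t in Set.Ioi (0:ℝ), ‖K t p‖ₑ ≤ ENNReal.ofReal |sg s p| := by
    intro p
    rcases (qq_nonneg p).eq_or_lt with h0 | h0
    · simp [hK, sg_zero h0.symm]
    · have e : ∀ t ∈ Set.Ioi (0:ℝ), ‖K t p‖ₑ = ENNReal.ofReal (c * (|sg s p| * qq p ^ m)) *
          ENNReal.ofReal (t ^ ((m:ℝ) - 1) * Real.exp (-(2 * qq p * t))) := by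
        intro t ht0
        have ht0 : 0 < t := ht0
        rw [← ENNReal.ofReal_mul (by positivity), ← ofReal_norm]
        congr 1
        simp only [hK, Real.norm_eq_abs, abs_mul, abs_of_pos hc0, abs_of_pos (pow_pos h0 m),
          abs_of_pos (Real.rpow_pos_of_pos ht0 _), Real.abs_exp]
      rw [setLIntegral_congr_fun measurableSet_Ioi e, lintegral_const_mul' _ _ (by finiteness),
        ← ofReal_integral_eq_lintegral_ofReal (hint p h0), hval p h0, ← ENNReal.ofReal_mul (by positivity)]
      · refine le_of_eq (congrArg _ ?_)
        field_simp
      · refine (ae_restrict_iff' measurableSet_Ioi).2 (Filter.Eventually.of_forall fun t ht0 => ?_)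
        have ht0 : 0 < t := ht0
        positivity
  have hKm : Measurable (Function.uncurry K) := by
    have h1 : Measurable (fun p : EE n × EE n => sg s p) := (sg_pg (by linarith)).cont.measurable
    have h2 : Measurable (fun p : EE n × EE n => qq p) := qq_cont.measurable
    have h3 : Measurable (fun z : ℝ × (EE n × EE n) => sg s z.2) := h1.comp measurable_snd
    have h4 : Measurable (fun z : ℝ × (EE n × EE n) => qq z.2) := h2.comp measurable_snd
    have h5 : Measurable (fun z : ℝ × (EE n × EE n) => z.1 ^ ((m:ℝ) - 1)) :=
      measurable_fst.pow_const _
    exact (measurable_const.mul (h3.mul (h4.pow_const m))).mul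
      (h5.mul (Real.measurable_exp.comp (((measurable_const.mul h4).mul measurable_fst).neg)))
  have hPabs : PG (fun p : EE n × EE n => |sg s p|) :=
    PG.of_le (sg_pg (by linarith)).cont.abs (sg_pg (s := s) (by linarith)) fun p => by simp
  refine (fubini_TS hKm hS hPabs hKP (Nc.of_schwartz (ft a)) (Nc.of_schwartz (ft h))
    (Nc.of_schwartz (ft ψ))).trans ?_
  calc _ = ∫⁻ t in Set.Ioi (0:ℝ), ENNReal.ofReal c * (ENNReal.ofReal (t ^ ((m:ℝ) - 1)) *
      ‖TS (fun p => sg s p * qq p ^ m) (hf t (ft a)) (hf t (ft h)) (hf t (ft ψ))‖ₑ) := by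
        refine setLIntegral_congr_fun measurableSet_Ioi fun t ht0 => ?_
        have ht0 : 0 < t := ht0
        have e : TS (K t) (ft a) (ft h) (ft ψ) = ((c * t ^ ((m:ℝ) - 1) : ℝ) : ℂ) *
            TS (fun p => sg s p * qq p ^ m) (hf t (ft a)) (hf t (ft h)) (hf t (ft ψ)) := by
          rw [← TS_const_mul]
          unfold TS
          congr 1; ext p
          have := ht_prod t p
          simp only [hK, ← this, hf]
          push_cast; ring
        show ‖TS (K t) (ft a) (ft h) (ft ψ)‖ₑ = _
        rw [e, enorm_mul, ← ofReal_norm, Complex.norm_real, Real.norm_of_nonneg (by positivity),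
          ENNReal.ofReal_mul hc0.le, mul_assoc]
    _ ≤ ENNReal.ofReal c * (ENNReal.ofReal C * RH s a h ψ X Y) := by
        rw [lintegral_const_mul' _ _ (by finiteness)]
        exact mul_le_mul_right (hb a h ψ aD X Y hA) _
    _ = _ := by rw [ENNReal.ofReal_mul hc0.le, mul_assoc]

end KP

end Part12

section Part13
open MeasureTheory
open scoped FourierTransform ENNReal ContDiff
namespace KP
variable {n : ℕ}

lemma inv_eq (γ : SchwartzMap (EE n) ℂ) (x : EE n) : 𝓕⁻ (fun ξ => ft γ ξ) x = γ x := by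
  have h : 𝓕⁻ (ft γ) = γ := by simp [ft]
  have h2 := SchwartzMap.fourierInv_coe (ft γ)
  rw [h] at h2
  exact (congrFun h2 x).symm

lemma ft_coe (γ : SchwartzMap (EE n) ℂ) : (𝓕 (fun ξ => γ ξ) : EE n → ℂ) = fun x => ft γ x :=
  (SchwartzMap.fourier_coe γ).symm

/-- Parseval in bilinear form. -/
lemma parseval {F : EE n → ℂ} (hF : Nc F) (γ : SchwartzMap (EE n) ℂ) :
    ∫ x, 𝓕⁻ F x * ft γ x = ∫ ξ, F ξ * γ ξ := by
  have h1 : ∫ x, 𝓕⁻ F x * ft γ x = ∫ x, 𝓕 F x * ft γ (-x) := by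
    rw [← integral_neg_eq_self]
    congr 1; ext x
    rw [Real.fourierInv_eq_fourier_neg, neg_neg]
  set δ : SchwartzMap (EE n) ℂ := 𝓕⁻ γ with hδ
  have hγ : ft δ = γ := by simp [ft, hδ]
  have h2 : ∀ x, ft γ (-x) = δ x := by
    intro x
    have e := SchwartzMap.fourierInv_coe γ
    rw [← hδ] at e
    rw [e, Real.fourierInv_eq_fourier_neg, ← SchwartzMap.fourier_coe]
  rw [h1]
  simp only [h2]
  rw [fourier_self_adj hF.integrable (Nc.of_schwartz δ).integrable, ft_coe, hγ]

noncomputable def mulS (a h : SchwartzMap (EE n) ℂ) : SchwartzMap (EE n) ℂ :=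
  SchwartzMap.pairing (ContinuousLinearMap.mul ℂ ℂ) a h

lemma mulS_apply (a h : SchwartzMap (EE n) ℂ) (x : EE n) : mulS a h x = a x * h x := rfl

/-- symbol side of the fractional Laplacian -/
noncomputable def LF (s : ℝ) (h : SchwartzMap (EE n) ℂ) : EE n → ℂ :=
  fun ξ => ((‖ξ‖ ^ s : ℝ) : ℂ) * ft h ξ

lemma LF_nc {s : ℝ} (hs : 0 ≤ s) (h : SchwartzMap (EE n) ℂ) : Nc (LF s h) :=
  (Nc.of_schwartz (ft h)).mul_pg (PG.norm_rpow hs)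

noncomputable def W (s : ℝ) (a h : SchwartzMap (EE n) ℂ) (x : EE n) : ℂ :=
  𝓕⁻ (LF s (mulS a h)) x - a x * 𝓕⁻ (LF s h) x

lemma memLp_inv {F : EE n → ℂ} (hF : Nc F) : MemLp (𝓕⁻ F) 2 volume :=
  ⟨(fourierInv_cont hF.integrable).aestronglyMeasurable, by
    rw [hF.plancherelInv]; exact hF.memLp.2⟩

lemma memLp_mul_inv {F : EE n → ℂ} (hF : Nc F) (a : SchwartzMap (EE n) ℂ) :
    MemLp (fun x => a x * 𝓕⁻ F x) 2 volume := by
  obtain ⟨C, hC, hb⟩ := (Nc.of_schwartz a).bdd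
  refine ⟨(a.continuous.mul (fourierInv_cont hF.integrable)).aestronglyMeasurable, ?_⟩
  exact (eLpNorm_bdd_mul_le hb).trans_lt (ENNReal.mul_lt_top ENNReal.ofReal_lt_top (memLp_inv hF).2)

lemma W_memLp {s : ℝ} (hs : 0 ≤ s) (a h : SchwartzMap (EE n) ℂ) : MemLp (W s a h) 2 volume :=
  (memLp_inv (LF_nc hs _)).sub (memLp_mul_inv (LF_nc hs h) a)

lemma W_pair {s : ℝ} (hs : 0 ≤ s) (a h γ : SchwartzMap (EE n) ℂ) :
    ∫ x, W s a h x * ft γ x = TS (sg s) (ft a) (ft h) γ := by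
  have hL : MemLp (fun x => ft γ x) 2 (volume : Measure (EE n)) := (Nc.of_schwartz (ft γ)).memLp
  have i1 : Integrable (fun x => 𝓕⁻ (LF s (mulS a h)) x * ft γ x) :=
    (memLp_inv (LF_nc hs (mulS a h))).integrable_mul hL
  have i2 : Integrable (fun x => a x * 𝓕⁻ (LF s h) x * ft γ x) :=
    (memLp_mul_inv (LF_nc hs h) a).integrable_mul hL
  have e0 : ∫ x, W s a h x * ft γ x = ∫ x, (𝓕⁻ (LF s (mulS a h)) x * ft γ x -
      a x * 𝓕⁻ (LF s h) x * ft γ x) := by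
    congr 1; ext x; unfold W; ring
  rw [e0, integral_sub i1 i2, parseval (LF_nc hs _)]
  have hγ' : Nc (fun ξ => ((‖ξ‖ ^ s : ℝ) : ℂ) * γ ξ) := (Nc.of_schwartz γ).mul_pg (PG.norm_rpow hs)
  have e1 : ∫ ξ, LF s (mulS a h) ξ * γ ξ =
      TS (fun p => ‖p.1 + p.2‖ ^ s) (ft a) (ft h) γ := by
    have : ∀ ξ, LF s (mulS a h) ξ * γ ξ =
        (𝓕 (fun x => mulS a h x) : EE n → ℂ) ξ * (((‖ξ‖ ^ s : ℝ) : ℂ) * γ ξ) := by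
      intro ξ; rw [ft_coe]; unfold LF; ring
    simp only [this]
    rw [fourier_self_adj (Nc.of_schwartz (mulS a h)).integrable hγ'.integrable]
    have hT := T_identity a (Nc.of_schwartz (ft h)) hγ'
    have : ∀ x, mulS a h x * 𝓕 (fun ξ => ((‖ξ‖ ^ s : ℝ) : ℂ) * γ ξ) x =
        a x * 𝓕⁻ (fun ξ => ft h ξ) x * 𝓕 (fun ξ => ((‖ξ‖ ^ s : ℝ) : ℂ) * γ ξ) x := by
      intro x; rw [inv_eq, mulS_apply]
    simp only [this]
    rw [← hT]
    unfold TS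
    congr 1; ext p
    push_cast; ring
  have e2 : ∫ x, a x * 𝓕⁻ (LF s h) x * ft γ x = TS (fun p => ‖p.2‖ ^ s) (ft a) (ft h) γ := by
    have hT := T_identity a (LF_nc hs h) (Nc.of_schwartz γ)
    rw [ft_coe] at hT
    rw [← hT]
    unfold TS LF
    congr 1; ext p
    push_cast; ring
  rw [e1, e2]
  have i3 := integrable_integrand ((PG.norm_rpow (V := EE n) hs).plus) (Nc.of_schwartz (ft a))
    (Nc.of_schwartz (ft h)) (Nc.of_schwartz γ)
  have i4 := integrable_integrand ((PG.norm_rpow (V := EE n) hs).snd (V := EE n)) (Nc.of_schwartz (ft a))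
    (Nc.of_schwartz (ft h)) (Nc.of_schwartz γ)
  unfold TS
  rw [← integral_sub i3 i4]
  congr 1; ext p
  unfold sg
  push_cast; ring

lemma duality {F : EE n → ℂ} (hF : MemLp F 2 volume) {M : ℝ≥0∞}
    (h : ∀ φ : SchwartzMap (EE n) ℂ, ‖∫ x, F x * φ x‖ₑ ≤ M * eLpNorm φ 2 volume) :
    eLpNorm F 2 volume ≤ M := by
  by_cases hM : M = ⊤
  · simp [hM]
  have hG : MemLp (fun x => star (F x)) 2 volume := hF.star
  have hGF : eLpNorm (fun x => star (F x)) 2 volume = eLpNorm F 2 volume :=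
    eLpNorm_congr_norm_ae (Filter.Eventually.of_forall fun x => by simp)
  set u : Lp ℂ 2 (volume : Measure (EE n)) := hG.toLp _ with hu
  have key : ∀ w : Lp ℂ 2 (volume : Measure (EE n)), ‖(inner ℂ u w : ℂ)‖ ≤ M.toReal * ‖w‖ := by
    intro w
    refine (SchwartzMap.denseRange_toLpCLM (E := EE n) (F := ℂ) (p := 2) (μ := volume)
      (by norm_num)).induction_on (p := fun w => ‖(inner ℂ u w : ℂ)‖ ≤ M.toReal * ‖w‖) w ?_ ?_
    · exact isClosed_le (by fun_prop) (by fun_prop)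
    · intro φ
      have e : (inner ℂ u (SchwartzMap.toLpCLM ℝ ℂ 2 volume φ) : ℂ) = ∫ x, F x * φ x := by
        rw [L2.inner_def]
        refine integral_congr_ae ?_
        filter_upwards [hG.coeFn_toLp, φ.coeFn_toLp 2 volume] with x h1 h2
        rw [hu, h1]
        have h3 : (SchwartzMap.toLpCLM ℝ ℂ 2 volume φ : Lp ℂ 2 (volume : Measure (EE n))) x = φ x := h2
        rw [h3]
        simp [mul_comm]
      have e2 : ‖(SchwartzMap.toLpCLM ℝ ℂ 2 volume φ : Lp ℂ 2 (volume : Measure (EE n)))‖ =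
          (eLpNorm φ 2 volume).toReal := SchwartzMap.norm_toLp
      rw [e, e2, ← ENNReal.toReal_mul, ← toReal_enorm]
      exact ENNReal.toReal_mono (ENNReal.mul_ne_top hM (φ.memLp 2 (volume : Measure (EE n))).2.ne) (h φ)
  have h1 := key u
  rw [inner_self_eq_norm_sq_to_K] at h1
  have h2 : ‖u‖ ^ 2 ≤ M.toReal * ‖u‖ := by simpa using h1
  have h3 : ‖u‖ ≤ M.toReal := by
    by_contra hc
    push Not at hc
    have : 0 ≤ M.toReal := ENNReal.toReal_nonneg
    nlinarith [norm_nonneg u]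
  rw [hu, Lp.norm_toLp, hGF] at h3
  exact (ENNReal.toReal_le_toReal hF.2.ne hM).1 h3

lemma scalar_bound {s : ℝ} (hs : 1 ≤ s) : ∃ C : ℝ, 0 ≤ C ∧ ∀ (a h : SchwartzMap (EE n) ℂ)
    (aD : Fin n → SchwartzMap (EE n) ℂ) (X Y : ℝ), Adm a h aD X Y →
    eLpNorm (W s a h) 2 volume ≤ ENNReal.ofReal C *
      (ENNReal.ofReal X * eLpNorm (LF (s - 1) h) 2 volume +
        eLpNorm (LF s a) 2 volume * ENNReal.ofReal Y) := by
  obtain ⟨C, hC, hb⟩ := core (n := n) hs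
  refine ⟨C, hC, fun a h aD X Y hA => duality (W_memLp (by linarith) a h) fun φ => ?_⟩
  set γ : SchwartzMap (EE n) ℂ := 𝓕⁻ φ with hγ
  set ψ : SchwartzMap (EE n) ℂ := 𝓕⁻ γ with hψ
  have h1 : ft γ = φ := by simp [ft, hγ]
  have h2 : ft ψ = γ := by simp [ft, hψ]
  have h3 := hb a h ψ aD X Y hA
  rw [h2, ← W_pair (by linarith), h1] at h3
  refine h3.trans_eq ?_
  unfold RH
  rw [h2, ← schwartz_plancherel γ, h1, ← mul_assoc]
  rfl

end KP

end Part13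

section Part14
open MeasureTheory
open scoped FourierTransform ENNReal ContDiff
namespace KP
variable {n : ℕ}

lemma Lam_eq (s : ℝ) (h : SchwartzMap (EE n) ℂ) : Lam s (fun x => h x) = 𝓕⁻ (LF s h) := by
  ext x
  unfold Lam LF
  rw [ft_coe]

lemma fderiv_inv {F : EE n → ℂ} (hF : Nc F) (x : EE n) (l : Fin n) :
    fderiv ℝ (𝓕⁻ F) x (EuclideanSpace.single l 1) =
      𝓕⁻ (fun ξ => (2 * Real.pi * Complex.I) * ((ξ l : ℝ) : ℂ) * F ξ) x := by
  have hN : Nc (fun ξ => ((‖ξ‖ ^ (1:ℝ) : ℝ) : ℂ) * F ξ) := hF.mul_pg (PG.norm_rpow zero_le_one)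
  have h2 : Integrable (fun v : EE n => ‖v‖ * ‖F v‖) := by
    refine hN.integrable.norm.congr (Filter.Eventually.of_forall fun v => ?_)
    simp
  have hd := Real.hasFDerivAt_fourier hF.integrable h2 (-x)
  have e : 𝓕⁻ F = (𝓕 F) ∘ (fun x => -x) := by ext x; exact Real.fourierInv_eq_fourier_neg F x
  have hc := hd.comp x ((hasFDerivAt_id x).neg)
  have hI : Integrable (VectorFourier.fourierSMulRight (innerSL ℝ) F) := by
    refine (h2.const_mul (2 * Real.pi)).mono' ?_ (Filter.Eventually.of_forall fun v => ?_)
    · exact AEStronglyMeasurable.fourierSMulRight (L := innerSL ℝ) hF.integrable.1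
    · have := VectorFourier.norm_fourierSMulRight (innerSL ℝ) F v
      rw [this, innerSL_apply_norm, mul_assoc]
  have hc' : HasFDerivAt (𝓕⁻ F) (𝓕 (VectorFourier.fourierSMulRight (innerSL ℝ) F) (-x) ∘SL
      (-ContinuousLinearMap.id ℝ (EE n))) x := by rw [e]; exact hc
  rw [hc'.fderiv]
  simp only [ContinuousLinearMap.comp_apply, neg_apply, map_neg,
    ContinuousLinearMap.id_apply]
  rw [Real.fourier_continuousLinearMap_apply hI, Real.fourierInv_eq_fourier_neg,
    Real.fourier_eq', Real.fourier_eq', ← integral_neg]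
  congr 1; ext v
  have hin : ((innerSL ℝ) v) (EuclideanSpace.single l (1:ℝ)) = v l := by
    rw [innerSL_apply_apply, EuclideanSpace.inner_single_right]; simp
  simp [VectorFourier.fourierSMulRight_apply, hin]
  ring

/-- complex-valued component -/
noncomputable def cmp (j : Fin n) (f : SchwartzMap (EE n) (EE n)) : SchwartzMap (EE n) ℂ :=
  SchwartzMap.postcompCLM (Complex.ofRealCLM ∘L (EuclideanSpace.proj j : EE n →L[ℝ] ℝ)) f

lemma cmp_apply (j : Fin n) (f : SchwartzMap (EE n) (EE n)) (x : EE n) :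
    cmp j f x = ((f x j : ℝ) : ℂ) := rfl

lemma fderiv_cmp (j : Fin n) (f : SchwartzMap (EE n) (EE n)) (x v : EE n) :
    fderiv ℝ (cmp j f) x v = (((fderiv ℝ f x v) j : ℝ) : ℂ) := by
  have h := (Complex.ofRealCLM ∘L (EuclideanSpace.proj j : EE n →L[ℝ] ℝ)).hasFDerivAt.comp x
    (f.differentiableAt (x := x)).hasFDerivAt
  have e : (cmp j f : EE n → ℂ) = (Complex.ofRealCLM ∘L (EuclideanSpace.proj j : EE n →L[ℝ] ℝ)) ∘ f := rfl
  rw [e, h.fderiv]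
  rfl

lemma fderiv_comp_real (j : Fin n) (f : SchwartzMap (EE n) (EE n)) (x v : EE n) :
    fderiv ℝ (fun y => f y j) x v = (fderiv ℝ f x v) j := by
  have h := (EuclideanSpace.proj j : EE n →L[ℝ] ℝ).hasFDerivAt.comp x
    (f.differentiableAt (x := x)).hasFDerivAt
  have e : (fun y => f y j) = (EuclideanSpace.proj j : EE n →L[ℝ] ℝ) ∘ f := rfl
  rw [e, h.fderiv]
  rfl

lemma dl_cmp_norm (j l : Fin n) (f : SchwartzMap (EE n) (EE n)) (x : EE n) :
    ‖dl l (cmp j f) x‖ ≤ ‖fderiv ℝ f x‖ := by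
  rw [dl_apply, fderiv_cmp, Complex.norm_real]
  refine (coord_bound j _).trans ?_
  refine ((fderiv ℝ f x).le_opNorm _).trans ?_
  simp

lemma sup_bound {V : Type*} [NormedAddCommGroup V] {F : EE n → V} (hF : Continuous F)
    (hfin : eLpNorm F ⊤ volume ≠ ⊤) (x : EE n) : ‖F x‖ ≤ (eLpNorm F ⊤ volume).toReal := by
  have h : ‖F x‖ₑ ≤ eLpNorm F ⊤ volume := by
    by_contra hc
    push Not at hc
    have ho : IsOpen {y | eLpNorm F ⊤ volume < ‖F y‖ₑ} := isOpen_lt continuous_const hF.enorm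
    have h0 : volume {y | eLpNorm F ⊤ volume < ‖F y‖ₑ} = 0 := by
      have := ae_le_eLpNormEssSup (f := F) (μ := (volume : Measure (EE n)))
      rw [← eLpNorm_exponent_top, ae_iff] at this
      simpa using this
    have := (ho.measure_eq_zero_iff volume).1 h0
    exact (Set.eq_empty_iff_forall_notMem.1 this x) hc
  rw [← toReal_enorm]
  exact ENNReal.toReal_mono hfin h

lemma fd_fin (f : SchwartzMap (EE n) (EE n)) : eLpNorm (fun x => fderiv ℝ f x) ⊤ volume ≠ ⊤ :=
  ((SchwartzMap.fderivCLM ℝ (EE n) (EE n) f).memLp_top volume).2.ne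

lemma fd_cont (f : SchwartzMap (EE n) (EE n)) : Continuous (fun x => fderiv ℝ f x) :=
  (SchwartzMap.fderivCLM ℝ (EE n) (EE n) f).continuous

lemma adm_cmp (f g : SchwartzMap (EE n) (EE n)) (i j : Fin n) :
    Adm (cmp j f) (dl j (cmp i g)) (fun l => (2 * Real.pi * Complex.I)⁻¹ • dl l (cmp j f))
      (eLpNorm (fun x => fderiv ℝ f x) ⊤ volume).toReal
      (eLpNorm (fun x => fderiv ℝ g x) ⊤ volume).toReal := by
  refine ⟨fun l ζ => ?_, fun l x => ?_, fun x => ?_⟩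
  · have hpi : (Real.pi : ℂ) ≠ 0 := by exact_mod_cast Real.pi_ne_zero
    have := Complex.I_ne_zero
    rw [ft_smul, smul_apply, ft_dl, smul_eq_mul]
    field_simp
  · rw [smul_apply, norm_smul]
    have h1 : ‖(2 * Real.pi * Complex.I)⁻¹‖ ≤ 1 := by
      have : (1:ℝ) ≤ 2 * Real.pi := by linarith [Real.pi_gt_three]
      have e : ‖(2 * Real.pi * Complex.I)⁻¹‖ = (2 * Real.pi)⁻¹ := by
        simp [abs_of_pos Real.pi_pos]
      rw [e]; exact inv_le_one_of_one_le₀ this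
    calc _ ≤ 1 * ‖dl l (cmp j f) x‖ := by gcongr
      _ ≤ ‖fderiv ℝ f x‖ := by rw [one_mul]; exact dl_cmp_norm _ _ _ _
      _ ≤ _ := sup_bound (fd_cont f) (fd_fin f) x
  · exact (dl_cmp_norm _ _ _ _).trans (sup_bound (fd_cont g) (fd_fin g) x)

lemma LF_dl {s : ℝ} (hs : 1 ≤ s) (j : Fin n) (h : SchwartzMap (EE n) ℂ) :
    eLpNorm (LF (s - 1) (dl j h)) 2 volume ≤
      ENNReal.ofReal (2 * Real.pi) * eLpNorm (LF s h) 2 volume := by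
  refine eLpNorm_le_mul_eLpNorm_of_ae_le_mul (Filter.Eventually.of_forall fun ξ => ?_) 2
  unfold LF
  rw [ft_dl]
  simp only [norm_mul, Complex.norm_real, Complex.norm_I, Complex.norm_ofNat, Real.norm_eq_abs,
    abs_of_pos Real.pi_pos, mul_one]
  rw [abs_of_nonneg (Real.rpow_nonneg (norm_nonneg ξ) (s - 1)),
    abs_of_nonneg (Real.rpow_nonneg (norm_nonneg ξ) s)]
  have e : ‖ξ‖ ^ s = ‖ξ‖ ^ (s - 1) * ‖ξ‖ := by
    have := Real.rpow_add_of_nonneg (norm_nonneg ξ) (y := s - 1) (z := 1) (by linarith) zero_le_one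
    simpa using this
  rw [e]
  have := coord_bound j ξ
  calc ‖ξ‖ ^ (s - 1) * (2 * Real.pi * |ξ j| * ‖ft h ξ‖)
      ≤ ‖ξ‖ ^ (s - 1) * (2 * Real.pi * ‖ξ‖ * ‖ft h ξ‖) := by gcongr
    _ = _ := by ring

lemma eLpNorm_comp_le {F : EE n → Fin n → ℂ} (i : Fin n) :
    eLpNorm (fun x => F x i) 2 volume ≤ eLpNorm F 2 volume :=
  eLpNorm_mono_ae (Filter.Eventually.of_forall fun x => norm_le_pi_norm (F x) i)

lemma eLpNorm_pi_le {F : EE n → Fin n → ℂ} (hF : ∀ i, Continuous (fun x => F x i)) :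
    eLpNorm F 2 volume ≤ ∑ i, eLpNorm (fun x => F x i) 2 volume := by
  have e : F = ∑ i, fun x => (Pi.single i (F x i) : Fin n → ℂ) := by
    ext x k
    simp [Finset.sum_apply, Pi.single_apply]
  have h1 : eLpNorm F 2 volume ≤ ∑ i, eLpNorm (fun x => (Pi.single i (F x i) : Fin n → ℂ)) 2 volume := by
    conv_lhs => rw [e]
    refine eLpNorm_sum_le (fun i _ => Continuous.aestronglyMeasurable ?_) (by norm_num)
    exact (continuous_single i).comp (hF i)
  refine h1.trans (Finset.sum_le_sum fun i _ => ?_)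
  refine eLpNorm_mono_ae (Filter.Eventually.of_forall fun x => ?_)
  rw [Pi.norm_single]

lemma W_cont {s : ℝ} (hs : 0 ≤ s) (a h : SchwartzMap (EE n) ℂ) : Continuous (W s a h) :=
  (fourierInv_cont (LF_nc hs _).integrable).sub
    (a.continuous.mul (fourierInv_cont (LF_nc hs _).integrable))

lemma LF_sum (s : ℝ) {ι : Type*} (t : Finset ι) (F : ι → SchwartzMap (EE n) ℂ) (hs : 0 ≤ s) (x : EE n) :
    𝓕⁻ (LF s (∑ j ∈ t, F j)) x = ∑ j ∈ t, 𝓕⁻ (LF s (F j)) x := by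
  simp only [Real.fourierInv_eq']
  rw [← integral_finsetSum]
  · congr 1; ext v
    unfold LF
    rw [ft_sum, sum_apply, Finset.mul_sum, Finset.smul_sum]
  · intro j _
    have := (LF_nc hs (F j)).integrable (μ := volume)
    refine this.norm.mono' ?_ (Filter.Eventually.of_forall fun v => ?_)
    · have h1 : Continuous (fun v : EE n => Complex.exp ((↑(2 * Real.pi * inner ℝ v x) * Complex.I))) := by fun_prop
      exact (h1.smul (LF_nc hs (F j)).cont).aestronglyMeasurable
    · rw [norm_smul, Complex.norm_exp_ofReal_mul_I, one_mul]

lemma component {s : ℝ} (hs : 1 ≤ s) (f g : SchwartzMap (EE n) (EE n)) (i : Fin n) (x : EE n) :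
    Lam s (fun y => ((∑ j, f y j *
              fderiv ℝ (fun z => g z i) y (EuclideanSpace.single j 1) : ℝ) : ℂ)) x
            - ∑ j, (f x j : ℂ) *
              fderiv ℝ (fun y => Lam s (fun z => ((g z i : ℝ) : ℂ)) y) x
                (EuclideanSpace.single j 1) = ∑ j, W s (cmp j f) (dl j (cmp i g)) x := by
  have h0 : 0 ≤ s := by linarith
  have e1 : (fun y => ((∑ j, f y j *
      fderiv ℝ (fun z => g z i) y (EuclideanSpace.single j 1) : ℝ) : ℂ)) =
      fun y => (∑ j, mulS (cmp j f) (dl j (cmp i g)) : SchwartzMap (EE n) ℂ) y := by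
    ext y
    rw [sum_apply]
    push_cast
    refine Finset.sum_congr rfl fun j _ => ?_
    rw [mulS_apply, cmp_apply, dl_apply, fderiv_cmp, fderiv_comp_real]
  have e2 : (fun y => Lam s (fun z => ((g z i : ℝ) : ℂ)) y) = 𝓕⁻ (LF s (cmp i g)) := by
    rw [← Lam_eq]; rfl
  rw [e1, Lam_eq, e2, LF_sum s _ _ h0, ← Finset.sum_sub_distrib]
  refine Finset.sum_congr rfl fun j _ => ?_
  unfold W
  rw [fderiv_inv (LF_nc h0 _), cmp_apply]
  have e3 : (fun ξ => (2 * Real.pi * Complex.I) * ((ξ j : ℝ) : ℂ) * LF s (cmp i g) ξ) =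
      LF s (dl j (cmp i g)) := by
    ext ξ
    unfold LF
    rw [ft_dl]; ring
  rw [e3]

lemma main (n : ℕ) (s : ℝ) (hs : 1 ≤ s) :
    ∃ C : ℝ, 0 < C ∧
    ∀ f g : SchwartzMap (EE n) (EE n),
      eLpNorm (fun x => (fun i =>
          Lam s (fun y => ((∑ j, f y j *
              fderiv ℝ (fun z => g z i) y (EuclideanSpace.single j 1) : ℝ) : ℂ)) x
            - ∑ j, (f x j : ℂ) *
              fderiv ℝ (fun y => Lam s (fun z => ((g z i : ℝ) : ℂ)) y) x
                (EuclideanSpace.single j 1) : Fin n → ℂ)) 2 volume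
        ≤ ENNReal.ofReal C *
          (eLpNorm (fun x => fderiv ℝ (⇑f) x) ⊤ volume *
              eLpNorm (fun x => (fun i => Lam s (fun z => ((g z i : ℝ) : ℂ)) x
                : Fin n → ℂ)) 2 volume
            + eLpNorm (fun x => (fun i => Lam s (fun z => ((f z i : ℝ) : ℂ)) x
                : Fin n → ℂ)) 2 volume *
              eLpNorm (fun x => fderiv ℝ (⇑g) x) ⊤ volume) := by
  have h0 : 0 ≤ s := by linarith
  obtain ⟨C, hC, hb⟩ := scalar_bound (n := n) hs
  refine ⟨(n * n + 1) * ((C + 1) * (2 * Real.pi)), by positivity, fun f g => ?_⟩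
  set A := eLpNorm (fun x => fderiv ℝ (⇑f) x) ⊤ volume with hA
  set B := eLpNorm (fun x => fderiv ℝ (⇑g) x) ⊤ volume with hB
  set G := eLpNorm (fun x => (fun i => Lam s (fun z => ((g z i : ℝ) : ℂ)) x
                : Fin n → ℂ)) 2 volume with hG
  set F := eLpNorm (fun x => (fun i => Lam s (fun z => ((f z i : ℝ) : ℂ)) x
                : Fin n → ℂ)) 2 volume with hF
  have key : ∀ (u : SchwartzMap (EE n) (EE n)) (i : Fin n), eLpNorm (LF s (cmp i u)) 2 volume ≤
      eLpNorm (fun x => (fun i => Lam s (fun z => ((u z i : ℝ) : ℂ)) x : Fin n → ℂ)) 2 volume := by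
    intro u i
    rw [← (LF_nc h0 (cmp i u)).plancherelInv, ← Lam_eq]
    exact eLpNorm_comp_le (F := fun x => (fun i => Lam s (fun z => ((u z i : ℝ) : ℂ)) x)) i
  have hpi1 : (1:ℝ) ≤ 2 * Real.pi := by linarith [Real.pi_gt_three]
  have hW : ∀ i j, eLpNorm (W s (cmp j f) (dl j (cmp i g))) 2 volume ≤
      ENNReal.ofReal ((C + 1) * (2 * Real.pi)) * (A * G + F * B) := by
    intro i j
    refine (hb _ _ _ _ _ (adm_cmp f g i j)).trans ?_
    rw [ENNReal.ofReal_toReal (fd_fin f), ENNReal.ofReal_toReal (fd_fin g)]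
    calc _ ≤ ENNReal.ofReal (C + 1) * (A * (ENNReal.ofReal (2 * Real.pi) * G) +
          ENNReal.ofReal (2 * Real.pi) * F * B) := by
          gcongr
          · linarith
          · exact (LF_dl hs j _).trans (mul_le_mul_right (key g i) _)
          · refine (key f j).trans ?_
            refine le_mul_of_one_le_left zero_le ?_
            rw [← ENNReal.ofReal_one]; exact ENNReal.ofReal_le_ofReal hpi1
      _ = _ := by
          rw [ENNReal.ofReal_mul (p := C + 1) (by positivity)]; ring
  simp only [component hs f g]
  refine (eLpNorm_pi_le fun i => continuous_finsetSum _ fun j _ => W_cont h0 _ _).trans ?_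
  have hi : ∀ i, eLpNorm (fun x => ∑ j, W s (cmp j f) (dl j (cmp i g)) x) 2 volume ≤
      ∑ j : Fin n, ENNReal.ofReal ((C + 1) * (2 * Real.pi)) * (A * G + F * B) := by
    intro i
    have e : (fun x => ∑ j, W s (cmp j f) (dl j (cmp i g)) x) =
        ∑ j, W s (cmp j f) (dl j (cmp i g)) := by ext x; simp
    rw [e]
    exact (eLpNorm_sum_le (fun j _ => (W_cont h0 _ _).aestronglyMeasurable) (by norm_num)).trans
      (Finset.sum_le_sum fun j _ => hW i j)
  refine (Finset.sum_le_sum fun i _ => hi i).trans ?_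
  simp only [Finset.sum_const, Finset.card_univ, Fintype.card_fin, nsmul_eq_mul]
  rw [ENNReal.ofReal_mul (p := (n * n + 1 : ℝ)) (by positivity), ← mul_assoc, mul_assoc _ _ (A * G + F * B)]
  gcongr
  calc (n:ℝ≥0∞) * n = ENNReal.ofReal (n * n) := by
        rw [ENNReal.ofReal_mul (by positivity), ENNReal.ofReal_natCast]
    _ ≤ _ := ENNReal.ofReal_le_ofReal (by linarith)

end KP

end Part14

/-- Kato–Ponce commutator estimate (case `p = 2`, `s ≥ 1`): there exists `C` such that for
Schwartz `f` and divergence-free Schwartz `g`,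
`‖Λˢ(f·∇g) − f·∇Λˢg‖_{L²} ≤ C(‖∇f‖_{L^∞}‖Λˢg‖_{L²} + ‖Λˢf‖_{L²}‖∇g‖_{L^∞})`. -/
theorem stmt14 (n : ℕ) (s : ℝ) (hs : 1 ≤ s) :
    ∃ C : ℝ, 0 < C ∧
    ∀ f g : SchwartzMap (EuclideanSpace ℝ (Fin n)) (EuclideanSpace ℝ (Fin n)),
      (∀ x, ∑ j, fderiv ℝ (fun y => g y j) x (EuclideanSpace.single j 1) = 0) →
      eLpNorm (fun x => (fun i =>
          Lam s (fun y => ((∑ j, f y j *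
              fderiv ℝ (fun z => g z i) y (EuclideanSpace.single j 1) : ℝ) : ℂ)) x
            - ∑ j, (f x j : ℂ) *
              fderiv ℝ (fun y => Lam s (fun z => ((g z i : ℝ) : ℂ)) y) x
                (EuclideanSpace.single j 1) : Fin n → ℂ)) 2 volume
        ≤ ENNReal.ofReal C *
          (eLpNorm (fun x => fderiv ℝ (⇑f) x) ⊤ volume *
              eLpNorm (fun x => (fun i => Lam s (fun z => ((g z i : ℝ) : ℂ)) x
                : Fin n → ℂ)) 2 volume
            + eLpNorm (fun x => (fun i => Lam s (fun z => ((f z i : ℝ) : ℂ)) x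
                : Fin n → ℂ)) 2 volume *
              eLpNorm (fun x => fderiv ℝ (⇑g) x) ⊤ volume) := by
  obtain ⟨C, hC, h⟩ := KP.main n s hs
  exact ⟨C, hC, fun f g _ => h f g⟩
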